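/- arXiv:1806.09437 — 2 statements merged into one kernel-verified Lean document; each statement's English description precedes it below -/
import Mathlib

section
/- Let n ≥ 3, m ≥ 2, and for each ε ∈ (0, 4/(n−2)) let u_ε be the radial Dirichlet solution with exactly m−1 interior zeros normalized so that u_ε(δ_{1,ε}) > 0, where δ_{1,ε} is its largest critical point and ρ_{2,ε} its largest interior zero. Define z_ε : (0,∞) → ℝ by z_ε(s) := u_ε( u_ε(δ_{1,ε})^{(1−p_ε)/2} · s ) / u_ε(δ_{1,ε}) if u_ε(δ_{1,ε})^{(p_ε−1)/2}·ρ_{2,ε} < s < u_ε(δ_{1,ε})^{(p_ε−1)/2}, and z_ε(s) := 0 otherwise. Then: (a) there exist a measurable v : (0,∞) → [0,∞) with ∫_0^∞ v(s)·s^{n−1} ds < ∞ and ε₀ ∈ (0, 4/(n−2)) such that |z_ε(s)|^{p_ε} ≤ v(s) and |z_ε(s)|^{p_ε+1} ≤ v(s) for all s > 0 and all ε ∈ (0, ε₀); (b) u_ε(δ_{1,ε})^{(p_ε−1)/2} → ∞ and δ_{1,ε}·u_ε(δ_{1,ε})^{(p_ε−1)/2} → 0 as ε → 0⁺; (c) for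 every compact K ⊂ (0,∞), z_ε → U in C²(K) as ε → 0⁺, where U(s) := (1 + s²/(n(n−2)))^{−(n−2)/2}. -/
open Real Set Filter Topology MeasureTheory

noncomputable section

/-- `κ_n = ((n-2)/4) · Γ(n/2)² / Γ(n)`. -/
def kappa (n : ℕ) : ℝ :=
  (((n : ℝ) - 2) / 4) * Real.Gamma ((n : ℝ) / 2) ^ 2 / Real.Gamma (n : ℝ)

/-- `p_ε = (n+2)/(n-2) - ε`. -/
def pEps (n : ℕ) (ε : ℝ) : ℝ := ((n : ℝ) + 2) / ((n : ℝ) - 2) - ε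

/-- `u ∈ C²([0,1])` is a radial solution of `-Δu = |u|^{p-1} u` on the unit ball of `ℝⁿ`,
written in the radial variable: `(r^{n-1} u')' = -|u|^{p-1} u · r^{n-1}` on `(0,1]`,
with `u'(0) = 0`. -/
def IsRadialSolution (n : ℕ) (p : ℝ) (u : ℝ → ℝ) : Prop :=
  ContDiffOn ℝ 2 u (Set.Icc 0 1) ∧ deriv u 0 = 0 ∧
    ∀ r ∈ Set.Ioc (0 : ℝ) 1,
      deriv (fun s => s ^ (n - 1) * deriv u s) r = -(|u r| ^ (p - 1) * u r * r ^ (n - 1))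

/-- Radial Dirichlet solution with exactly `m-1` interior zeros, together with the
decreasing enumeration of its zeros `ρ 1 = 1 > ρ 2 > … > ρ m > 0` in `(0,1]` and of its
critical points `1 > δ 1 > … > δ m = 0` in `[0,1]`, interlaced as
`0 = δ m < ρ m < δ (m-1) < … < δ 1 < ρ 1 = 1`. -/
def DirichletData (n : ℕ) (p : ℝ) (m : ℕ) (u : ℝ → ℝ) (ρ δ : ℕ → ℝ) : Prop :=
  IsRadialSolution n p u ∧ u 1 = 0 ∧ ρ 1 = 1 ∧ δ m = 0 ∧
    (∀ k, 1 ≤ k → k ≤ m → δ k < ρ k) ∧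
    (∀ k, 1 ≤ k → k + 1 ≤ m → ρ (k + 1) < δ k) ∧
    {r : ℝ | r ∈ Set.Ioc (0 : ℝ) 1 ∧ u r = 0} = ρ '' Set.Icc 1 m ∧
    {r : ℝ | r ∈ Set.Icc (0 : ℝ) 1 ∧ deriv u r = 0} = δ '' Set.Icc 1 m

/-- Radial Neumann solution with exactly `m-1` interior zeros, together with the
decreasing enumeration of its zeros `1 > ρ 1 > … > ρ (m-1) > 0` in `(0,1)` and of its
critical points `δ 1 = 1 > δ 2 > … > δ m = 0` in `[0,1]`, interlaced as
`0 = δ m < ρ (m-1) < δ (m-1) < … < ρ 1 < δ 1 = 1`. -/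
def NeumannData (n : ℕ) (p : ℝ) (m : ℕ) (u : ℝ → ℝ) (ρ δ : ℕ → ℝ) : Prop :=
  IsRadialSolution n p u ∧ deriv u 1 = 0 ∧ δ 1 = 1 ∧ δ m = 0 ∧
    (∀ k, 1 ≤ k → k ≤ m - 1 → ρ k < δ k) ∧
    (∀ k, 1 ≤ k → k ≤ m - 1 → δ (k + 1) < ρ k) ∧
    {r : ℝ | r ∈ Set.Ioo (0 : ℝ) 1 ∧ u r = 0} = ρ '' Set.Icc 1 (m - 1) ∧
    {r : ℝ | r ∈ Set.Icc (0 : ℝ) 1 ∧ deriv u r = 0} = δ '' Set.Icc 1 m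

/-- A nontrivial radial Dirichlet solution with exactly `m-1` interior zeros. -/
def DirichletSol (n : ℕ) (p : ℝ) (m : ℕ) (u : ℝ → ℝ) : Prop :=
  IsRadialSolution n p u ∧ u 1 = 0 ∧ (∃ r ∈ Set.Icc (0 : ℝ) 1, u r ≠ 0) ∧
    ∃ Z : Finset ℝ, (Z : Set ℝ) = {r | r ∈ Set.Ioo (0 : ℝ) 1 ∧ u r = 0} ∧ Z.card = m - 1

/-- A nontrivial radial Neumann solution with exactly `m-1` interior zeros. -/
def NeumannSol (n : ℕ) (p : ℝ) (m : ℕ) (u : ℝ → ℝ) : Prop :=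
  IsRadialSolution n p u ∧ deriv u 1 = 0 ∧ (∃ r ∈ Set.Icc (0 : ℝ) 1, u r ≠ 0) ∧
    ∃ Z : Finset ℝ, (Z : Set ℝ) = {r | r ∈ Set.Ioo (0 : ℝ) 1 ∧ u r = 0} ∧ Z.card = m - 1

/-- The standard normalized Aubin–Talenti bubble `U(s) = (1 + s²/(n(n-2)))^{-(n-2)/2}`. -/
def bubble (n : ℕ) (s : ℝ) : ℝ :=
  (1 + s ^ 2 / ((n : ℝ) * ((n : ℝ) - 2))) ^ (-(((n : ℝ) - 2) / 2))

/-- Working interface for radial solutions: `u`, its derivative `g`, dimension `j+3`. -/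
structure RSol (j : ℕ) (p : ℝ) (u g : ℝ → ℝ) : Prop where
  cu : ContinuousOn u (Icc 0 1)
  cg : ContinuousOn g (Icc 0 1)
  du : ∀ r ∈ Ioo (0:ℝ) 1, HasDerivAt u (g r) r
  dg : ∀ r ∈ Ioo (0:ℝ) 1, HasDerivAt g (-(((j:ℝ)+2)/r * g r) - |u r|^(p-1) * u r) r

lemma rsol_of {j : ℕ} {p : ℝ} {u : ℝ → ℝ} (h : IsRadialSolution (j+3) p u) :
    RSol j p u (derivWithin u (Icc 0 1)) ∧ ∀ r ∈ Ioo (0:ℝ) 1, derivWithin u (Icc 0 1) r = deriv u r := by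
  obtain ⟨hC, -, hode⟩ := h
  have hU : UniqueDiffOn ℝ (Icc (0:ℝ) 1) := uniqueDiffOn_Icc one_pos
  have h1 : ContDiffOn ℝ 1 (derivWithin u (Icc 0 1)) (Icc 0 1) :=
    hC.derivWithin hU (by norm_num)
  have heq : ∀ r ∈ Ioo (0:ℝ) 1, derivWithin u (Icc 0 1) r = deriv u r := fun r hr =>
    derivWithin_of_mem_nhds (Icc_mem_nhds hr.1 hr.2)
  refine ⟨⟨hC.continuousOn, h1.continuousOn, ?_, ?_⟩, heq⟩
  · intro r hr
    rw [heq r hr]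
    exact ((hC.differentiableOn (by norm_num) r (Ioo_subset_Icc_self hr)).differentiableAt
      (Icc_mem_nhds hr.1 hr.2)).hasDerivAt
  · intro r hr
    have hd : DifferentiableAt ℝ (derivWithin u (Icc 0 1)) r :=
      ((h1.differentiableOn (by norm_num) r (Ioo_subset_Icc_self hr)).differentiableAt
      (Icc_mem_nhds hr.1 hr.2))
    have ho := hode r ⟨hr.1, hr.2.le⟩
    have hev : (fun s => s ^ (j+3-1) * deriv u s) =ᶠ[𝓝 r]
        (fun s => s ^ (j+2) * derivWithin u (Icc 0 1) s) := by
      filter_upwards [Ioo_mem_nhds hr.1 hr.2] with s hs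
      rw [heq s hs]; rfl
    rw [hev.deriv_eq] at ho
    have hD := ((hasDerivAt_pow (j+2) r).mul hd.hasDerivAt).deriv
    have hD' : deriv (fun s => s ^ (j+2) * derivWithin u (Icc 0 1) s) r = _ := hD
    rw [hD'] at ho
    have hr0 : r ≠ 0 := hr.1.ne'
    have key : deriv (derivWithin u (Icc 0 1)) r =
        -(((j:ℝ)+2)/r * derivWithin u (Icc 0 1) r) - |u r|^(p-1) * u r := by
      have e1 : (j+3-1) = j+2 := rfl
      have e2 : (j+2-1) = j+1 := rfl
      rw [e1] at ho; simp only [e2] at ho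
      push_cast at ho
      have hp : r^(j+1) ≠ 0 := pow_ne_zero _ hr0
      field_simp
      apply mul_left_cancel₀ hp
      have : r^(j+2) = r^(j+1) * r := pow_succ _ _
      rw [this] at ho
      linear_combination ho
    rw [← key]; exact hd.hasDerivAt

lemma abs_rpow_split (x : ℝ) {p : ℝ} (hp : 1 < p) : |x|^(p+1) = |x|^(p-1) * x^2 := by
  rcases eq_or_ne x 0 with rfl | hx
  · simp; rw [Real.zero_rpow (by linarith)]
  · rw [show p + 1 = (p-1) + 2 by ring, Real.rpow_add (abs_pos.2 hx)]
    congr 1; rw [← sq_abs]; norm_num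

/-- Pohozaev-type positivity. -/
lemma pohozaev {j : ℕ} {p : ℝ} {u g : ℝ → ℝ} (h : RSol j p u g) (hp : 1 < p)
    (hc : (p+1) * ((j:ℝ)+1) ≤ 2 * ((j:ℝ)+3)) :
    ∀ r ∈ Ioo (0:ℝ) 1, 0 ≤ (r * g r)^2/2 + ((j:ℝ)+1)/2 * (r * g r) * u r
      + r^2 * (|u r|^(p-1) * (u r)^2)/(p+1) := by
  have hp1 : (0:ℝ) < p + 1 := by linarith
  set P : ℝ → ℝ := fun r => r^(j+1) * ((r * g r)^2/2 + ((j:ℝ)+1)/2 * (r * g r) * u r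
      + r^2 * |u r|^(p+1)/(p+1)) with hP
  have hmono : MonotoneOn P (Icc 0 1) := by
    have habs : ContinuousOn (fun r => |u r|^(p+1)) (Icc 0 1) :=
      h.cu.abs.rpow_const (fun x _ => Or.inr hp1.le)
    have hcont : ContinuousOn P (Icc 0 1) := by
      have := h.cu; have := h.cg
      simp only [hP]; fun_prop
    have hder : ∀ r ∈ Ioo (0:ℝ) 1, HasDerivAt P
        (r^(j+2) * |u r|^(p+1) * ((((j:ℝ)+3))/(p+1) - ((j:ℝ)+1)/2)) r := by
      intro r hr
      have d1 := h.du r hr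
      have d2 := h.dg r hr
      have d3 : HasDerivAt (fun r => |u r|^(p+1)) ((p+1) * |u r|^(p+1-2) * u r * g r) r :=
        (hasDerivAt_abs_rpow (u r) (by linarith)).comp r d1
      have d4 := (hasDerivAt_id r).mul d2
      have d5 := ((hasDerivAt_pow (j+1) r).mul (((d4.pow 2).div_const 2).add
        (((d4.const_mul (((j:ℝ)+1)/2)).mul d1)) |>.add
          (((hasDerivAt_pow 2 r).mul d3).div_const (p+1))))
      have d6 := d5.congr_deriv (g' := (r^(j+2) * |u r|^(p+1) * ((((j:ℝ)+3))/(p+1) - ((j:ℝ)+1)/2))) ?_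
      · exact d6
      · have hr0 : r ≠ 0 := hr.1.ne'
        simp only [Pi.mul_apply, Pi.add_apply, Pi.pow_apply, id]
        rw [show p + 1 - 2 = p - 1 by ring, abs_rpow_split _ hp]
        simp only [Nat.add_sub_cancel, pow_succ]
        push_cast
        field_simp
        ring
    apply monotoneOn_of_deriv_nonneg (convex_Icc 0 1) hcont
    · intro r hr; rw [interior_Icc] at hr
      exact (hder r hr).differentiableAt.differentiableWithinAt
    · intro r hr; rw [interior_Icc] at hr
      rw [(hder r hr).deriv]
      have hr1 := hr.1
      apply mul_nonneg (by positivity)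
      rw [sub_nonneg, le_div_iff₀ hp1]; linarith
  intro r hr
  have h0 : P 0 ≤ P r := hmono (by simp) (Ioo_subset_Icc_self hr) hr.1.le
  have : P 0 = 0 := by simp [hP]
  rw [this] at h0
  have hr1 := hr.1
  have := (mul_nonneg_iff_of_pos_left (by positivity : 0 < r^(j+1))).1 h0
  rwa [abs_rpow_split _ hp] at this

/-- logarithmic derivative is antitone on nodal domains -/
lemma logder_antitone {j : ℕ} {p : ℝ} {u g : ℝ → ℝ} (h : RSol j p u g) (hp : 1 < p)
    (hc : (p+1) * ((j:ℝ)+1) ≤ 2 * ((j:ℝ)+3)) {a b : ℝ} (ha : 0 ≤ a) (hb : b ≤ 1)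
    (hne : ∀ r ∈ Ioo a b, u r ≠ 0) : AntitoneOn (fun r => r * g r / u r) (Ioo a b) := by
  have hsub : Ioo a b ⊆ Ioo 0 1 := Ioo_subset_Ioo ha hb
  have hder : ∀ r ∈ Ioo a b, HasDerivAt (fun r => r * g r / u r)
      (-((r * g r)^2 + ((j:ℝ)+1) * (r * g r) * u r + r^2 * (|u r|^(p-1) * (u r)^2)) / (r * (u r)^2)) r := by
    intro r hr
    have hr' := hsub hr
    have d := ((hasDerivAt_id r).mul (h.dg r hr')).div (h.du r hr') (hne r hr)
    refine d.congr_deriv ?_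
    have := hne r hr
    have hr0 : r ≠ 0 := hr'.1.ne'
    simp only [Pi.mul_apply, id]
    field_simp
    ring
  apply antitoneOn_of_deriv_nonpos (convex_Ioo a b)
  · exact fun r hr => (hder r hr).continuousAt.continuousWithinAt
  · intro r hr; rw [interior_Ioo] at hr
    exact (hder r hr).differentiableAt.differentiableWithinAt
  · intro r hr; rw [interior_Ioo] at hr
    rw [(hder r hr).deriv]
    have hr' := hsub hr
    have hP := pohozaev h hp hc r hr'
    have hr1 := hr'.1
    apply div_nonpos_of_nonpos_of_nonneg _ (by positivity)
    set Y := r^2 * (|u r|^(p-1) * (u r)^2) with hY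
    have hY0 : 0 ≤ Y := by positivity
    have : Y / (p+1) ≤ Y / 2 := by
      apply div_le_div_of_nonneg_left hY0 (by norm_num) (by linarith)
    nlinarith
/-- Emden-Fowler coordinates -/
def efF (α : ℝ) (u : ℝ → ℝ) (r : ℝ) : ℝ := r^α * u r
def efG (α : ℝ) (u g : ℝ → ℝ) (r : ℝ) : ℝ := r^α * (r * g r + α * u r)
def efE (j : ℕ) (p α : ℝ) (u g : ℝ → ℝ) (r : ℝ) : ℝ :=
  (efG α u g r)^2/2 - α * ((j:ℝ)+1-α) * (efF α u r)^2/2 + |efF α u r|^(p+1)/(p+1)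

lemma efF_der {j : ℕ} {p α : ℝ} {u g : ℝ → ℝ} (h : RSol j p u g) {r : ℝ} (hr : r ∈ Ioo (0:ℝ) 1) :
    HasDerivAt (efF α u) (efG α u g r / r) r := by
  have hr0 : 0 < r := hr.1
  have d1 := (Real.hasDerivAt_rpow_const (x := r) (p := α) (Or.inl hr0.ne')).mul (h.du r hr)
  refine d1.congr_deriv ?_
  rw [Real.rpow_sub_one hr0.ne', efG]
  field_simp
  ring

lemma efG_der {j : ℕ} {p α : ℝ} {u g : ℝ → ℝ} (h : RSol j p u g) (hp : 1 < p)
    (hα : α * (p - 1) = 2) {r : ℝ} (hr : r ∈ Ioo (0:ℝ) 1) :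
    HasDerivAt (efG α u g) (((2*α - ((j:ℝ)+1)) * efG α u g r + α * ((j:ℝ)+1-α) * efF α u r
      - |efF α u r|^(p-1) * efF α u r) / r) r := by
  have hr0 : 0 < r := hr.1
  have d1 := (Real.hasDerivAt_rpow_const (x := r) (p := α) (Or.inl hr0.ne')).mul
    ((((hasDerivAt_id r).mul (h.dg r hr))).add ((h.du r hr).const_mul α))
  refine d1.congr_deriv ?_
  have e : |efF α u r|^(p-1) = r^2 * |u r|^(p-1) := by
    rw [efF, abs_mul, abs_of_pos (Real.rpow_pos_of_pos hr0 α),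
      Real.mul_rpow (by positivity) (abs_nonneg _), ← Real.rpow_mul hr0.le, hα]
    norm_num
  rw [e, Real.rpow_sub_one hr0.ne', efG, efF]
  simp only [Pi.mul_apply, Pi.add_apply, id]
  field_simp
  ring

lemma efE_der {j : ℕ} {p α : ℝ} {u g : ℝ → ℝ} (h : RSol j p u g) (hp : 1 < p)
    (hα : α * (p - 1) = 2) {r : ℝ} (hr : r ∈ Ioo (0:ℝ) 1) :
    HasDerivAt (efE j p α u g) ((2*α - ((j:ℝ)+1)) * (efG α u g r)^2 / r) r := by
  have hr0 : 0 < r := hr.1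
  have dF := efF_der (α := α) h hr
  have dG := efG_der h hp hα hr
  have d3 : HasDerivAt (fun r => |efF α u r|^(p+1)) ((p+1) * |efF α u r|^(p+1-2) * efF α u r *
      (efG α u g r / r)) r :=
    (hasDerivAt_abs_rpow (efF α u r) (by linarith)).comp r dF
  have d := (((dG.pow 2).div_const 2).sub (((dF.pow 2).const_mul (α * ((j:ℝ)+1-α))).div_const 2)).add
    (d3.div_const (p+1))
  refine d.congr_deriv ?_
  have : p + 1 ≠ 0 := by linarith
  rw [show p + 1 - 2 = p - 1 by ring]
  push_cast
  field_simp
  ring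

lemma efF_cont {j : ℕ} {p α : ℝ} {u g : ℝ → ℝ} (h : RSol j p u g) (hα : 0 < α) :
    ContinuousOn (efF α u) (Icc 0 1) := by
  have := h.cu
  have h2 : ContinuousOn (fun r : ℝ => r^α) (Icc 0 1) :=
    continuousOn_id.rpow_const (fun x _ => Or.inr hα.le)
  unfold efF; fun_prop

lemma efG_cont {j : ℕ} {p α : ℝ} {u g : ℝ → ℝ} (h : RSol j p u g) (hα : 0 < α) :
    ContinuousOn (efG α u g) (Icc 0 1) := by
  have := h.cu
  have := h.cg
  have h2 : ContinuousOn (fun r : ℝ => r^α) (Icc 0 1) :=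
    continuousOn_id.rpow_const (fun x _ => Or.inr hα.le)
  unfold efG; fun_prop

lemma efE_cont {j : ℕ} {p α : ℝ} {u g : ℝ → ℝ} (h : RSol j p u g) (hα : 0 < α) (hp : 1 < p) :
    ContinuousOn (efE j p α u g) (Icc 0 1) := by
  have h1 := efF_cont h hα
  have h2 := efG_cont h hα
  have h3 : ContinuousOn (fun r => |efF α u r|^(p+1)) (Icc 0 1) :=
      h1.abs.rpow_const (fun x _ => Or.inr (by linarith))
  unfold efE; fun_prop

lemma efE_zero {j : ℕ} {p α : ℝ} {u g : ℝ → ℝ} (hα : 0 < α) (hp : 1 < p) :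
    efE j p α u g 0 = 0 := by
  have : (0:ℝ)^α = 0 := Real.zero_rpow hα.ne'
  have h2 : (0:ℝ)^(p+1) = 0 := Real.zero_rpow (by linarith)
  simp [efE, efF, efG, this, h2]

lemma efE_mono {j : ℕ} {p α : ℝ} {u g : ℝ → ℝ} (h : RSol j p u g) (hp : 1 < p)
    (hα : α * (p - 1) = 2) (hη : (j:ℝ)+1 ≤ 2 * α) : MonotoneOn (efE j p α u g) (Icc 0 1) := by
  have hα0 : 0 < α := by have : (0:ℝ) ≤ j := Nat.cast_nonneg j
                         linarith
  apply monotoneOn_of_deriv_nonneg (convex_Icc 0 1) (efE_cont h hα0 hp)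
  · intro r hr; rw [interior_Icc] at hr
    exact (efE_der h hp hα hr).differentiableAt.differentiableWithinAt
  · intro r hr; rw [interior_Icc] at hr
    rw [(efE_der h hp hα hr).deriv]
    have := hr.1
    have : 0 ≤ 2 * α - ((j:ℝ)+1) := by linarith
    positivity

/-- the uniform bound constant -/
lemma ef_bounds {j : ℕ} : ∃ C : ℝ, 1 ≤ C ∧ ∀ (p α x y : ℝ), 1 < p → 2 ≤ (p - 1) * ((j:ℝ)+1) → p + 1 ≤ 6 →
    ∀ E, E = y^2/2 - α * ((j:ℝ)+1-α) * x^2/2 + |x|^(p+1)/(p+1) → 0 ≤ E →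
      x^2 ≤ C^2 * (1 + E) ∧ y^2 ≤ C^2 * (1+E) := by
  set B : ℝ := ((j:ℝ)+1)^2/4 with hB
  have hB0 : 0 ≤ B := by positivity
  set T : ℝ := 3 * (B+1) with hT
  set X : ℝ := T^(((j:ℝ)+1)/2) with hX
  set D : ℝ := 2 + X^2 with hD
  refine ⟨2 + D + B * D, ?_, ?_⟩
  · have : 0 ≤ D := by positivity
    nlinarith [mul_nonneg hB0 this]
  intro p α x y hp hp2 hp6 E hE hE0
  have hβ : α * ((j:ℝ)+1-α) ≤ B := by
    rw [hB]; nlinarith [sq_nonneg (α - ((j:ℝ)+1)/2)]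
  have hx : x^2 ≤ D * (1+E) := by
    rw [abs_rpow_split _ hp] at hE
    by_cases hc : T ≤ |x|^(p-1)
    · have h1 : T/6 * x^2 ≤ |x|^(p-1) * x^2/(p+1) := by
        rw [le_div_iff₀ (by linarith)]
        have : T / 6 * x^2 * (p+1) ≤ T * x^2 := by
          have : 0 ≤ T * x^2 := by positivity
          nlinarith
        have := mul_le_mul_of_nonneg_right hc (sq_nonneg x)
        linarith
      have h2 : x^2 ≤ 2 * E := by
        have := mul_le_mul_of_nonneg_right hβ (sq_nonneg x)
        nlinarith [sq_nonneg y]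
      have : 0 ≤ X^2 * (1+E) := by positivity
      rw [hD]; nlinarith
    · push Not at hc
      have h1 : |x| ≤ X := by
        have e : |x| = (|x|^(p-1))^(1/(p-1)) := by
          rw [← Real.rpow_mul (abs_nonneg _)]
          rw [mul_one_div_cancel (by linarith), Real.rpow_one]
        rw [e]
        calc (|x|^(p-1))^(1/(p-1)) ≤ T^(1/(p-1)) := by
              apply Real.rpow_le_rpow (by positivity) hc.le
              have : 0 < p - 1 := by linarith
              positivity
          _ ≤ X := by
              apply Real.rpow_le_rpow_of_exponent_le
              · linarith
              · rw [div_le_iff₀ (by linarith)]; linarith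
      have h2 : x^2 ≤ X^2 := by
        rw [← sq_abs]; exact pow_le_pow_left₀ (abs_nonneg _) h1 2
      have : 0 ≤ X^2 * E := by positivity
      rw [hD]; nlinarith
  have hy : y^2 ≤ (2 + B * D) * (1+E) := by
    have h1 := mul_le_mul_of_nonneg_right hβ (sq_nonneg x)
    have h2 := mul_le_mul_of_nonneg_left hx hB0
    have h3 : 0 ≤ |x|^(p+1)/(p+1) := by
      have : 0 < p + 1 := by linarith
      positivity
    nlinarith
  have hD0 : 0 ≤ D := by positivity
  have hBD : 0 ≤ B * D := by positivity
  have hE1 : 0 ≤ 1 + E := by linarith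
  constructor
  · refine hx.trans (mul_le_mul_of_nonneg_right ?_ hE1)
    nlinarith
  · refine hy.trans (mul_le_mul_of_nonneg_right ?_ hE1)
    nlinarith

/-- growth of the energy along one monotone piece -/
lemma ef_piece {j : ℕ} {p α C : ℝ} {u g : ℝ → ℝ} (h : RSol j p u g) (hp : 1 < p)
    (hα : α * (p - 1) = 2) (hη : (j:ℝ)+1 ≤ 2 * α) (hC : 1 ≤ C)
    (hb : ∀ r ∈ Icc (0:ℝ) 1, (efF α u r)^2 ≤ C^2 * (1 + efE j p α u g r) ∧
      (efG α u g r)^2 ≤ C^2 * (1 + efE j p α u g r))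
    {c d σ : ℝ} (hc : 0 ≤ c) (hcd : c ≤ d) (hd : d ≤ 1) (hσ : |σ| = 1)
    (hG : ∀ r ∈ Ioo c d, 0 ≤ σ * efG α u g r) :
    √(1 + efE j p α u g d) * (1 - (2*α - ((j:ℝ)+1)) * C^2) ≤
      √(1 + efE j p α u g c) * (1 + (2*α - ((j:ℝ)+1)) * C^2) := by
  set η := 2*α - ((j:ℝ)+1) with hηd
  have hη0 : 0 ≤ η := by linarith
  have hα0 : 0 < α := by have : (0:ℝ) ≤ j := Nat.cast_nonneg j
                         linarith
  set E := efE j p α u g with hE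
  have hEpos : ∀ r ∈ Icc (0:ℝ) 1, 0 ≤ E r := by
    intro r hr
    have := efE_mono h hp hα hη (by simp) hr hr.1
    rwa [efE_zero hα0 hp] at this
  have hsub : Icc c d ⊆ Icc 0 1 := Icc_subset_Icc hc hd
  have hsub' : Ioo c d ⊆ Ioo 0 1 := Ioo_subset_Ioo hc hd
  have hder : ∀ r ∈ Ioo c d, HasDerivAt (fun r => √(1 + E r) - η * C * (σ * efF α u r))
      (η * (efG α u g r)^2 / r / (2 * √(1 + E r)) - η * C * (σ * (efG α u g r / r))) r := by
    intro r hr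
    have hpos := hEpos r (hsub (Ioo_subset_Icc_self hr))
    exact (((efE_der h hp hα (hsub' hr)).const_add 1).sqrt (by change 1 + E r ≠ 0; linarith)).sub
      (((efF_der h (hsub' hr)).const_mul σ).const_mul (η * C))
  have hF : ∀ r ∈ Icc (0:ℝ) 1, |efF α u r| ≤ C * √(1 + E r) := by
    intro r hr
    have := hEpos r hr
    apply abs_le_of_sq_le_sq _ (by positivity)
    rw [mul_pow, Real.sq_sqrt (by linarith)]
    exact (hb r hr).1
  have hG' : ∀ r ∈ Icc (0:ℝ) 1, |efG α u g r| ≤ C * √(1 + E r) := by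
    intro r hr
    have := hEpos r hr
    apply abs_le_of_sq_le_sq _ (by positivity)
    rw [mul_pow, Real.sq_sqrt (by linarith)]
    exact (hb r hr).2
  have hanti : AntitoneOn (fun r => √(1 + E r) - η * C * (σ * efF α u r)) (Icc c d) := by
    apply antitoneOn_of_deriv_nonpos (convex_Icc c d)
    · have h1 := (efE_cont h hα0 hp).mono hsub
      have h2 := (efF_cont h hα0).mono hsub
      have h3 : ContinuousOn (fun r => √(1 + E r)) (Icc c d) := (continuousOn_const.add h1).sqrt
      fun_prop
    · intro r hr; rw [interior_Icc] at hr
      exact (hder r hr).differentiableAt.differentiableWithinAt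
    · intro r hr; rw [interior_Icc] at hr
      rw [(hder r hr).deriv]
      have hr0 := (hsub' hr).1
      have hrI := hsub (Ioo_subset_Icc_self hr)
      have hpos := hEpos r hrI
      have hS : 0 < √(1 + E r) := Real.sqrt_pos.2 (by linarith)
      have e1 : σ * efG α u g r = |efG α u g r| := by
        rw [← abs_of_nonneg (hG r hr), abs_mul, hσ, one_mul]
      have e2 : (efG α u g r)^2 = |efG α u g r| * |efG α u g r| := by
        rw [← sq_abs]; ring
      have e3 : σ * (efG α u g r / r) = |efG α u g r| / r := by rw [← e1]; ring
      rw [e3, e2, sub_nonpos, div_le_iff₀ (by positivity)]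
      have h1 := hG' r hrI
      have h2 := abs_nonneg (efG α u g r)
      have e4 : η * (|efG α u g r| * |efG α u g r|) / r = η * |efG α u g r| / r * |efG α u g r| := by ring
      have e5 : η * C * (|efG α u g r| / r) * (2 * √(1 + E r)) =
        η * |efG α u g r| / r * (2 * (C * √(1 + E r))) := by ring
      rw [e4, e5]
      apply mul_le_mul_of_nonneg_left _ (by positivity)
      nlinarith [mul_nonneg (by linarith : 0 ≤ C) hS.le]
  have hfin := hanti (left_mem_Icc.2 hcd) (right_mem_Icc.2 hcd) hcd
  simp only at hfin
  have hFc := hF c (hsub (left_mem_Icc.2 hcd))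
  have hFd := hF d (hsub (right_mem_Icc.2 hcd))
  have k1 : σ * efF α u d ≤ C * √(1 + E d) := by
    refine (le_abs_self _).trans ?_
    rw [abs_mul, hσ, one_mul]; exact hFd
  have k2 : -(C * √(1 + E c)) ≤ σ * efF α u c := by
    have : |σ * efF α u c| ≤ C * √(1 + E c) := by rw [abs_mul, hσ, one_mul]; exact hFc
    exact (abs_le.1 this).1
  have hηC : 0 ≤ η * C := by positivity
  have := mul_le_mul_of_nonneg_left k1 hηC
  have := mul_le_mul_of_nonneg_left k2 hηC
  nlinarith

lemma antitone_split {f : ℝ → ℝ} {a b : ℝ} (hab : a ≤ b) (hf : AntitoneOn f (Ioo a b)) :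
    ∃ t ∈ Icc a b, (∀ r ∈ Ioo a t, 0 ≤ f r) ∧ (∀ r ∈ Ioo t b, f r ≤ 0) := by
  set S : Set ℝ := insert a {r ∈ Ioo a b | 0 ≤ f r} with hS
  have hbdd : ∀ x ∈ S, x ≤ b := by
    rintro x (rfl | hx)
    · exact hab
    · exact hx.1.2.le
  have hne : S.Nonempty := ⟨a, Or.inl rfl⟩
  have hB : BddAbove S := ⟨b, hbdd⟩
  refine ⟨sSup S, ⟨le_csSup hB (Or.inl rfl), csSup_le hne hbdd⟩, ?_, ?_⟩
  · intro r hr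
    obtain ⟨x, hx, hrx⟩ := exists_lt_of_lt_csSup hne hr.2
    rcases hx with rfl | hx
    · exact absurd hr.1 (not_lt.2 hrx.le)
    · exact hx.2.trans (hf ⟨hr.1, hrx.trans hx.1.2⟩ hx.1 hrx.le)
  · intro r hr
    by_contra hcon
    push Not at hcon
    have ha : a < r := (le_csSup hB (Or.inl rfl)).trans_lt hr.1
    exact absurd (le_csSup hB (Or.inr ⟨⟨ha, hr.2⟩, hcon.le⟩ : r ∈ S)) (not_le.2 hr.1)

/-- growth of the energy along a nodal domain -/
lemma ef_bump {j : ℕ} {p α C : ℝ} {u g : ℝ → ℝ} (h : RSol j p u g) (hp : 1 < p)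
    (hcr : (p+1) * ((j:ℝ)+1) ≤ 2 * ((j:ℝ)+3))
    (hα : α * (p - 1) = 2) (hη : (j:ℝ)+1 ≤ 2 * α) (hC : 1 ≤ C)
    (hb : ∀ r ∈ Icc (0:ℝ) 1, (efF α u r)^2 ≤ C^2 * (1 + efE j p α u g r) ∧
      (efG α u g r)^2 ≤ C^2 * (1 + efE j p α u g r))
    (hsm : (2*α - ((j:ℝ)+1)) * C^2 < 1)
    {c d : ℝ} (hc : 0 ≤ c) (hcd : c ≤ d) (hd : d ≤ 1) (hne : ∀ r ∈ Ioo c d, u r ≠ 0) :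
    √(1 + efE j p α u g d) ≤ √(1 + efE j p α u g c) *
      ((1 + (2*α - ((j:ℝ)+1)) * C^2) / (1 - (2*α - ((j:ℝ)+1)) * C^2))^2 := by
  have hα0 : 0 < α := by have : (0:ℝ) ≤ j := Nat.cast_nonneg j
                         linarith
  have hanti := logder_antitone h hp hcr hc hd hne
  have hanti2 : AntitoneOn (fun r => r * g r / u r + α) (Ioo c d) := hanti.add_const α
  obtain ⟨t, ht, h1, h2⟩ := antitone_split hcd hanti2
  -- constant sign of u
  obtain ⟨σ, hσ, hσu⟩ : ∃ σ : ℝ, |σ| = 1 ∧ ∀ r ∈ Ioo c d, 0 < σ * u r := by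
    rcases eq_or_lt_of_le hcd with rfl | hlt
    · exact ⟨1, by simp, fun r hr => by simp at hr⟩
    have hcont : ContinuousOn u (Ioo c d) :=
      h.cu.mono (Ioo_subset_Icc_self.trans (Icc_subset_Icc hc hd))
    have hm : (c+d)/2 ∈ Ioo c d := ⟨by linarith, by linarith⟩
    rcases lt_or_gt_of_ne (hne _ hm) with hneg | hpos
    · refine ⟨-1, by simp, fun r hr => ?_⟩
      by_contra hcon
      have h0 : 0 ≤ u r := by linarith
      obtain ⟨x, hx, hx0⟩ := isPreconnected_Ioo.intermediate_value hm hr hcont ⟨hneg.le, h0⟩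
      exact hne x hx hx0
    · refine ⟨1, by simp, fun r hr => ?_⟩
      by_contra hcon
      have h0 : u r ≤ 0 := by linarith
      obtain ⟨x, hx, hx0⟩ := isPreconnected_Ioo.intermediate_value hr hm hcont ⟨h0, hpos.le⟩
      exact hne x hx hx0
  have hGe : ∀ r ∈ Ioo c d, efG α u g r = r^α * u r * (r * g r / u r + α) := by
    intro r hr
    have := hne r hr
    rw [efG]; field_simp
  have p1 := ef_piece h hp hα hη hC hb (c := c) (d := t) (σ := σ) hc ht.1 (ht.2.trans hd) hσ (by
    intro r hr
    have hr' : r ∈ Ioo c d := ⟨hr.1, hr.2.trans_le ht.2⟩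
    have hr0 : 0 < r := hc.trans_lt hr.1
    rw [hGe r hr', show σ * (r^α * u r * (r * g r / u r + α)) =
      r^α * (σ * u r) * (r * g r / u r + α) by ring]
    have := hσu r hr'
    have := h1 r hr
    have := Real.rpow_pos_of_pos hr0 α
    positivity)
  have p2 := ef_piece h hp hα hη hC hb (c := t) (d := d) (σ := -σ) (hc.trans ht.1) ht.2 hd (by simpa using hσ) (by
    intro r hr
    have hr' : r ∈ Ioo c d := ⟨ht.1.trans_lt hr.1, hr.2⟩
    have hr0 : 0 < r := hc.trans_lt hr'.1
    rw [hGe r hr', show -σ * (r^α * u r * (r * g r / u r + α)) =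
      r^α * (σ * u r) * (-(r * g r / u r + α)) by ring]
    have := hσu r hr'
    have : 0 ≤ -(r * g r / u r + α) := by have := h2 r hr; linarith
    have := Real.rpow_pos_of_pos hr0 α
    positivity)
  set θ := (2*α - ((j:ℝ)+1)) * C^2 with hθ
  have hθ1 : 0 < 1 - θ := by linarith
  have hθ0 : 0 ≤ θ := by
    have : 0 ≤ 2*α - ((j:ℝ)+1) := by linarith
    positivity
  rw [div_pow, ← mul_div_assoc, le_div_iff₀ (by positivity)]
  calc _ = (√(1 + efE j p α u g d) * (1 - θ)) * (1 - θ) := by ring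
    _ ≤ (√(1 + efE j p α u g t) * (1 + θ)) * (1 - θ) := mul_le_mul_of_nonneg_right p2 hθ1.le
    _ = (√(1 + efE j p α u g t) * (1 - θ)) * (1 + θ) := by ring
    _ ≤ (√(1 + efE j p α u g c) * (1 + θ)) * (1 + θ) := mul_le_mul_of_nonneg_right p1 (by linarith)
    _ = _ := by ring
lemma rho_anti {n m : ℕ} {p : ℝ} {u : ℝ → ℝ} {ρ δ : ℕ → ℝ} (h : DirichletData n p m u ρ δ)
    {i k : ℕ} (hi : 1 ≤ i) (hik : i ≤ k) (hk : k ≤ m) : ρ k ≤ ρ i := by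
  obtain ⟨-, -, -, -, h1, h2, -, -⟩ := h
  induction k, hik using Nat.le_induction with
  | base => exact le_rfl
  | succ k hik ih =>
    exact ((h2 k (hi.trans hik) hk).trans (h1 k (hi.trans hik) (by omega))).le.trans (ih (by omega))

lemma rho_mem {n m : ℕ} {p : ℝ} {u : ℝ → ℝ} {ρ δ : ℕ → ℝ} (h : DirichletData n p m u ρ δ)
    {i : ℕ} (hi : 1 ≤ i) (hk : i ≤ m) : ρ i ∈ Ioc (0:ℝ) 1 ∧ u (ρ i) = 0 := by
  obtain ⟨-, -, -, -, -, -, h1, -⟩ := h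
  have : ρ i ∈ {r : ℝ | r ∈ Set.Ioc (0 : ℝ) 1 ∧ u r = 0} := by
    rw [h1]; exact ⟨i, ⟨hi, hk⟩, rfl⟩
  exact this

lemma no_zero {n m : ℕ} {p : ℝ} {u : ℝ → ℝ} {ρ δ : ℕ → ℝ} (h : DirichletData n p m u ρ δ)
    {k : ℕ} (hi : 1 ≤ k) (hk : k + 1 ≤ m) : ∀ r ∈ Ioo (ρ (k+1)) (ρ k), u r ≠ 0 := by
  intro r hr h0
  have hm1 := (rho_mem h (by omega) hk).1
  have hm2 := (rho_mem h hi (by omega)).1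
  have hr' : r ∈ {r : ℝ | r ∈ Set.Ioc (0 : ℝ) 1 ∧ u r = 0} :=
    ⟨⟨hm1.1.trans hr.1, hr.2.le.trans hm2.2⟩, h0⟩
  rw [h.2.2.2.2.2.2.1] at hr'
  obtain ⟨i, hi', rfl⟩ := hr'
  rcases Nat.lt_or_ge k i with hki | hki
  · exact absurd (rho_anti h (by omega) (by omega : k+1 ≤ i) hi'.2) (not_le.2 hr.1)
  · exact absurd (rho_anti h hi'.1 hki (by omega)) (not_le.2 hr.2)

lemma no_zero_first {n m : ℕ} {p : ℝ} {u : ℝ → ℝ} {ρ δ : ℕ → ℝ} (h : DirichletData n p m u ρ δ)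
    (hm : 1 ≤ m) : ∀ r ∈ Ioo 0 (ρ m), u r ≠ 0 := by
  intro r hr h0
  have hm2 := (rho_mem h hm le_rfl).1
  have hr' : r ∈ {r : ℝ | r ∈ Set.Ioc (0 : ℝ) 1 ∧ u r = 0} :=
    ⟨⟨hr.1, hr.2.le.trans hm2.2⟩, h0⟩
  rw [h.2.2.2.2.2.2.1] at hr'
  obtain ⟨i, hi', rfl⟩ := hr'
  exact absurd (rho_anti h hi'.1 hi'.2 le_rfl) (not_le.2 hr.2)

lemma energy_final {j m : ℕ} {p α C : ℝ} {u : ℝ → ℝ} {ρ δ : ℕ → ℝ}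
    (h : DirichletData (j+3) p m u ρ δ) (hm : 2 ≤ m) (hp : 1 < p) (hA : 0 < u (δ 1))
    (hcr : (p+1) * ((j:ℝ)+1) ≤ 2 * ((j:ℝ)+3)) (hp2 : 2 ≤ (p - 1) * ((j:ℝ)+1)) (hp6 : p + 1 ≤ 6)
    (hα : α * (p - 1) = 2) (hη : (j:ℝ)+1 ≤ 2 * α) (hC : 1 ≤ C)
    (hCb : ∀ (p α x y : ℝ), 1 < p → 2 ≤ (p - 1) * ((j:ℝ)+1) → p + 1 ≤ 6 →
      ∀ E, E = y^2/2 - α * ((j:ℝ)+1-α) * x^2/2 + |x|^(p+1)/(p+1) → 0 ≤ E →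
      x^2 ≤ C^2 * (1 + E) ∧ y^2 ≤ C^2 * (1+E))
    (hsm : (2*α - ((j:ℝ)+1)) * C^2 < 1) :
    (δ 1 * u (δ 1) ^ ((p-1)/2)) ^ (2*α+2) ≤
      6 * (((((1 + (2*α - ((j:ℝ)+1)) * C^2) / (1 - (2*α - ((j:ℝ)+1)) * C^2))^2)^m)^2 - 1) := by
  obtain ⟨hs, hgeq⟩ := rsol_of h.1
  set g := derivWithin u (Icc 0 1) with hg
  have hα0 : 0 < α := by have : (0:ℝ) ≤ j := Nat.cast_nonneg j
                         linarith
  have hmono := efE_mono hs hp hα hη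
  have hEpos : ∀ r ∈ Icc (0:ℝ) 1, 0 ≤ efE j p α u g r := by
    intro r hr
    have := hmono (by simp) hr hr.1
    rwa [efE_zero hα0 hp] at this
  have hb : ∀ r ∈ Icc (0:ℝ) 1, (efF α u r)^2 ≤ C^2 * (1 + efE j p α u g r) ∧
      (efG α u g r)^2 ≤ C^2 * (1 + efE j p α u g r) := by
    intro r hr
    exact hCb p α _ _ hp hp2 hp6 _ rfl (hEpos r hr)
  set θ := (2*α - ((j:ℝ)+1)) * C^2 with hθ
  have hθ1 : 0 < 1 - θ := by linarith
  have hθ0 : 0 ≤ θ := by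
    have : 0 ≤ 2*α - ((j:ℝ)+1) := by linarith
    positivity
  set q := ((1 + θ) / (1 - θ))^2 with hq
  have hq0 : 0 ≤ q := by positivity
  have hind : ∀ t, t + 1 ≤ m → √(1 + efE j p α u g (ρ (m - t))) ≤ q^(t+1) := by
    intro t
    induction t with
    | zero =>
      intro _
      have hmm := (rho_mem h (by omega : 1 ≤ m) le_rfl).1
      have := ef_bump hs hp hcr hα hη hC hb hsm le_rfl hmm.1.le hmm.2 (no_zero_first h (by omega))
      rw [efE_zero hα0 hp] at this
      simpa using this
    | succ t ih =>
      intro ht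
      have ih' := ih (by omega)
      obtain ⟨k, hk⟩ : ∃ k, m - (t+1) = k := ⟨_, rfl⟩
      have hk1 : m - t = k + 1 := by omega
      rw [hk]; rw [hk1] at ih'
      have hk0 : 1 ≤ k := by omega
      have m1 := (rho_mem h (by omega : 1 ≤ k+1) (by omega)).1
      have m2 := (rho_mem h hk0 (by omega)).1
      have := ef_bump hs hp hcr hα hη hC hb hsm m1.1.le (rho_anti h hk0 (by omega) (by omega)) m2.2
        (no_zero h hk0 (by omega))
      refine this.trans ?_
      rw [pow_succ q (t+1)]
      exact mul_le_mul_of_nonneg_right ih' hq0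
  have hfin := hind (m-1) (by omega)
  rw [show m - (m-1) = 1 by omega, show m - 1 + 1 = m by omega, h.2.2.1] at hfin
  have hE1 : efE j p α u g 1 ≤ (q^m)^2 - 1 := by
    have := hEpos 1 (by simp)
    have h2 : (√(1 + efE j p α u g 1))^2 ≤ (q^m)^2 := pow_le_pow_left₀ (by positivity) hfin 2
    rw [Real.sq_sqrt (by linarith)] at h2
    linarith
  have hρ2 := (rho_mem h (by omega : 1 ≤ 2) hm).1
  have hd1 : ρ 2 < δ 1 := h.2.2.2.2.2.1 1 le_rfl hm
  have hd2 : δ 1 < 1 := by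
    have := h.2.2.2.2.1 1 le_rfl (by omega)
    rwa [h.2.2.1] at this
  have hd0 : 0 < δ 1 := hρ2.1.trans hd1
  have hcrit : deriv u (δ 1) = 0 := by
    have : δ 1 ∈ {r : ℝ | r ∈ Set.Icc (0 : ℝ) 1 ∧ deriv u r = 0} := by
      rw [h.2.2.2.2.2.2.2]; exact ⟨1, ⟨le_rfl, by omega⟩, rfl⟩
    exact this.2
  have hg0 : g (δ 1) = 0 := by rw [hgeq _ ⟨hd0, hd2⟩, hcrit]
  have hEd : efE j p α u g (δ 1) ≤ efE j p α u g 1 := hmono ⟨hd0.le, hd2.le⟩ (by simp) hd2.le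
  have hF0 : 0 < efF α u (δ 1) := mul_pos (Real.rpow_pos_of_pos hd0 _) hA
  have hFE : |efF α u (δ 1)|^(p+1) / 6 ≤ efE j p α u g (δ 1) := by
    have hG : efG α u g (δ 1) = α * efF α u (δ 1) := by
      rw [efG, efF, hg0]; ring
    have : |efF α u (δ 1)|^(p+1) / 6 ≤ |efF α u (δ 1)|^(p+1) / (p+1) :=
      div_le_div_of_nonneg_left (by positivity) (by linarith) hp6
    have h3 : 0 ≤ α * (2*α - ((j:ℝ)+1)) * (efF α u (δ 1))^2 := by
      have : 0 ≤ 2*α - ((j:ℝ)+1) := by linarith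
      positivity
    rw [efE, hG]
    nlinarith
  have hFd : δ 1 * u (δ 1) ^ ((p-1)/2) = (efF α u (δ 1))^((p-1)/2) := by
    rw [efF, Real.mul_rpow (Real.rpow_nonneg hd0.le _) hA.le, ← Real.rpow_mul hd0.le,
      show α * ((p-1)/2) = 1 by linarith, Real.rpow_one]
  rw [hFd, ← Real.rpow_mul hF0.le, show (p-1)/2 * (2*α+2) = p + 1 by linarith]
  rw [abs_of_pos hF0] at hFE
  linarith

lemma pEps_facts {j : ℕ} {ε : ℝ} (h0 : 0 < ε) (h1 : ε < 2/((j:ℝ)+1)) :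
    ε ∈ Ioo (0:ℝ) (4 / (((j+3:ℕ):ℝ) - 2)) ∧ 1 < pEps (j+3) ε ∧
    (pEps (j+3) ε+1) * ((j:ℝ)+1) ≤ 2 * ((j:ℝ)+3) ∧ 2 ≤ (pEps (j+3) ε - 1) * ((j:ℝ)+1) ∧
    pEps (j+3) ε + 1 ≤ 6 ∧ 2 / (pEps (j+3) ε - 1) * (pEps (j+3) ε - 1) = 2 ∧
    (j:ℝ)+1 ≤ 2 * (2 / (pEps (j+3) ε - 1)) ∧ 2 / (pEps (j+3) ε - 1) ≤ (j:ℝ)+1 := by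
  have hj : (0:ℝ) ≤ j := Nat.cast_nonneg j
  have hj1 : (0:ℝ) < (j:ℝ)+1 := by linarith
  have e : pEps (j+3) ε = 1 + 4/((j:ℝ)+1) - ε := by
    rw [pEps]; push_cast
    rw [show (j:ℝ)+3-2 = j+1 by ring]
    field_simp; ring
  rw [e]
  have h2 : ε * ((j:ℝ)+1) < 2 := by rwa [lt_div_iff₀ hj1] at h1
  have h4 : 4/((j:ℝ)+1) = 2 * (2/((j:ℝ)+1)) := by ring
  have h5 : 2/((j:ℝ)+1) * ((j:ℝ)+1) = 2 := by field_simp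
  have h6 : 2/((j:ℝ)+1) ≤ 2 := by rw [div_le_iff₀ hj1]; linarith
  have h7 : 0 < 2/((j:ℝ)+1) := by positivity
  have hpos : 0 < 1 + 4/((j:ℝ)+1) - ε - 1 := by linarith
  refine ⟨⟨h0, ?_⟩, by linarith, ?_, ?_, by linarith, ?_, ?_, ?_⟩
  · push_cast; rw [show (j:ℝ)+3-2 = j+1 by ring]; linarith
  · rw [h4]; nlinarith
  · rw [h4]; nlinarith
  · exact div_mul_cancel₀ _ hpos.ne'
  · rw [← mul_div_assoc, le_div_iff₀ hpos, h4]; nlinarith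
  · rw [div_le_iff₀ hpos, h4]; nlinarith

lemma pEps_tendsto (j : ℕ) : Tendsto (fun ε => pEps (j+3) ε) (𝓝[>] (0:ℝ)) (𝓝 (1 + 4/((j:ℝ)+1))) := by
  have hj : (0:ℝ) ≤ j := Nat.cast_nonneg j
  have e : ∀ ε, pEps (j+3) ε = 1 + 4/((j:ℝ)+1) - ε := by
    intro ε
    rw [pEps]; push_cast
    rw [show (j:ℝ)+3-2 = j+1 by ring]
    field_simp; ring
  have : Tendsto (fun ε => pEps (j+3) ε) (𝓝 (0:ℝ)) (𝓝 (1 + 4/((j:ℝ)+1))) := by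
    have hc : Continuous (fun ε => pEps (j+3) ε) := by unfold pEps; fun_prop
    have := hc.tendsto 0
    rwa [e 0, sub_zero] at this
  exact this.mono_left nhdsWithin_le_nhds

lemma small_ev (j : ℕ) : ∀ᶠ ε in 𝓝[>] (0:ℝ), 0 < ε ∧ ε < 2/((j:ℝ)+1) := by
  have : (0:ℝ) < 2/((j:ℝ)+1) := by positivity
  filter_upwards [Ioo_mem_nhdsGT this] with ε h using h

lemma delta_tendsto (j m : ℕ) (hm : 2 ≤ m)
    (u : ℝ → ℝ → ℝ) (ρ δ : ℝ → ℕ → ℝ)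
    (hu : ∀ ε ∈ Set.Ioo (0 : ℝ) (4 / (((j+3:ℕ) : ℝ) - 2)),
      DirichletData (j+3) (pEps (j+3) ε) m (u ε) (ρ ε) (δ ε) ∧ 0 < u ε (δ ε 1)) :
    Tendsto (fun ε : ℝ => δ ε 1 * u ε (δ ε 1) ^ ((pEps (j+3) ε - 1) / 2))
      (𝓝[>] (0 : ℝ)) (𝓝 0) := by
  obtain ⟨C, hC, hCb⟩ := ef_bounds (j := j)
  have hj1 : (0:ℝ) < (j:ℝ)+1 := by positivity
  set θ : ℝ → ℝ := fun ε => (2*(2 / (pEps (j+3) ε - 1)) - ((j:ℝ)+1)) * C^2 with hθ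
  have hθlim : Tendsto θ (𝓝[>] 0) (𝓝 0) := by
    have h1 : Tendsto (fun ε => pEps (j+3) ε - 1) (𝓝[>] (0:ℝ)) (𝓝 (4/((j:ℝ)+1))) := by
      simpa using (pEps_tendsto j).sub_const 1
    have h2 := (((((tendsto_const_nhds (x := (2:ℝ))).div h1 (by positivity)).const_mul 2).sub_const ((j:ℝ)+1)).mul_const (C^2))
    have : (2 * (2 / (4/((j:ℝ)+1))) - ((j:ℝ)+1)) * C^2 = 0 := by field_simp; ring
    rwa [this] at h2
  have hQ : Tendsto (fun ε => 6 * (((((1 + θ ε) / (1 - θ ε))^2)^m)^2 - 1)) (𝓝[>] 0) (𝓝 0) := by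
    have h1 := ((((((hθlim.const_add 1).div (hθlim.const_sub 1) (by norm_num)).pow 2).pow m).pow 2).sub_const 1).const_mul 6
    simpa using h1
  rw [Metric.tendsto_nhds]
  intro κ0 hκ0
  set κ := min κ0 1 with hκ
  have hκp : 0 < κ := lt_min hκ0 one_pos
  have hpow : 0 < κ^(2*((j:ℝ)+1)+2) := Real.rpow_pos_of_pos hκp _
  filter_upwards [small_ev j, hQ.eventually (gt_mem_nhds hpow), hθlim.eventually (gt_mem_nhds one_pos)]
    with ε hε hq ht
  obtain ⟨hI, hp, hcr, hp2, hp6, hα, hη, hα1⟩ := pEps_facts hε.1 hε.2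
  obtain ⟨hD, hA⟩ := hu ε hI
  have hmain := energy_final hD hm hp hA hcr hp2 hp6 hα hη hC hCb ht
  have hρ2 := (rho_mem hD (by omega : 1 ≤ 2) hm).1
  have hd1 : ρ ε 2 < δ ε 1 := hD.2.2.2.2.2.1 1 le_rfl hm
  have hd0 : 0 < δ ε 1 := hρ2.1.trans hd1
  set d := δ ε 1 * u ε (δ ε 1) ^ ((pEps (j+3) ε - 1) / 2) with hd
  have hdp : 0 < d := mul_pos hd0 (Real.rpow_pos_of_pos hA _)
  rw [Real.dist_eq, sub_zero, abs_of_pos hdp]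
  refine lt_of_lt_of_le ?_ (min_le_left κ0 1)
  change d < κ
  by_contra hcon
  push Not at hcon
  set α := 2 / (pEps (j+3) ε - 1) with hαd
  have a1 : κ^(2*((j:ℝ)+1)+2) ≤ κ^(2*α+2) :=
    Real.rpow_le_rpow_of_exponent_ge hκp (min_le_right _ _) (by linarith)
  have a2 : κ^(2*α+2) ≤ d^(2*α+2) :=
    Real.rpow_le_rpow hκp.le hcon (by linarith)
  have : d^(2*α+2) ≤ 6 * (((((1 + θ ε) / (1 - θ ε))^2)^m)^2 - 1) := hmain
  linarith
lemma log_concave {j : ℕ} {p : ℝ} {u g : ℝ → ℝ} (h : RSol j p u g) (hp : 1 < p)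
    (hc : (p+1) * ((j:ℝ)+1) ≤ 2 * ((j:ℝ)+3)) {a b : ℝ} (ha : 0 ≤ a) (hb : b ≤ 1)
    (hpos : ∀ r ∈ Ioo a b, 0 < u r) {r₀ r : ℝ} (hr₀ : r₀ ∈ Ioo a b) (hr : r ∈ Ioo a b) :
    u r ≤ u r₀ * (r/r₀)^(r₀ * g r₀ / u r₀) := by
  set k := r₀ * g r₀ / u r₀ with hk
  have hanti := logder_antitone h hp hc ha hb (fun r hr => (hpos r hr).ne')
  have hder : ∀ x ∈ Ioo a b, HasDerivAt (fun x => u x * x^(-k))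
      (x^(-k) / x * u x * (x * g x / u x - k)) x := by
    intro x hx
    have hx0 : 0 < x := ha.trans_lt hx.1
    have hd := (h.du x ⟨hx0, hx.2.trans_le hb⟩).mul
      (Real.hasDerivAt_rpow_const (x := x) (p := -k) (Or.inl hx0.ne'))
    refine hd.congr_deriv ?_
    have := (hpos x hx).ne'
    rw [Real.rpow_sub_one hx0.ne']
    field_simp
    ring
  have key : u r * r^(-k) ≤ u r₀ * r₀^(-k) := by
    rcases le_total r₀ r with hle | hle
    · have hsub : Icc r₀ r ⊆ Ioo a b := fun x hx => ⟨hr₀.1.trans_le hx.1, hx.2.trans_lt hr.2⟩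
      have : AntitoneOn (fun x => u x * x^(-k)) (Icc r₀ r) := by
        apply antitoneOn_of_deriv_nonpos (convex_Icc _ _)
        · exact fun x hx => (hder x (hsub hx)).continuousAt.continuousWithinAt
        · exact fun x hx => (hder x (hsub (interior_subset hx))).differentiableAt.differentiableWithinAt
        · intro x hx
          have hx' := interior_subset hx
          have hx1 := hsub hx'
          have hx0 : 0 < x := ha.trans_lt hx1.1
          rw [(hder x hx1).deriv]
          have h1 := hpos x hx1
          have h2 : x * g x / u x ≤ k := hanti hr₀ hx1 hx'.1
          exact mul_nonpos_of_nonneg_of_nonpos (by positivity) (by linarith)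
      exact this (left_mem_Icc.2 hle) (right_mem_Icc.2 hle) hle
    · have hsub : Icc r r₀ ⊆ Ioo a b := fun x hx => ⟨hr.1.trans_le hx.1, hx.2.trans_lt hr₀.2⟩
      have : MonotoneOn (fun x => u x * x^(-k)) (Icc r r₀) := by
        apply monotoneOn_of_deriv_nonneg (convex_Icc _ _)
        · exact fun x hx => (hder x (hsub hx)).continuousAt.continuousWithinAt
        · exact fun x hx => (hder x (hsub (interior_subset hx))).differentiableAt.differentiableWithinAt
        · intro x hx
          have hx' := interior_subset hx
          have hx1 := hsub hx'
          have hx0 : 0 < x := ha.trans_lt hx1.1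
          rw [(hder x hx1).deriv]
          have h1 := hpos x hx1
          have h2 : k ≤ x * g x / u x := hanti hx1 hr₀ hx'.2
          exact mul_nonneg (by positivity) (by linarith)
      exact this (left_mem_Icc.2 hle) (right_mem_Icc.2 hle) hle
  have hr0 : 0 < r := ha.trans_lt hr.1
  have hr00 : 0 < r₀ := ha.trans_lt hr₀.1
  rw [Real.rpow_neg hr0.le, Real.rpow_neg hr00.le] at key
  rw [Real.div_rpow hr0.le hr00.le]
  have := Real.rpow_pos_of_pos hr0 k
  have := Real.rpow_pos_of_pos hr00 k
  rw [← div_eq_mul_inv, ← div_eq_mul_inv, div_le_iff₀ (by positivity)] at key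
  calc u r ≤ _ := key
    _ = _ := by ring

lemma scaled {j m : ℕ} {p : ℝ} {u : ℝ → ℝ} {ρ δ : ℕ → ℝ}
    (h : DirichletData (j+3) p m u ρ δ) (hm : 2 ≤ m) (hp : 1 < p) (hA : 0 < u (δ 1))
    (hcr : (p+1) * ((j:ℝ)+1) ≤ 2 * ((j:ℝ)+3)) {M : ℝ} (hM : M = u (δ 1) ^ ((p-1)/2)) :
    ∃ Z W : ℝ → ℝ, (∀ s, Z s = u (u (δ 1) ^ ((1-p)/2) * s) / u (δ 1)) ∧ 0 < M ∧ 0 < ρ 2 ∧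
      M * ρ 2 < δ 1 * M ∧ δ 1 * M < M ∧
      ContinuousOn Z (Icc (δ 1 * M) M) ∧ ContinuousOn W (Icc (δ 1 * M) M) ∧
      (∀ s ∈ Ioo (M * ρ 2) M, HasDerivAt Z (W s) s ∧
        HasDerivAt W (-(((j:ℝ)+2)/s * W s) - (Z s)^p) s ∧ 0 < Z s ∧ Z s ≤ 1) ∧
      Z (δ 1 * M) = 1 ∧ W (δ 1 * M) = 0 ∧ Z M = 0 ∧
      (∀ s₀ ∈ Ioo (M * ρ 2) M, ∀ s ∈ Ioo (M * ρ 2) M,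
        Z s ≤ Z s₀ * (s/s₀)^(s₀ * W s₀ / Z s₀)) := by
  obtain ⟨hs, hgeq⟩ := rsol_of h.1
  set g := derivWithin u (Icc 0 1) with hg
  set A := u (δ 1) with hAd
  have hM0 : 0 < M := by rw [hM]; exact Real.rpow_pos_of_pos hA _
  have hMinv : A ^ ((1-p)/2) = M⁻¹ := by
    rw [hM, ← Real.rpow_neg hA.le]; congr 1; ring
  have hM2 : M^2 = A^(p-1) := by
    rw [hM, ← Real.rpow_natCast, ← Real.rpow_mul hA.le]; congr 1; push_cast; ring
  have hρ2 := (rho_mem h (by omega : 1 ≤ 2) hm).1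
  have hd1 : ρ 2 < δ 1 := h.2.2.2.2.2.1 1 le_rfl hm
  have hd2 : δ 1 < 1 := by
    have := h.2.2.2.2.1 1 le_rfl (by omega)
    rwa [h.2.2.1] at this
  have hd0 : 0 < δ 1 := hρ2.1.trans hd1
  have hcrit : deriv u (δ 1) = 0 := by
    have : δ 1 ∈ {r : ℝ | r ∈ Set.Icc (0 : ℝ) 1 ∧ deriv u r = 0} := by
      rw [h.2.2.2.2.2.2.2]; exact ⟨1, ⟨le_rfl, by omega⟩, rfl⟩
    exact this.2
  have hg0 : g (δ 1) = 0 := by rw [hgeq _ ⟨hd0, hd2⟩, hcrit]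
  have hdI : δ 1 ∈ Ioo (ρ 2) 1 := ⟨hd1, hd2⟩
  have hnz : ∀ r ∈ Ioo (ρ 2) 1, u r ≠ 0 := by
    have := no_zero h (k := 1) le_rfl hm
    rwa [h.2.2.1] at this
  have hpos : ∀ r ∈ Ioo (ρ 2) 1, 0 < u r := by
    intro r hr
    by_contra hcon
    push Not at hcon
    have hcont : ContinuousOn u (Ioo (ρ 2) 1) :=
      hs.cu.mono (Ioo_subset_Icc_self.trans (Icc_subset_Icc hρ2.1.le le_rfl))
    obtain ⟨x, hx, hx0⟩ := isPreconnected_Ioo.intermediate_value hr hdI hcont ⟨hcon, hA.le⟩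
    exact hnz x hx hx0
  have hle : ∀ r ∈ Ioo (ρ 2) 1, u r ≤ A := by
    intro r hr
    have := log_concave hs hp hcr hρ2.1.le le_rfl hpos hdI hr
    rwa [hg0, mul_zero, zero_div, Real.rpow_zero, mul_one] at this
  have hmap : ∀ s ∈ Ioo (M * ρ 2) M, M⁻¹ * s ∈ Ioo (ρ 2) 1 := by
    intro s hs'
    rw [inv_mul_eq_div]
    exact ⟨by rw [lt_div_iff₀ hM0]; linarith [hs'.1], by rw [div_lt_one hM0]; exact hs'.2⟩
  have hmapc : MapsTo (fun s => M⁻¹ * s) (Icc (δ 1 * M) M) (Icc 0 1) := by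
    intro s hs'
    simp only [inv_mul_eq_div]
    have := mul_pos hd0 hM0
    exact ⟨div_nonneg (this.le.trans hs'.1) hM0.le, by rw [div_le_one hM0]; exact hs'.2⟩
  have hlin : ∀ s : ℝ, HasDerivAt (fun s => M⁻¹ * s) M⁻¹ s := fun s => by
    simpa using (hasDerivAt_id s).const_mul M⁻¹
  have hlc : ContinuousOn (fun s : ℝ => M⁻¹ * s) (Icc (δ 1 * M) M) := by fun_prop
  refine ⟨fun s => u (M⁻¹ * s) / A, fun s => g (M⁻¹ * s) * M⁻¹ / A, ?_, hM0, hρ2.1, ?_, ?_, ?_, ?_,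
    ?_, ?_, ?_, ?_, ?_⟩
  · intro s; rw [hMinv]
  · nlinarith
  · nlinarith
  · exact (hs.cu.comp hlc hmapc).div_const A
  · exact ((hs.cg.comp hlc hmapc).mul_const M⁻¹).div_const A
  · intro s hs'
    have hr := hmap s hs'
    have hr' : M⁻¹ * s ∈ Ioo (0:ℝ) 1 := ⟨hρ2.1.trans hr.1, hr.2⟩
    have hs0 : 0 < s := (mul_pos hM0 hρ2.1).trans hs'.1
    have hup := hpos _ hr
    refine ⟨?_, ?_, div_pos hup hA, (div_le_one hA).2 (hle _ hr)⟩
    · exact ((hs.du _ hr').comp s (hlin s)).div_const A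
    · have d := (((hs.dg _ hr').comp s (hlin s)).mul_const M⁻¹).div_const A
      refine d.congr_deriv ?_
      rw [Real.div_rpow hup.le hA.le, abs_of_pos hup]
      have e1 : A^p = A^(p-1) * A := by
        rw [← Real.rpow_add_one hA.ne']; congr 1; ring
      have e2 : u (M⁻¹ * s)^p = u (M⁻¹ * s)^(p-1) * u (M⁻¹ * s) := by
        rw [← Real.rpow_add_one hup.ne']; congr 1; ring
      rw [e1, e2, ← hM2]
      beta_reduce
      generalize u (M⁻¹ * s)^(p-1) * u (M⁻¹ * s) = Q
      generalize g (M⁻¹ * s) = G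
      field_simp
  · simp only
    rw [show M⁻¹ * (δ 1 * M) = δ 1 by field_simp]
    exact div_self hA.ne'
  · simp only
    rw [show M⁻¹ * (δ 1 * M) = δ 1 by field_simp, hg0]; simp
  · simp only
    rw [inv_mul_cancel₀ hM0.ne', h.2.1]; simp
  · intro s₀ hs₀ s hs'
    have hr₀ := hmap s₀ hs₀
    have := log_concave hs hp hcr hρ2.1.le le_rfl hpos hr₀ (hmap s hs')
    have hu0 := hpos _ hr₀
    have e1 : s₀ * (g (M⁻¹ * s₀) * M⁻¹ / A) / (u (M⁻¹ * s₀) / A) =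
        M⁻¹ * s₀ * g (M⁻¹ * s₀) / u (M⁻¹ * s₀) := by
      field_simp
    have e2 : s / s₀ = M⁻¹ * s / (M⁻¹ * s₀) := by
      rw [mul_div_mul_left _ _ (inv_ne_zero hM0.ne')]
    simp only
    rw [e1, e2, div_mul_eq_mul_div]
    exact div_le_div_of_nonneg_right this hA.le

/-- derivative of the bubble -/
def bubD (j : ℕ) (s : ℝ) : ℝ :=
  -(s / ((j:ℝ)+3)) * (1 + s^2 / (((j:ℝ)+3) * ((j:ℝ)+1)))^(-(((j:ℝ)+3)/2))

lemma bub_eq (j : ℕ) (s : ℝ) : bubble (j+3) s =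
    (1 + s^2 / (((j:ℝ)+3) * ((j:ℝ)+1)))^(-(((j:ℝ)+1)/2)) := by
  rw [bubble]; push_cast
  rw [show (j:ℝ)+3-2 = j+1 by ring]

lemma bub_base_pos (j : ℕ) (s : ℝ) : 1 ≤ 1 + s^2 / (((j:ℝ)+3) * ((j:ℝ)+1)) := by
  have : 0 ≤ s^2 / (((j:ℝ)+3) * ((j:ℝ)+1)) := by positivity
  linarith

lemma bub_base_der (j : ℕ) (s : ℝ) : HasDerivAt (fun s : ℝ => 1 + s^2 / (((j:ℝ)+3) * ((j:ℝ)+1)))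
    (2 * s / (((j:ℝ)+3) * ((j:ℝ)+1))) s := by
  have := ((hasDerivAt_pow 2 s).div_const (((j:ℝ)+3) * ((j:ℝ)+1))).const_add 1
  simpa using this

lemma bub_der (j : ℕ) (s : ℝ) : HasDerivAt (bubble (j+3)) (bubD j s) s := by
  have e : bubble (j+3) = fun s => (1 + s^2 / (((j:ℝ)+3) * ((j:ℝ)+1)))^(-(((j:ℝ)+1)/2)) :=
    funext (bub_eq j)
  rw [e]
  have hb := bub_base_pos j s
  have := (bub_base_der j s).rpow_const (p := -(((j:ℝ)+1)/2)) (Or.inl (by linarith))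
  refine this.congr_deriv ?_
  rw [bubD, show -(((j:ℝ)+1)/2) - 1 = -(((j:ℝ)+3)/2) by ring]
  have : (j:ℝ)+1 ≠ 0 := by positivity
  have : (j:ℝ)+3 ≠ 0 := by positivity
  field_simp

lemma bub_pos (j : ℕ) (s : ℝ) : 0 < bubble (j+3) s := by
  rw [bub_eq]; exact Real.rpow_pos_of_pos (by linarith [bub_base_pos j s]) _

lemma bub_le (j : ℕ) (s : ℝ) : bubble (j+3) s ≤ 1 := by
  rw [bub_eq]; exact Real.rpow_le_one_of_one_le_of_nonpos (bub_base_pos j s)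
    (by have : (0:ℝ) ≤ j := Nat.cast_nonneg j
        linarith)

lemma bub_anti (j : ℕ) {s t : ℝ} (hs : 0 ≤ s) (hst : s ≤ t) : bubble (j+3) t ≤ bubble (j+3) s := by
  rw [bub_eq, bub_eq]
  apply Real.rpow_le_rpow_of_nonpos
  · linarith [bub_base_pos j s]
  · gcongr
  · have : (0:ℝ) ≤ j := Nat.cast_nonneg j
    linarith

lemma bubD_der (j : ℕ) {s : ℝ} (hs : s ≠ 0) : HasDerivAt (bubD j)
    (-(((j:ℝ)+2)/s * bubD j s) - (bubble (j+3) s)^(1 + 4/((j:ℝ)+1))) s := by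
  have hb := bub_base_pos j s
  have d := (((hasDerivAt_id s).div_const ((j:ℝ)+3)).neg).mul
    ((bub_base_der j s).rpow_const (p := -(((j:ℝ)+3)/2)) (Or.inl (by linarith)))
  refine d.congr_deriv ?_
  rw [bub_eq, ← Real.rpow_mul (by linarith), bubD]
  have h1 : (j:ℝ)+1 ≠ 0 := by positivity
  have h3 : (j:ℝ)+3 ≠ 0 := by positivity
  rw [show -(((j:ℝ)+1)/2) * (1 + 4/((j:ℝ)+1)) = -(((j:ℝ)+3)/2) - 1 by field_simp; ring]
  have e : (1 + s^2 / (((j:ℝ)+3) * ((j:ℝ)+1)))^(-(((j:ℝ)+3)/2)) =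
    (1 + s^2 / (((j:ℝ)+3) * ((j:ℝ)+1)))^(-(((j:ℝ)+3)/2) - 1) * (1 + s^2 / (((j:ℝ)+3) * ((j:ℝ)+1))) := by
    rw [← Real.rpow_add_one (by linarith)]; congr 1; ring
  rw [e]
  generalize (1 + s^2 / (((j:ℝ)+3) * ((j:ℝ)+1)))^(-(((j:ℝ)+3)/2) - 1) = Q
  simp only [Pi.neg_apply, id]
  field_simp
  ring

lemma pow_diff {P ε a b : ℝ} (hε : 0 ≤ ε) (hP : 1 < P - ε) (ha : 0 ≤ a) (ha1 : a ≤ 1)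
    (hb : 0 ≤ b) (hb1 : b ≤ 1) : |a^(P-ε) - b^P| ≤ ε + P * |a - b| := by
  have h1 : |a^(P-ε) - a^P| ≤ ε := by
    rcases eq_or_lt_of_le ha with rfl | ha0
    · rw [Real.zero_rpow (by linarith), Real.zero_rpow (by linarith)]; simpa using hε
    have hge : a^P ≤ a^(P-ε) := Real.rpow_le_rpow_of_exponent_ge ha0 ha1 (by linarith)
    rw [abs_of_nonneg (by linarith)]
    have e : a^P = a^(P-ε) * a^ε := by rw [← Real.rpow_add ha0]; congr 1; ring
    have h2 : 1 + Real.log a * ε ≤ a^ε := by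
      rw [Real.rpow_def_of_pos ha0]; linarith [Real.add_one_le_exp (Real.log a * ε)]
    have h3 : 1 - 1/a ≤ Real.log a := by
      have := Real.one_sub_inv_le_log_of_pos ha0
      rwa [one_div]
    have h4 : a^(P-ε) ≤ a := by
      calc a^(P-ε) ≤ a^(1:ℝ) := Real.rpow_le_rpow_of_exponent_ge ha0 ha1 hP.le
        _ = a := Real.rpow_one a
    have h5 : 0 ≤ a^(P-ε) := by positivity
    have h6 : 1 - a^ε ≤ ε * (1/a) := by nlinarith
    rw [e]
    calc a^(P-ε) - a^(P-ε) * a^ε = a^(P-ε) * (1 - a^ε) := by ring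
      _ ≤ a^(P-ε) * (ε * (1/a)) := mul_le_mul_of_nonneg_left h6 h5
      _ ≤ a * (ε * (1/a)) := mul_le_mul_of_nonneg_right h4 (by positivity)
      _ = ε := by field_simp
  have h2 : |a^P - b^P| ≤ P * |a - b| := by
    have := Convex.norm_image_sub_le_of_norm_hasDerivWithin_le (f := fun x : ℝ => x^P)
      (f' := fun x => P * x^(P-1)) (s := Icc (0:ℝ) 1) (C := P) (x := b) (y := a)
      (fun x _ => (Real.hasDerivAt_rpow_const (Or.inr (by linarith))).hasDerivWithinAt)
      (fun x hx => by
        rw [Real.norm_eq_abs, abs_of_nonneg (mul_nonneg (by linarith) (Real.rpow_nonneg hx.1 _))]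
        have := Real.rpow_le_one hx.1 hx.2 (by linarith : 0 ≤ P - 1)
        nlinarith) (convex_Icc 0 1) ⟨hb, hb1⟩ ⟨ha, ha1⟩
    simpa [Real.norm_eq_abs] using this
  calc |a^(P-ε) - b^P| = |(a^(P-ε) - a^P) + (a^P - b^P)| := by ring_nf
    _ ≤ _ := (abs_add_le _ _).trans (add_le_add h1 h2)

lemma gron {j : ℕ} {P ε d T : ℝ} {Z W : ℝ → ℝ} (hPd : P = 1 + 4/((j:ℝ)+1)) (hε : 0 ≤ ε) (hP : 1 < P - ε)
    (hd : 0 < d) (hdT : d ≤ T) (cZ : ContinuousOn Z (Icc d T)) (cW : ContinuousOn W (Icc d T))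
    (hZW : ∀ s ∈ Ioo d T, HasDerivAt Z (W s) s ∧
        HasDerivAt W (-(((j:ℝ)+2)/s * W s) - (Z s)^(P-ε)) s ∧ 0 < Z s ∧ Z s ≤ 1)
    (hZd : Z d = 1) (hWd : W d = 0) :
    ∀ s ∈ Icc d T, (Z s - bubble (j+3) s)^2 + (W s - bubD j s)^2 ≤
      ((1 - bubble (j+3) d)^2 + (bubD j d)^2 + ε^2) * Real.exp ((2+P) * T) := by
  set N : ℝ → ℝ := fun s => (Z s - bubble (j+3) s)^2 + (W s - bubD j s)^2 + ε^2 with hN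
  have hPp : 1 < P := by linarith
  set K := 2 + P with hK
  have hanti : AntitoneOn (fun s => N s * Real.exp (-(K * s))) (Icc d T) := by
    have hder : ∀ s ∈ Ioo d T, HasDerivAt (fun s => N s * Real.exp (-(K * s)))
      ((2 * (Z s - bubble (j+3) s) * (W s - bubD j s) + 2 * (W s - bubD j s) *
        (-(((j:ℝ)+2)/s * (W s - bubD j s)) - ((Z s)^(P-ε) - (bubble (j+3) s)^P)) - K * N s)
          * Real.exp (-(K * s))) s := by
      intro s hs
      obtain ⟨h1, h2, -, -⟩ := hZW s hs
      have hs0 : s ≠ 0 := (hd.trans hs.1).ne'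
      have d1 := (h1.sub (bub_der j s)).pow 2
      have d2 := (h2.sub (bubD_der j hs0)).pow 2
      have d3 : HasDerivAt (fun s => Real.exp (-(K * s))) (Real.exp (-(K*s)) * (-(K * 1))) s :=
        (((hasDerivAt_id s).const_mul K).neg).exp
      have d4 := ((d1.add d2).add_const (ε^2)).mul d3
      refine d4.congr_deriv ?_
      rw [← hPd]
      simp only [hN, Pi.add_apply, Pi.pow_apply, Pi.sub_apply]
      push_cast
      ring
    apply antitoneOn_of_deriv_nonpos (convex_Icc _ _)
    · have c1 : Continuous (bubble (j+3)) :=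
        continuous_iff_continuousAt.2 fun s => (bub_der j s).continuousAt
      have c2 : ContinuousOn (bubD j) (Icc d T) := fun s hs =>
        (bubD_der j (hd.trans_le hs.1).ne').continuousAt.continuousWithinAt
      have c3 := c1.continuousOn (s := Icc d T)
      simp only [hN]
      fun_prop
    · intro s hs; rw [interior_Icc] at hs
      exact (hder s hs).differentiableAt.differentiableWithinAt
    · intro s hs; rw [interior_Icc] at hs
      rw [(hder s hs).deriv]
      obtain ⟨-, -, h3, h4⟩ := hZW s hs
      have hs0 : 0 < s := (hd.trans hs.1)
      apply mul_nonpos_of_nonpos_of_nonneg _ (Real.exp_pos _).le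
      have hdiff := pow_diff hε hP h3.le h4 (bub_pos j s).le (bub_le j s)
      simp only [hN]
      set x := Z s - bubble (j+3) s with hx
      set y := W s - bubD j s with hy
      set f := (Z s)^(P-ε) - (bubble (j+3) s)^P with hf
      have t1 : 2 * x * y ≤ x^2 + y^2 := by nlinarith [sq_nonneg (x-y)]
      have t2 : 0 ≤ ((j:ℝ)+2)/s * y^2 := by positivity
      have t3 : -(y * f) ≤ |y| * (ε + P * |x|) := by
        calc -(y*f) ≤ |y*f| := neg_le_abs _
          _ = |y| * |f| := abs_mul _ _
          _ ≤ _ := mul_le_mul_of_nonneg_left hdiff (abs_nonneg _)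
      have t4 : 2 * (|y| * ε) ≤ y^2 + ε^2 := by
        nlinarith [sq_nonneg (|y| - ε), sq_abs y]
      have t5 : 2 * (|y| * |x|) ≤ x^2 + y^2 := by
        nlinarith [sq_nonneg (|y| - |x|), sq_abs y, sq_abs x]
      have t6 : 2 * (P * (|y| * |x|)) ≤ P * (x^2 + y^2) := by nlinarith
      have t7 : 0 ≤ ε^2 := sq_nonneg ε
      have t8 : 0 ≤ P * ε^2 := by positivity
      nlinarith [sq_nonneg x, sq_nonneg y]
  intro s hs
  have h1 := hanti (left_mem_Icc.2 hdT) hs hs.1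
  simp only [hN, hZd, hWd] at h1
  have hB : 0 ≤ (1 - bubble (j+3) d)^2 + (bubD j d)^2 + ε^2 := by positivity
  have h2 : ((1 - bubble (j+3) d)^2 + (0 - bubD j d)^2 + ε^2) * Real.exp (-(K*d)) ≤
      ((1 - bubble (j+3) d)^2 + (bubD j d)^2 + ε^2) := by
    rw [show (0 - bubD j d)^2 = (bubD j d)^2 by ring]
    apply mul_le_of_le_one_right hB
    rw [Real.exp_le_one_iff]
    have : 0 < K * d := by positivity
    linarith
  have h3 := h1.trans h2
  rw [Real.exp_neg, ← div_eq_mul_inv, div_le_iff₀ (Real.exp_pos _)] at h3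
  have h4 : Real.exp (K * s) ≤ Real.exp (K * T) := by
    apply Real.exp_le_exp.2
    exact mul_le_mul_of_nonneg_left hs.2 (by linarith)
  have h5 := mul_le_mul_of_nonneg_left h4 hB
  nlinarith [sq_nonneg ε]
/-- **Theorem 4.4 (blow-up/normalization, after [DIP17]).** For the radial Dirichlet
solution `u_ε` with `m-1` interior zeros normalized by `u_ε(δ_{1,ε}) > 0`, the rescaled
functions `z_ε` have a uniform integrable dominating function, the blow-up rates
`u_ε(δ_{1,ε})^{(p_ε-1)/2} → ∞` and `δ_{1,ε} u_ε(δ_{1,ε})^{(p_ε-1)/2} → 0` hold, and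
`z_ε → U` in `C²(K)` for every compact `K ⊂ (0,∞)`. -/
theorem blowup_normalization (n m : ℕ) (hn : 3 ≤ n) (hm : 2 ≤ m)
    (u : ℝ → ℝ → ℝ) (ρ δ : ℝ → ℕ → ℝ)
    (hu : ∀ ε ∈ Set.Ioo (0 : ℝ) (4 / ((n : ℝ) - 2)),
      DirichletData n (pEps n ε) m (u ε) (ρ ε) (δ ε) ∧ 0 < u ε (δ ε 1))
    (z : ℝ → ℝ → ℝ)
    (hz : ∀ ε ∈ Set.Ioo (0 : ℝ) (4 / ((n : ℝ) - 2)), ∀ s : ℝ,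
      z ε s = if u ε (δ ε 1) ^ ((pEps n ε - 1) / 2) * ρ ε 2 < s ∧
          s < u ε (δ ε 1) ^ ((pEps n ε - 1) / 2)
        then u ε (u ε (δ ε 1) ^ ((1 - pEps n ε) / 2) * s) / u ε (δ ε 1) else 0) :
    (∃ v : ℝ → ℝ, Measurable v ∧ (∀ s : ℝ, 0 ≤ v s) ∧
      MeasureTheory.IntegrableOn (fun s : ℝ => v s * s ^ (n - 1)) (Set.Ioi 0) ∧
      ∃ ε₀ ∈ Set.Ioo (0 : ℝ) (4 / ((n : ℝ) - 2)), ∀ ε ∈ Set.Ioo (0 : ℝ) ε₀,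
        ∀ s ∈ Set.Ioi (0 : ℝ),
          |z ε s| ^ pEps n ε ≤ v s ∧ |z ε s| ^ (pEps n ε + 1) ≤ v s) ∧
    Tendsto (fun ε : ℝ => u ε (δ ε 1) ^ ((pEps n ε - 1) / 2)) (𝓝[>] (0 : ℝ)) atTop ∧
    Tendsto (fun ε : ℝ => δ ε 1 * u ε (δ ε 1) ^ ((pEps n ε - 1) / 2))
      (𝓝[>] (0 : ℝ)) (𝓝 0) ∧
    (∀ K : Set ℝ, K ⊆ Set.Ioi 0 → IsCompact K →
      TendstoUniformlyOn (fun (ε : ℝ) (s : ℝ) => z ε s) (bubble n) (𝓝[>] (0 : ℝ)) K ∧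
      TendstoUniformlyOn (fun (ε : ℝ) (s : ℝ) => deriv (z ε) s) (deriv (bubble n))
        (𝓝[>] (0 : ℝ)) K ∧
      TendstoUniformlyOn (fun (ε : ℝ) (s : ℝ) => deriv (deriv (z ε)) s)
        (deriv (deriv (bubble n))) (𝓝[>] (0 : ℝ)) K) := by
  obtain ⟨j, rfl⟩ : ∃ j, n = j + 3 := ⟨n - 3, by omega⟩
  have hdel := delta_tendsto j m hm u ρ δ hu
  have hj1 : (0:ℝ) < (j:ℝ)+1 := by positivity
  set P : ℝ := 1 + 4/((j:ℝ)+1) with hP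
  have hPpos : 1 < P := by
    have : 0 < 4/((j:ℝ)+1) := by positivity
    linarith
  have hpP : ∀ ε, pEps (j+3) ε = P - ε := by
    intro ε
    rw [pEps, hP]; push_cast
    rw [show (j:ℝ)+3-2 = j+1 by ring]
    field_simp; ring
  set M : ℝ → ℝ := fun ε => u ε (δ ε 1) ^ ((pEps (j+3) ε - 1) / 2) with hM
  have hsc : ∀ ε, (0 < ε ∧ ε < 2/((j:ℝ)+1)) → _ := fun ε hε =>
    have f := pEps_facts (j := j) hε.1 hε.2
    scaled (M := M ε) (hu ε f.1).1 hm f.2.1 (hu ε f.1).2 f.2.2.1 rfl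
  choose! Z W hZW using hsc
  have hzZ : ∀ ε, (0 < ε ∧ ε < 2/((j:ℝ)+1)) → ∀ s,
      z ε s = if M ε * ρ ε 2 < s ∧ s < M ε then Z ε s else 0 := by
    intro ε hε s
    rw [hz ε (pEps_facts (j := j) hε.1 hε.2).1 s, (hZW ε hε).1 s]
  have cU : Continuous (bubble (j+3)) :=
    continuous_iff_continuousAt.2 fun s => (bub_der j s).continuousAt
  have cD : Continuous (bubD j) := by
    unfold bubD
    refine Continuous.mul (by fun_prop) (Continuous.rpow_const (by fun_prop) ?_)
    intro s; left; linarith [bub_base_pos j s]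
  have hid : Tendsto (fun ε : ℝ => ε) (𝓝[>] 0) (𝓝 0) := nhdsWithin_le_nhds
  have claim : ∀ S > 0, ∀ κ > 0, ∀ᶠ ε in 𝓝[>] (0:ℝ), S < M ε ∧
      ∀ s ∈ Icc (δ ε 1 * M ε) S, (Z ε s - bubble (j+3) s)^2 + (W ε s - bubD j s)^2 ≤ κ := by
    intro S hS κ hκ
    set κ' := min κ ((bubble (j+3) S)^2/2) with hκ'
    have hUS := bub_pos j S
    have hκ'0 : 0 < κ' := lt_min hκ (by positivity)
    have hB : Tendsto (fun ε => ((1 - bubble (j+3) (δ ε 1 * M ε))^2 + (bubD j (δ ε 1 * M ε))^2 + ε^2)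
        * Real.exp ((2+P) * S)) (𝓝[>] 0) (𝓝 0) := by
      have h1 := (cU.tendsto 0).comp hdel
      have h2 := (cD.tendsto 0).comp hdel
      have h3 := (((((h1.const_sub 1).pow 2).add (h2.pow 2)).add (hid.pow 2)).mul_const
        (Real.exp ((2+P) * S)))
      have e1 : bubble (j+3) 0 = 1 := by rw [bub_eq]; simp
      have e2 : bubD j 0 = 0 := by rw [bubD]; simp
      rw [e1, e2] at h3
      simpa using h3
    filter_upwards [small_ev j, hB.eventually (gt_mem_nhds hκ'0), hdel.eventually (gt_mem_nhds hS)]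
      with ε hε hBε hdS
    obtain ⟨-, hM0, hρ, hd1, hd2, cZ, cW, hode, hZd, hWd, hZM, -⟩ := hZW ε hε
    have hp1 := (pEps_facts (j := j) hε.1 hε.2).2.1
    simp only [hpP] at hode hp1
    have hd0 : 0 < δ ε 1 * M ε := (mul_pos hM0 hρ).trans hd1
    set T := min (M ε) S with hT
    have hdT : δ ε 1 * M ε ≤ T := le_min hd2.le hdS.le
    have hTM : T ≤ M ε := min_le_left _ _
    have hTS : T ≤ S := min_le_right _ _
    have hg := gron hP hε.1.le hp1 hd0 hdT (cZ.mono (Icc_subset_Icc le_rfl hTM))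
      (cW.mono (Icc_subset_Icc le_rfl hTM))
      (fun s hs => hode s ⟨hd1.trans hs.1, hs.2.trans_le hTM⟩) hZd hWd
    have hg' : ∀ s ∈ Icc (δ ε 1 * M ε) T,
        (Z ε s - bubble (j+3) s)^2 + (W ε s - bubD j s)^2 ≤ κ' := by
      intro s hs
      refine (hg s hs).trans (le_trans ?_ hBε.le)
      apply mul_le_mul_of_nonneg_left _ (by positivity)
      apply Real.exp_le_exp.2
      exact mul_le_mul_of_nonneg_left hTS (by linarith)
    have hSM : S < M ε := by
      by_contra hcon
      push Not at hcon
      have hTe : T = M ε := min_eq_left hcon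
      have h1 := hg' (M ε) ⟨hd2.le, hTe.ge⟩
      rw [hZM] at h1
      have h2 := bub_anti j hM0.le hcon
      have h3 : κ' ≤ (bubble (j+3) S)^2/2 := min_le_right _ _
      nlinarith [sq_nonneg (W ε (M ε) - bubD j (M ε))]
    refine ⟨hSM, fun s hs => (hg' s ⟨hs.1, ?_⟩).trans (min_le_left _ _)⟩
    rw [hT, min_eq_right hSM.le]; exact hs.2
  have claim2 : ∀ a S, 0 < a → 0 < S → ∀ κ > 0, ∀ᶠ ε in 𝓝[>] (0:ℝ), (0 < ε ∧ ε < 2/((j:ℝ)+1)) ∧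
      ∀ s ∈ Icc a S, s ∈ Ioo (M ε * ρ ε 2) (M ε) ∧ |Z ε s - bubble (j+3) s| < κ ∧
        |W ε s - bubD j s| < κ := by
    intro a S ha hS κ hκ
    filter_upwards [small_ev j, claim S hS ((κ/2)^2) (by positivity), hdel.eventually (gt_mem_nhds ha)]
      with ε hε hc hda
    refine ⟨hε, fun s hs => ?_⟩
    obtain ⟨-, hM0, hρ, hd1, hd2, -⟩ := hZW ε hε
    have h1 := hc.2 s ⟨hda.le.trans hs.1, hs.2⟩
    refine ⟨⟨hd1.trans (hda.trans_le hs.1), hs.2.trans_lt hc.1⟩, ?_, ?_⟩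
    · have : |Z ε s - bubble (j+3) s| ≤ κ/2 := abs_le_of_sq_le_sq (by
        nlinarith [sq_nonneg (W ε s - bubD j s)]) (by positivity)
      linarith
    · have : |W ε s - bubD j s| ≤ κ/2 := abs_le_of_sq_le_sq (by
        nlinarith [sq_nonneg (Z ε s - bubble (j+3) s)]) (by positivity)
      linarith
  refine ⟨?_, ?_, hdel, ?_⟩
  · -- domination
    set s₀ : ℝ := ((j:ℝ)+4)^2 with hs₀
    have hs0 : 0 < s₀ := by positivity
    have hZl : Tendsto (fun ε => Z ε s₀) (𝓝[>] 0) (𝓝 (bubble (j+3) s₀)) := by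
      rw [Metric.tendsto_nhds]
      intro κ hκ
      filter_upwards [claim2 s₀ s₀ hs0 hs0 κ hκ] with ε h
      exact (h.2 s₀ ⟨le_rfl, le_rfl⟩).2.1
    have hWl : Tendsto (fun ε => W ε s₀) (𝓝[>] 0) (𝓝 (bubD j s₀)) := by
      rw [Metric.tendsto_nhds]
      intro κ hκ
      filter_upwards [claim2 s₀ s₀ hs0 hs0 κ hκ] with ε h
      exact (h.2 s₀ ⟨le_rfl, le_rfl⟩).2.2
    have hlim : Tendsto (fun ε => s₀ * W ε s₀ / Z ε s₀ * pEps (j+3) ε) (𝓝[>] 0)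
        (𝓝 (s₀ * bubD j s₀ / bubble (j+3) s₀ * P)) :=
      ((hWl.const_mul s₀).div hZl (bub_pos j s₀).ne').mul (pEps_tendsto j)
    have hneg : s₀ * bubD j s₀ / bubble (j+3) s₀ * P < -((j:ℝ)+4) := by
      have hb := bub_base_pos j s₀
      rw [bubD, bub_eq, hP]
      have e : (1 + s₀^2 / (((j:ℝ)+3) * ((j:ℝ)+1)))^(-(((j:ℝ)+1)/2)) =
        (1 + s₀^2 / (((j:ℝ)+3) * ((j:ℝ)+1)))^(-(((j:ℝ)+3)/2)) * (1 + s₀^2 / (((j:ℝ)+3) * ((j:ℝ)+1))) := by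
        rw [← Real.rpow_add_one (by linarith)]; congr 1; ring
      rw [e]
      have hQ : 0 < (1 + s₀^2 / (((j:ℝ)+3) * ((j:ℝ)+1)))^(-(((j:ℝ)+3)/2)) :=
        Real.rpow_pos_of_pos (by linarith) _
      generalize (1 + s₀^2 / (((j:ℝ)+3) * ((j:ℝ)+1)))^(-(((j:ℝ)+3)/2)) = Q at hQ
      have e2 : s₀ * (-(s₀ / ((j:ℝ)+3)) * Q) / (Q * (1 + s₀^2 / (((j:ℝ)+3) * ((j:ℝ)+1)))) *
          (1 + 4/((j:ℝ)+1)) = -(((j:ℝ)+5) * s₀^2 / (((j:ℝ)+3) * ((j:ℝ)+1) + s₀^2)) := by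
        field_simp; ring
      rw [e2, neg_lt_neg_iff, lt_div_iff₀ (by positivity)]
      have hj0 : (0:ℝ) ≤ j := Nat.cast_nonneg j
      have h1 : ((j:ℝ)+4) * (((j:ℝ)+3) * ((j:ℝ)+1)) < s₀^2 := by
        rw [hs₀]
        nlinarith [pow_nonneg hj0 2, pow_nonneg hj0 3, pow_nonneg hj0 4]
      nlinarith
    have hev := (claim2 s₀ s₀ hs0 hs0 1 one_pos).and (hlim.eventually (gt_mem_nhds hneg))
    obtain ⟨e0, he0, hsub⟩ := mem_nhdsGT_iff_exists_Ioo_subset.1 hev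
    refine ⟨fun s => if s ≤ s₀ then 1 else (s₀/s)^(j+4), ?_, ?_, ?_, min e0 (2/((j:ℝ)+1)), ?_, ?_⟩
    · exact Measurable.ite measurableSet_Iic measurable_const (by fun_prop)
    · intro s
      beta_reduce
      split_ifs with h
      · exact zero_le_one
      · have : 0 < s := hs0.trans (not_le.1 h)
        positivity
    · rw [← Ioc_union_Ioi_eq_Ioi hs0.le]
      apply IntegrableOn.union
      · have h1 : IntegrableOn (fun s : ℝ => s^(j+3-1)) (Ioc 0 s₀) :=
          ((continuous_pow _).integrableOn_Icc).mono_set Ioc_subset_Icc_self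
        refine h1.congr_fun ?_ measurableSet_Ioc
        intro s hs
        simp only [if_pos hs.2, one_mul]
      · have h1 : IntegrableOn (fun s : ℝ => s₀^(j+4) * s^(-2:ℝ)) (Ioi s₀) :=
          (integrableOn_Ioi_rpow_of_lt (by norm_num) hs0).const_mul _
        refine h1.congr_fun ?_ measurableSet_Ioi
        intro s hs
        have hs' : s₀ < s := hs
        have hsp : 0 < s := hs0.trans hs'
        simp only [if_neg (not_le.2 hs')]
        rw [Real.rpow_neg hsp.le, div_pow, show j + 3 - 1 = j + 2 by omega,
          show s^(2:ℝ) = s^2 by norm_num]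
        rw [show s^(j+4) = s^(j+2) * s^2 by ring]
        field_simp
    · refine ⟨lt_min he0 (by positivity), ?_⟩
      push_cast
      rw [show (j:ℝ)+3-2 = j+1 by ring]
      refine (min_le_right _ _).trans_lt ?_
      apply div_lt_div_of_pos_right _ hj1
      norm_num
    · intro ε hε s hs
      obtain ⟨⟨hεs, hcl⟩, hk⟩ := hsub ⟨hε.1, hε.2.trans_le (min_le_left _ _)⟩
      have hs₀I := (hcl s₀ ⟨le_rfl, le_rfl⟩).1
      obtain ⟨-, hM0, hρ, hd1, hd2, -, -, hode, -, -, -, hdec⟩ := hZW ε hεs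
      have hp1 := (pEps_facts (j := j) hεs.1 hεs.2).2.1
      have hsp : 0 < s := hs
      rw [hzZ ε hεs s]
      have hv0 : 0 ≤ (if s ≤ s₀ then 1 else (s₀/s)^(j+4)) := by
        split_ifs with h
        · exact zero_le_one
        · positivity
      by_cases hI : M ε * ρ ε 2 < s ∧ s < M ε
      · rw [if_pos hI]
        obtain ⟨-, -, hZp, hZ1⟩ := hode s hI
        rw [abs_of_pos hZp]
        have hstep : Z ε s ^ (pEps (j+3) ε + 1) ≤ Z ε s ^ pEps (j+3) ε :=
          Real.rpow_le_rpow_of_exponent_ge hZp hZ1 (by linarith)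
        have hmain : Z ε s ^ pEps (j+3) ε ≤ (if s ≤ s₀ then 1 else (s₀/s)^(j+4)) := by
          split_ifs with h
          · exact Real.rpow_le_one hZp.le hZ1 (by linarith)
          · push Not at h
            have h1 := hdec s₀ hs₀I s hI
            have hZ01 := (hode s₀ hs₀I).2.2.2
            set k := s₀ * W ε s₀ / Z ε s₀ with hkd
            have hq : 0 < s/s₀ := by positivity
            have hq1 : 1 ≤ s/s₀ := by rw [le_div_iff₀ hs0]; linarith
            have h2 : Z ε s ≤ (s/s₀)^k := by
              refine h1.trans (mul_le_of_le_one_left (Real.rpow_nonneg hq.le _) hZ01)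
            calc Z ε s ^ pEps (j+3) ε ≤ ((s/s₀)^k)^pEps (j+3) ε :=
                  Real.rpow_le_rpow hZp.le h2 (by linarith)
              _ = (s/s₀)^(k * pEps (j+3) ε) := (Real.rpow_mul hq.le _ _).symm
              _ ≤ (s/s₀)^(-((j:ℝ)+4)) := Real.rpow_le_rpow_of_exponent_le hq1 hk.le
              _ = (s₀/s)^(j+4) := by
                  rw [Real.rpow_neg hq.le, ← Real.inv_rpow hq.le, inv_div,
                    show ((j:ℝ)+4) = ((j+4:ℕ):ℝ) by push_cast; ring, Real.rpow_natCast]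
        exact ⟨hmain, hstep.trans hmain⟩
      · rw [if_neg hI, abs_zero, Real.zero_rpow (by linarith), Real.zero_rpow (by linarith)]
        exact ⟨hv0, hv0⟩
  · rw [tendsto_atTop]
    intro b
    filter_upwards [claim (max b 1) (by positivity) 1 one_pos] with ε h
    exact (le_max_left b 1).trans h.1.le
  · intro K hK0 hKc
    rcases K.eq_empty_or_nonempty with rfl | hne
    · exact ⟨tendstoUniformlyOn_empty, tendstoUniformlyOn_empty, tendstoUniformlyOn_empty⟩
    obtain ⟨a, haK, ha⟩ := hKc.exists_isLeast hne
    obtain ⟨b, hbK, hb⟩ := hKc.exists_isGreatest hne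
    have ha0 : 0 < a := hK0 haK
    have hb0 : 0 < b := hK0 hbK
    have hKI : ∀ s ∈ K, s ∈ Icc a b := fun s hs => ⟨ha hs, hb hs⟩
    have hz0 : ∀ ε, (0 < ε ∧ ε < 2/((j:ℝ)+1)) → ∀ s ∈ Ioo (M ε * ρ ε 2) (M ε), z ε s = Z ε s := by
      intro ε hε s hs
      rw [hzZ ε hε s, if_pos ⟨hs.1, hs.2⟩]
    have hz1 : ∀ ε, (0 < ε ∧ ε < 2/((j:ℝ)+1)) → ∀ s ∈ Ioo (M ε * ρ ε 2) (M ε), deriv (z ε) s = W ε s := by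
      intro ε hε s hs
      have : z ε =ᶠ[𝓝 s] Z ε := by
        filter_upwards [Ioo_mem_nhds hs.1 hs.2] with t ht using hz0 ε hε t ht
      rw [this.deriv_eq]
      exact ((hZW ε hε).2.2.2.2.2.2.2.1 s hs).1.deriv
    have hz2 : ∀ ε, (0 < ε ∧ ε < 2/((j:ℝ)+1)) → ∀ s ∈ Ioo (M ε * ρ ε 2) (M ε),
        deriv (deriv (z ε)) s = -(((j:ℝ)+2)/s * W ε s) - (Z ε s)^(pEps (j+3) ε) := by
      intro ε hε s hs
      have : deriv (z ε) =ᶠ[𝓝 s] W ε := by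
        filter_upwards [Ioo_mem_nhds hs.1 hs.2] with t ht using hz1 ε hε t ht
      rw [this.deriv_eq]
      exact ((hZW ε hε).2.2.2.2.2.2.2.1 s hs).2.1.deriv
    have hdU : deriv (bubble (j+3)) = bubD j := funext fun s => (bub_der j s).deriv
    refine ⟨?_, ?_, ?_⟩
    · rw [Metric.tendstoUniformlyOn_iff]
      intro κ hκ
      filter_upwards [claim2 a b ha0 hb0 κ hκ] with ε h s hs
      obtain ⟨h1, h2, h3⟩ := h.2 s (hKI s hs)
      rw [hz0 ε h.1 s h1, dist_comm, Real.dist_eq]; exact h2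
    · rw [Metric.tendstoUniformlyOn_iff]
      intro κ hκ
      filter_upwards [claim2 a b ha0 hb0 κ hκ] with ε h s hs
      obtain ⟨h1, h2, h3⟩ := h.2 s (hKI s hs)
      rw [hz1 ε h.1 s h1, hdU, dist_comm, Real.dist_eq]; exact h3
    · rw [Metric.tendstoUniformlyOn_iff]
      intro κ hκ
      set D := ((j:ℝ)+2)/a + P with hD
      have hD0 : 0 < D := by positivity
      have hκ' : 0 < κ / (2 * D) := by positivity
      filter_upwards [claim2 a b ha0 hb0 _ hκ', hid.eventually (gt_mem_nhds (half_pos hκ))]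
        with ε h hεκ s hs
      obtain ⟨h1, h2, h3⟩ := h.2 s (hKI s hs)
      have hs0 : 0 < s := hK0 hs
      obtain ⟨-, -, hZp, hZ1⟩ := (hZW ε h.1).2.2.2.2.2.2.2.1 s h1
      have hp1 := (pEps_facts (j := j) h.1.1 h.1.2).2.1
      rw [hpP] at hp1
      have hpd := pow_diff h.1.1.le hp1 hZp.le hZ1 (bub_pos j s).le (bub_le j s)
      rw [hz2 ε h.1 s h1, hdU, (bubD_der j hs0.ne').deriv, dist_comm, Real.dist_eq, hpP]
      have e : -(((j:ℝ)+2)/s * W ε s) - (Z ε s)^(P-ε) -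
          (-(((j:ℝ)+2)/s * bubD j s) - (bubble (j+3) s)^(1 + 4/((j:ℝ)+1))) =
          -((((j:ℝ)+2)/s * (W ε s - bubD j s)) + ((Z ε s)^(P-ε) - (bubble (j+3) s)^P)) := by
        rw [← hP]; ring
      rw [e, abs_neg]
      have t1 : |((j:ℝ)+2)/s * (W ε s - bubD j s)| ≤ ((j:ℝ)+2)/a * (κ/(2*D)) := by
        rw [abs_mul, abs_of_nonneg (by positivity)]
        apply mul_le_mul _ h3.le (abs_nonneg _) (by positivity)
        exact div_le_div_of_nonneg_left (by positivity) ha0 (hKI s hs).1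
      have t2 : P * |Z ε s - bubble (j+3) s| ≤ P * (κ/(2*D)) :=
        mul_le_mul_of_nonneg_left h2.le (by linarith)
      have t3 : ((j:ℝ)+2)/a * (κ/(2*D)) + P * (κ/(2*D)) = κ/2 := by
        rw [← add_mul, ← hD]; field_simp
      have := abs_add_le (((j:ℝ)+2)/s * (W ε s - bubD j s)) ((Z ε s)^(P-ε) - (bubble (j+3) s)^P)
      linarith
end
end

section
/- Let n ≥ 3, m ≥ 2, and for each ε ∈ (0, 4/(n−2)) let u_ε be a radial Dirichlet solution with exactly m−1 interior zeros, with largest critical point δ_{1,ε}. Then, as ε → 0⁺: (κ_n ε)^{−1} · |u_ε(δ_{1,ε})|^{−ε(n−2)/2} · [ u_ε'(1)² − ((n−2)/(n − ε(n−2)/2)) · |u_ε(δ_{1,ε})|^{2n/(n−2)−ε} · δ_{1,ε}^n ] → n^{(n−2)/2}·(n−2)^{(n+2)/2}. -/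
open Real Set Filter Topology MeasureTheory

noncomputable section

/-- helper: monotonicity from derivative on the interior. -/
lemma mono_of_hasDerivAt {f f' : ℝ → ℝ} {a b : ℝ} (hc : ContinuousOn f (Icc a b))
    (hd : ∀ x ∈ Ioo a b, HasDerivAt f (f' x) x) (h0 : ∀ x ∈ Ioo a b, 0 ≤ f' x) :
    MonotoneOn f (Icc a b) := by
  apply monotoneOn_of_deriv_nonneg (convex_Icc a b) hc
  · rw [interior_Icc]
    exact fun x hx => (hd x hx).differentiableAt.differentiableWithinAt
  · rw [interior_Icc]
    intro x hx
    rw [(hd x hx).deriv]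
    exact h0 x hx

lemma anti_of_hasDerivAt {f f' : ℝ → ℝ} {a b : ℝ} (hc : ContinuousOn f (Icc a b))
    (hd : ∀ x ∈ Ioo a b, HasDerivAt f (f' x) x) (h0 : ∀ x ∈ Ioo a b, f' x ≤ 0) :
    AntitoneOn f (Icc a b) := by
  apply antitoneOn_of_deriv_nonpos (convex_Icc a b) hc
  · rw [interior_Icc]
    exact fun x hx => (hd x hx).differentiableAt.differentiableWithinAt
  · rw [interior_Icc]
    intro x hx
    rw [(hd x hx).deriv]
    exact h0 x hx

/-- Emden-Fowler phase-plane system, in the radial variable. -/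
structure PH (β γ p K : ℝ) (y z : ℝ → ℝ) : Prop where
  hp : 1 < p
  hβ : 0 ≤ β
  hβ' : 8 * β ≤ 1
  hγ : 0 < γ
  hK : ∀ x : ℝ, (γ + 1) * x ^ 2 ≤ 2 * |x| ^ (p + 1) / (p + 1) + K
  yc : ContinuousOn y (Icc 0 1)
  zc : ContinuousOn z (Icc 0 1)
  y0 : y 0 = 0
  z0 : z 0 = 0
  dy : ∀ r ∈ Ioo (0 : ℝ) 1, HasDerivAt y (z r / r) r
  dz : ∀ r ∈ Ioo (0 : ℝ) 1,
    HasDerivAt z ((2 * β * z r + γ * y r - |y r| ^ (p - 1) * y r) / r) r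

/-- The phase-plane energy (shifted by `K`). -/
def PP (γ p K : ℝ) (y z : ℝ → ℝ) (r : ℝ) : ℝ :=
  z r ^ 2 - γ * y r ^ 2 + 2 * |y r| ^ (p + 1) / (p + 1) + K

lemma PH.neg {β γ p K : ℝ} {y z : ℝ → ℝ} (h : PH β γ p K y z) :
    PH β γ p K (fun r => - y r) (fun r => - z r) where
  hp := h.hp
  hβ := h.hβ
  hβ' := h.hβ'
  hγ := h.hγ
  hK := h.hK
  yc := h.yc.neg
  zc := h.zc.neg
  y0 := by simp [h.y0]
  z0 := by simp [h.z0]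
  dy r hr := by
    refine (h.dy r hr).neg.congr_deriv ?_
    ring
  dz r hr := by
    refine (h.dz r hr).neg.congr_deriv ?_
    rw [abs_neg]
    ring

lemma PP_neg (γ p K : ℝ) (y z : ℝ → ℝ) (r : ℝ) :
    PP γ p K (fun r => - y r) (fun r => - z r) r = PP γ p K y z r := by
  simp [PP]

section
variable {β γ p K : ℝ} {y z : ℝ → ℝ}

lemma PH.PPcont (h : PH β γ p K y z) : ContinuousOn (PP γ p K y z) (Icc 0 1) := by
  unfold PP
  have hy := h.yc
  have hz := h.zc
  have : ContinuousOn (fun r => |y r| ^ (p + 1)) (Icc 0 1) :=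
    hy.abs.rpow_const (fun x _ => Or.inr (by linarith [h.hp]))
  fun_prop

lemma PH.dPP (h : PH β γ p K y z) {r : ℝ} (hr : r ∈ Ioo (0 : ℝ) 1) :
    HasDerivAt (PP γ p K y z) (4 * β * z r ^ 2 / r) r := by
  have h1 := h.dy r hr
  have h2 := h.dz r hr
  have hp := h.hp
  have h3 := (hasDerivAt_abs_rpow (y r) (p := p + 1) (by linarith)).comp r h1
  have h4 := (((h2.pow 2).sub ((h1.pow 2).const_mul γ)).add
    ((h3.const_mul 2).div_const (p + 1))).add_const K
  refine h4.congr_deriv ?_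
  have : p + 1 - 2 = p - 1 := by ring
  rw [this]
  have hr0 : r ≠ 0 := hr.1.ne'
  have hp1 : p + 1 ≠ 0 := by linarith
  field_simp
  ring

lemma PH.PPmono (h : PH β γ p K y z) : MonotoneOn (PP γ p K y z) (Icc 0 1) := by
  refine mono_of_hasDerivAt h.PPcont (fun x hx => h.dPP hx) ?_
  intro x hx
  have := h.hβ
  have := hx.1
  positivity

lemma PH.PP0 (h : PH β γ p K y z) : PP γ p K y z 0 = K := by
  have : p + 1 ≠ 0 := by linarith [h.hp]
  simp [PP, h.y0, h.z0, Real.zero_rpow this]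

lemma PH.z_le (h : PH β γ p K y z) (r : ℝ) : z r ^ 2 ≤ PP γ p K y z r := by
  have := h.hK (y r)
  unfold PP
  nlinarith [sq_nonneg (y r)]

lemma PH.y_le (h : PH β γ p K y z) (r : ℝ) : y r ^ 2 ≤ PP γ p K y z r := by
  have := h.hK (y r)
  unfold PP
  nlinarith [sq_nonneg (z r)]

lemma PH.piece (h : PH β γ p K y z) {r1 r2 τ : ℝ} (h1 : 0 ≤ r1) (h12 : r1 ≤ r2) (h2 : r2 ≤ 1)
    (hτ : τ ^ 2 = 1) (hz : ∀ r ∈ Ioo r1 r2, 0 ≤ τ * z r) :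
    PP γ p K y z r2 * (1 - 8 * β) ≤ PP γ p K y z r1 := by
  set P := PP γ p K y z with hP
  set sq := √(P r2) with hsq
  have hP2 : 0 ≤ P r2 := le_trans (sq_nonneg _) (h.y_le r2)
  have hsq2 : sq ^ 2 = P r2 := Real.sq_sqrt hP2
  have hsq0 : 0 ≤ sq := Real.sqrt_nonneg _
  have hβ := h.hβ
  have sub : Icc r1 r2 ⊆ Icc 0 1 := Icc_subset_Icc h1 h2
  have anti : AntitoneOn (fun r => P r - 4 * β * sq * τ * y r) (Icc r1 r2) := by
    refine anti_of_hasDerivAt (f' := fun r => 4 * β * z r ^ 2 / r - 4 * β * sq * τ * (z r / r))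
      ?_ ?_ ?_
    · have := h.PPcont.mono sub
      have := h.yc.mono sub
      fun_prop
    · intro r hr
      have hr' : r ∈ Ioo (0 : ℝ) 1 := ⟨by linarith [hr.1], by linarith [hr.2]⟩
      exact (h.dPP hr').sub ((h.dy r hr').const_mul _)
    · intro r hr
      have hr0 : 0 < r := by linarith [hr.1]
      have e : 4 * β * z r ^ 2 / r - 4 * β * sq * τ * (z r / r)
          = 4 * β * (τ * z r) * (τ * z r - sq) / r := by
        have : z r ^ 2 = (τ * z r) * (τ * z r) := by
          linear_combination (-z r ^ 2) * hτ
        rw [this]; ring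
      rw [e]
      apply div_nonpos_of_nonpos_of_nonneg _ hr0.le
      apply mul_nonpos_of_nonneg_of_nonpos
      · have := hz r hr
        positivity
      · have a1 : z r ^ 2 ≤ P r := h.z_le r
        have a2 : P r ≤ P r2 := h.PPmono (sub ⟨hr.1.le, hr.2.le⟩) (sub ⟨h12, le_rfl⟩) hr.2.le
        have : (τ * z r) ^ 2 ≤ sq ^ 2 := by
          rw [hsq2, mul_pow, hτ]; linarith
        have := abs_le_of_sq_le_sq this hsq0
        linarith [(abs_le.1 this).2]
  have A := anti ⟨le_rfl, h12⟩ ⟨h12, le_rfl⟩ h12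
  simp only at A
  have b1 : |y r1| ≤ sq := by
    apply abs_le_of_sq_le_sq' _ hsq0 |> abs_le.2
    rw [hsq2]
    exact (h.y_le r1).trans (h.PPmono (sub ⟨le_rfl, h12⟩) (sub ⟨h12, le_rfl⟩) h12)
  have b2 : |y r2| ≤ sq := by
    apply abs_le_of_sq_le_sq' _ hsq0 |> abs_le.2
    rw [hsq2]
    exact (h.y_le r2)
  have b3 : τ * (y r2 - y r1) ≤ 2 * sq := by
    have : |τ| = 1 := by
      rw [← sq_abs] at hτ
      nlinarith [abs_nonneg τ]
    calc τ * (y r2 - y r1) ≤ |τ * (y r2 - y r1)| := le_abs_self _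
      _ = |y r2 - y r1| := by rw [abs_mul, this, one_mul]
      _ ≤ |y r2| + |y r1| := abs_sub _ _
      _ ≤ _ := by linarith
  have b4 : β * sq * (τ * (y r2 - y r1)) ≤ β * sq * (2 * sq) := by gcongr
  nlinarith

lemma PH.crit (h : PH β γ p K y z) {r : ℝ} (hr : r ∈ Ioo (0 : ℝ) 1) (hy : 0 < y r)
    (hz : z r = 0) : (2 * β * z r + γ * y r - |y r| ^ (p - 1) * y r) / r < 0 := by
  have h1 : K ≤ PP γ p K y z r := by
    refine h.PP0.symm.le.trans ?_
    exact h.PPmono ⟨le_rfl, zero_le_one⟩ ⟨hr.1.le, hr.2.le⟩ hr.1.le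
  have hp := h.hp
  have hγ := h.hγ
  unfold PP at h1
  rw [hz, abs_of_pos hy] at *
  apply div_neg_of_neg_of_pos _ hr.1
  have e : y r ^ (p + 1) = y r ^ (p - 1) * y r ^ 2 := by
    rw [← Real.rpow_natCast (y r) 2, ← Real.rpow_add hy]; congr 1; push_cast; ring
  rw [e] at h1
  have h2 : γ * y r ^ 2 ≤ 2 * (y r ^ (p - 1) * y r ^ 2) / (p + 1) := by linarith
  rw [le_div_iff₀ (by linarith)] at h2
  have h3 : γ * (p + 1) ≤ 2 * y r ^ (p - 1) := by
    have : 0 < y r ^ 2 := by positivity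
    nlinarith
  have h4 : γ < y r ^ (p - 1) := by nlinarith
  nlinarith

lemma PH.nodal_pos (h : PH β γ p K y z) {r1 r2 : ℝ} (h1 : 0 ≤ r1) (h12 : r1 < r2) (h2 : r2 ≤ 1)
    (y1 : y r1 = 0) (y2 : y r2 = 0) (hy : ∀ r ∈ Ioo r1 r2, 0 < y r) :
    PP γ p K y z r2 * (1 - 8 * β) ^ 2 ≤ PP γ p K y z r1 := by
  have sub : Icc r1 r2 ⊆ Icc 0 1 := Icc_subset_Icc h1 h2
  have sub' : Ioo r1 r2 ⊆ Ioo 0 1 := Ioo_subset_Ioo h1 h2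
  obtain ⟨x0, hx0, hz0⟩ := exists_hasDerivAt_eq_zero h12 (h.yc.mono sub) (by rw [y1, y2])
    (fun x hx => h.dy x (sub' hx))
  have hz0' : z x0 = 0 := by
    have := (sub' hx0).1
    field_simp at hz0
    simpa using hz0
  have key : ∀ x ∈ Ioo r1 r2, z x ≤ 0 → ∀ t ∈ Ioo r1 r2, x ≤ t → z t ≤ 0 := by
    intro x hx hzx t ht hxt
    have sub2 : Icc x t ⊆ Ioo r1 r2 := fun s hs => ⟨by linarith [hs.1, hx.1], by linarith [hs.2, ht.2]⟩
    refine image_le_of_deriv_right_lt_deriv_boundary' (f := z)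
      (f' := fun r => ((2 * β * z r + γ * y r - |y r| ^ (p - 1) * y r) / r))
      (B := fun _ => 0) (B' := fun _ => 0) (a := x) (b := t) ?_ ?_ hzx ?_ ?_ ?_ ⟨hxt, le_rfl⟩
    · exact h.zc.mono (fun s hs => sub (Ioo_subset_Icc_self (sub2 hs)))
    · intro s hs
      exact (h.dz s (sub' (sub2 ⟨hs.1, hs.2.le⟩))).hasDerivWithinAt
    · exact continuousOn_const
    · intro s hs
      exact hasDerivWithinAt_const _ _ _
    · intro s hs hzs
      have := sub2 ⟨hs.1, hs.2.le⟩
      exact h.crit (sub' this) (hy s this) hzs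
  set A := {x | x ∈ Ioo r1 r2 ∧ z x ≤ 0} with hA
  have hAx : x0 ∈ A := ⟨hx0, hz0'.le⟩
  have hAb : BddBelow A := ⟨r1, fun x hx => hx.1.1.le⟩
  set c := sInf A
  have c1 : r1 ≤ c := le_csInf ⟨x0, hAx⟩ (fun x hx => hx.1.1.le)
  have c2 : c ≤ r2 := (csInf_le hAb hAx).trans hx0.2.le
  have p1 := h.piece (τ := 1) h1 c1 (c2.trans h2) (by norm_num) (by
    intro r hr
    by_contra hcon
    have : r ∈ A := ⟨⟨hr.1, hr.2.trans_le c2⟩, by linarith⟩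
    exact absurd (csInf_le hAb this) (not_le.2 hr.2))
  have p2 := h.piece (τ := -1) (h1.trans c1) c2 h2 (by norm_num) (by
    intro r hr
    obtain ⟨x, hx, hxr⟩ := exists_lt_of_csInf_lt ⟨x0, hAx⟩ hr.1
    have := key x hx.1 hx.2 r ⟨c1.trans_lt hr.1, hr.2⟩ hxr.le
    linarith)
  have hβ' := h.hβ'
  calc _ = (PP γ p K y z r2 * (1 - 8 * β)) * (1 - 8 * β) := by ring
    _ ≤ PP γ p K y z c * (1 - 8 * β) := by
      apply mul_le_mul_of_nonneg_right p2; linarith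
    _ ≤ _ := p1

lemma PH.nodal (h : PH β γ p K y z) {r1 r2 : ℝ} (h1 : 0 ≤ r1) (h12 : r1 < r2) (h2 : r2 ≤ 1)
    (y1 : y r1 = 0) (y2 : y r2 = 0) (hy : ∀ r ∈ Ioo r1 r2, y r ≠ 0) :
    PP γ p K y z r2 * (1 - 8 * β) ^ 2 ≤ PP γ p K y z r1 := by
  have sub' : Ioo r1 r2 ⊆ Icc 0 1 := Ioo_subset_Icc_self.trans (Icc_subset_Icc h1 h2)
  have hpre : (∀ r ∈ Ioo r1 r2, 0 < y r) ∨ (∀ r ∈ Ioo r1 r2, y r < 0) := by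
    by_contra! hcon
    obtain ⟨⟨s, hs, hs'⟩, ⟨t, ht, ht'⟩⟩ := hcon
    have := isPreconnected_Ioo.intermediate_value hs ht (h.yc.mono sub') ⟨hs', ht'⟩
    obtain ⟨x, hx, hx'⟩ := this
    exact hy x hx hx'
  rcases hpre with hpos | hneg
  · exact h.nodal_pos h1 h12 h2 y1 y2 hpos
  · have := h.neg.nodal_pos h1 h12 h2 (by simpa using y1) (by simpa using y2)
      (fun r hr => by simpa using hneg r hr)
    simpa [PP_neg] using this

/-- Iteration over the nodal intervals `0 < ρ m < … < ρ 1 = 1`. -/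
lemma PH.iter (h : PH β γ p K y z) (m : ℕ) (hm : 1 ≤ m) (ρ : ℕ → ℝ)
    (hpos : ∀ k, 1 ≤ k → k ≤ m → 0 < ρ k ∧ ρ k ≤ 1 ∧ y (ρ k) = 0)
    (hlt : ∀ k, 1 ≤ k → k + 1 ≤ m → ρ (k + 1) < ρ k)
    (h0 : ∀ r ∈ Ioo 0 (ρ m), y r ≠ 0)
    (hk : ∀ k, 1 ≤ k → k + 1 ≤ m → ∀ r ∈ Ioo (ρ (k + 1)) (ρ k), y r ≠ 0) :
    PP γ p K y z (ρ 1) * ((1 - 8 * β) ^ 2) ^ m ≤ K := by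
  have hb : 0 ≤ (1 - 8 * β) ^ 2 := sq_nonneg _
  have main : ∀ j, j + 1 ≤ m →
      PP γ p K y z (ρ (m - j)) * ((1 - 8 * β) ^ 2) ^ (j + 1) ≤ K := by
    intro j
    induction j with
    | zero =>
      intro _
      have a := hpos m hm le_rfl
      have := h.nodal le_rfl a.1 a.2.1 h.y0 a.2.2 h0
      rw [h.PP0] at this
      simpa using this
    | succ j ih =>
      intro hj
      have ih' := ih (by omega)
      have e : m - j = (m - (j + 1)) + 1 := by omega
      have k1 : 1 ≤ m - (j + 1) := by omega
      have k2 : m - (j + 1) + 1 ≤ m := by omega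
      rw [e] at ih'
      have a := hpos _ k1 (by omega)
      have b := hpos (m - (j + 1) + 1) (by omega) k2
      have := h.nodal b.1.le (hlt _ k1 k2) a.2.1 b.2.2 a.2.2 (hk _ k1 k2)
      calc _ = (PP γ p K y z (ρ (m - (j + 1))) * (1 - 8 * β) ^ 2) * ((1 - 8 * β) ^ 2) ^ (j + 1) := by
            ring
        _ ≤ PP γ p K y z (ρ (m - (j + 1) + 1)) * ((1 - 8 * β) ^ 2) ^ (j + 1) := by gcongr
        _ ≤ K := ih'
  have := main (m - 1) (by omega)
  have e1 : m - (m - 1) = 1 := by omega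
  have e2 : m - 1 + 1 = m := by omega
  rwa [e1, e2] at this
end

/-- Rescaled last bump: positive solution on `[a,b]`, starting with `v = 1`, `v' = 0` at `a`,
vanishing at `b`.  Here the dimension is `k + 3`. -/
structure Bub (k : ℕ) (p a b : ℝ) (v w : ℝ → ℝ) : Prop where
  hp : 1 < p
  hp' : p ≤ ((k : ℝ) + 5) / (k + 1)
  ha : 0 < a
  hab : a < b
  vc : ContinuousOn v (Icc a b)
  wc : ContinuousOn w (Icc a b)
  dv : ∀ s ∈ Ioo a b, HasDerivAt v (w s) s
  dw : ∀ s ∈ Ioo a b, HasDerivAt w (-((k + 2) / s * w s) - v s ^ p) s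
  va : v a = 1
  wa : w a = 0
  vb : v b = 0
  vpos : ∀ s ∈ Ico a b, 0 < v s

/-- The standard bubble in dimension `k + 3`. -/
def UU (k : ℕ) (s : ℝ) : ℝ := (1 + s ^ 2 / ((k + 3) * (k + 1))) ^ (-(((k : ℝ) + 1) / 2))

section
variable {k : ℕ} {p a b : ℝ} {v w : ℝ → ℝ}

lemma Bub.v_nonneg (h : Bub k p a b v w) {s : ℝ} (hs : s ∈ Icc a b) : 0 ≤ v s := by
  rcases eq_or_lt_of_le hs.2 with rfl | h2
  · exact h.vb.ge
  · exact (h.vpos s ⟨hs.1, h2⟩).le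

lemma Bub.dW (h : Bub k p a b v w) {s : ℝ} (hs : s ∈ Ioo a b) :
    HasDerivAt (fun s => s ^ (k + 2) * w s) (-(s ^ (k + 2) * v s ^ p)) s := by
  refine ((hasDerivAt_pow (k + 2) s).mul (h.dw s hs)).congr_deriv ?_
  have : s ≠ 0 := (h.ha.trans hs.1).ne'
  simp only [show k + 2 - 1 = k + 1 from rfl]
  push_cast
  field_simp
  ring

lemma Bub.W_le (h : Bub k p a b v w) {s : ℝ} (hs : s ∈ Icc a b) : w s ≤ 0 := by
  have anti : AntitoneOn (fun s => s ^ (k + 2) * w s) (Icc a b) := by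
    refine anti_of_hasDerivAt ?_ (fun x hx => h.dW hx) ?_
    · have := h.wc
      fun_prop
    · intro x hx
      have h1 := h.v_nonneg (Ioo_subset_Icc_self hx)
      have h2 : 0 < x := h.ha.trans hx.1
      have := Real.rpow_nonneg h1 p
      have : 0 ≤ x ^ (k + 2) * v x ^ p := by positivity
      linarith
  have := anti ⟨le_rfl, h.hab.le⟩ hs hs.1
  simp only [h.wa, mul_zero] at this
  have h2 : 0 < s := h.ha.trans_le hs.1
  have : 0 < s ^ (k + 2) := by positivity
  by_contra hc
  push Not at hc
  nlinarith

lemma Bub.v_anti (h : Bub k p a b v w) : AntitoneOn v (Icc a b) :=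
  anti_of_hasDerivAt h.vc h.dv (fun _ hx => h.W_le (Ioo_subset_Icc_self hx))

lemma Bub.v_le (h : Bub k p a b v w) {s : ℝ} (hs : s ∈ Icc a b) : v s ≤ 1 := by
  rw [← h.va]; exact h.v_anti ⟨le_rfl, h.hab.le⟩ hs hs.1

/-- `w ≥ - s / n`. -/
lemma Bub.w_ge (h : Bub k p a b v w) {s : ℝ} (hs : s ∈ Icc a b) : -(s / (k + 3)) ≤ w s := by
  have mono : MonotoneOn (fun s => s ^ (k + 2) * w s + s ^ (k + 3) / (k + 3)) (Icc a b) := by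
    refine mono_of_hasDerivAt ?_
      (fun x hx => (h.dW hx).add ((hasDerivAt_pow (k + 3) x).div_const ((k : ℝ) + 3))) ?_
    · have := h.wc
      fun_prop
    · intro x hx
      have h1 := h.v_nonneg (Ioo_subset_Icc_self hx)
      have h2 : 0 < x := h.ha.trans hx.1
      have h3 : v x ^ p ≤ 1 := Real.rpow_le_one h1 (h.v_le (Ioo_subset_Icc_self hx))
        (by linarith [h.hp])
      simp only [show k + 3 - 1 = k + 2 from rfl]
      push_cast
      have h4 : ((k : ℝ) + 3) * x ^ (k + 2) / (k + 3) = x ^ (k + 2) := by field_simp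
      rw [h4]
      have : 0 < x ^ (k + 2) := by positivity
      nlinarith
  have := mono ⟨le_rfl, h.hab.le⟩ hs hs.1
  simp only [h.wa, mul_zero] at this
  have h2 : 0 < s := h.ha.trans_le hs.1
  have h2 : 0 < a := h.ha
  have e : s ^ (k + 2) * w s + s ^ (k + 3) / (k + 3) = s ^ (k + 2) * (w s + s / (k + 3)) := by
    ring
  rw [e] at this
  have h3 : 0 ≤ s ^ (k + 2) * (w s + s / (k + 3)) := le_trans (by positivity) this
  have := nonneg_of_mul_nonneg_right h3 (by positivity)
  linarith

lemma Bub.v_ge (h : Bub k p a b v w) {s : ℝ} (hs : s ∈ Icc a b) :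
    1 - s ^ 2 / 2 ≤ v s := by
  have mono : MonotoneOn (fun s => v s + s ^ 2 / 2) (Icc a b) := by
    refine mono_of_hasDerivAt ?_
      (fun x hx => (h.dv x hx).add ((hasDerivAt_pow 2 x).div_const 2)) ?_
    · have := h.vc
      fun_prop
    · intro x hx
      have h1 := h.w_ge (Ioo_subset_Icc_self hx)
      have h2 : 0 < x := h.ha.trans hx.1
      have h3 : x / ((k : ℝ) + 3) ≤ x := div_le_self h2.le (by linarith [k.cast_nonneg (α := ℝ)])
      simp
      linarith
  have := mono ⟨le_rfl, h.hab.le⟩ hs hs.1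
  simp only [h.va] at this
  nlinarith [sq_nonneg a]

/-- Upper bound for `w`. -/
lemma Bub.w_le (h : Bub k p a b v w) {s : ℝ} (hs : s ∈ Icc a b) :
    s ^ (k + 2) * w s ≤ - (v s ^ p * (s ^ (k + 3) - a ^ (k + 3)) / (k + 3)) := by
  set c := v s ^ p
  have anti : AntitoneOn (fun t => t ^ (k + 2) * w t + c * (t ^ (k + 3) / (k + 3))) (Icc a s) := by
    refine anti_of_hasDerivAt ?_
      (fun x hx => (h.dW ⟨hx.1, hx.2.trans_le hs.2⟩).add
        (((hasDerivAt_pow (k + 3) x).div_const ((k : ℝ) + 3)).const_mul c)) ?_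
    · have := h.wc.mono (Icc_subset_Icc le_rfl hs.2)
      fun_prop
    · intro x hx
      have hx' : x ∈ Icc a b := ⟨hx.1.le, hx.2.le.trans hs.2⟩
      have h1 := h.v_nonneg hs
      have h2 : 0 < x := h.ha.trans hx.1
      have h3 : c ≤ v x ^ p := Real.rpow_le_rpow h1 (h.v_anti hx' hs hx.2.le)
        (by linarith [h.hp])
      simp only [show k + 3 - 1 = k + 2 from rfl]
      push_cast
      have h4 : ((k : ℝ) + 3) * x ^ (k + 2) / (k + 3) = x ^ (k + 2) := by field_simp
      rw [h4]
      have : 0 < x ^ (k + 2) := by positivity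
      nlinarith
  have := anti ⟨le_rfl, hs.1⟩ ⟨hs.1, le_rfl⟩ hs.1
  simp only [h.wa, mul_zero] at this
  have e : -(c * (s ^ (k + 3) - a ^ (k + 3)) / (k + 3))
    = c * (a ^ (k + 3) / (k + 3)) - c * (s ^ (k + 3) / (k + 3)) := by ring
  rw [e]; linarith

lemma Bub.D_nonneg (h : Bub k p a b v w) {s : ℝ} (hs : s ∈ Icc a b) :
    0 ≤ s ^ (k + 3) * v s ^ (p + 1) + (k + 3) * s ^ (k + 2) * v s * w s
      + (k + 3) / (k + 1) * s ^ (k + 3) * w s ^ 2 := by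
  have mono : MonotoneOn (fun s => s ^ (k + 3) * v s ^ (p + 1) + (k + 3) * s ^ (k + 2) * v s * w s
      + (k + 3) / (k + 1) * s ^ (k + 3) * w s ^ 2) (Icc a b) := by
    refine mono_of_hasDerivAt (f' := fun s => (p + 1 - 2 * ((k + 3) / (k + 1))) *
      (s ^ (k + 3) * v s ^ p * w s)) ?_ ?_ ?_
    · have := h.wc
      have := h.vc
      have : ContinuousOn (fun s => v s ^ (p + 1)) (Icc a b) :=
        h.vc.rpow_const (fun x _ => Or.inr (by linarith [h.hp]))
      fun_prop
    · intro x hx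
      have hv := h.vpos x (Ioo_subset_Ico_self hx)
      have hx0 : x ≠ 0 := (h.ha.trans hx.1).ne'
      have d1 := h.dv x hx
      have d2 := h.dw x hx
      have d3 := d1.rpow_const (p := p + 1) (Or.inl hv.ne')
      have d4 := (((hasDerivAt_pow (k + 3) x).mul d3).add
        ((((hasDerivAt_pow (k + 2) x).const_mul ((k : ℝ) + 3)).mul d1).mul d2)).add
        (((hasDerivAt_pow (k + 3) x).const_mul (((k : ℝ) + 3) / (k + 1))).mul (d2.pow 2))
      refine d4.congr_deriv ?_
      have e1 : p + 1 - 1 = p := by ring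
      have e2 : v x ^ (p + 1) = v x ^ p * v x := by rw [Real.rpow_add hv, Real.rpow_one]
      simp only [show k + 3 - 1 = k + 2 from rfl, show k + 2 - 1 = k + 1 from rfl, Pi.pow_apply,
        Pi.mul_apply]
      rw [e1, e2]
      push_cast
      field_simp
      ring
    · intro x hx
      have hv := h.vpos x (Ioo_subset_Ico_self hx)
      have hx0 : 0 < x := (h.ha.trans hx.1)
      have hw := h.W_le (Ioo_subset_Icc_self hx)
      have := Real.rpow_pos_of_pos hv p
      apply mul_nonneg_of_nonpos_of_nonpos
      · have e : ((k : ℝ) + 5) / (k + 1) + 1 = 2 * ((k + 3) / (k + 1)) := by field_simp; ring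
        linarith [h.hp']
      · apply mul_nonpos_of_nonneg_of_nonpos _ hw
        positivity
  have := mono ⟨le_rfl, h.hab.le⟩ hs hs.1
  refine le_trans ?_ this
  have := h.ha
  simp only [h.va, h.wa]
  simp
  positivity

/-- `g = - w / (s v^{n/(n-2)})` is monotone. -/
lemma Bub.g_mono (h : Bub k p a b v w) {c : ℝ} (hc : c < b) :
    MonotoneOn (fun s => - w s * (s⁻¹ * v s ^ (-(((k : ℝ) + 3) / (k + 1))))) (Icc a c) := by
  have sub : Icc a c ⊆ Icc a b := Icc_subset_Icc le_rfl hc.le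
  refine mono_of_hasDerivAt (f' := fun s => v s ^ (-(((k : ℝ) + 3) / (k + 1)) - 1)
     * (s ^ (k + 4))⁻¹ * (s ^ (k + 3) * v s ^ (p + 1) + (k + 3) * s ^ (k + 2) * v s * w s
      + (k + 3) / (k + 1) * s ^ (k + 3) * w s ^ 2)) ?_ ?_ ?_
  · have := h.wc.mono sub
    have := h.vc.mono sub
    have : ContinuousOn (fun s => v s ^ (-(((k : ℝ) + 3) / (k + 1)))) (Icc a c) :=
        this.rpow_const (fun x hx => Or.inl (h.vpos x ⟨hx.1, hx.2.trans_lt hc⟩).ne')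
    have : ContinuousOn (fun s : ℝ => s⁻¹) (Icc a c) :=
      continuousOn_inv₀.mono (fun x hx => (h.ha.trans_le hx.1).ne')
    fun_prop
  · intro x hx
    have hx' : x ∈ Ioo a b := ⟨hx.1, hx.2.trans hc⟩
    have hv := h.vpos x (Ioo_subset_Ico_self hx')
    have hx0 : x ≠ 0 := (h.ha.trans hx.1).ne'
    have d1 := h.dv x hx'
    have d2 := h.dw x hx'
    have d3 := d1.rpow_const (p := (-(((k : ℝ) + 3) / (k + 1)))) (Or.inl hv.ne')
    have d4 := d2.neg.mul ((hasDerivAt_inv hx0).mul d3)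
    refine d4.congr_deriv ?_
    have e1 : v x ^ (-(((k : ℝ) + 3) / (k + 1))) = v x ^ (-(((k : ℝ) + 3) / (k + 1)) - 1) * v x := by
      rw [← Real.rpow_add_one hv.ne']; congr 1; ring
    have e2 : v x ^ (p + 1) = v x ^ p * v x := by rw [Real.rpow_add hv, Real.rpow_one]
    simp only [Pi.mul_apply, Pi.inv_apply, Pi.neg_apply]
    rw [e2, e1]
    generalize v x ^ (-(((k : ℝ) + 3) / (k + 1)) - 1) = q
    field_simp
    ring
  · intro x hx
    have hx' : x ∈ Ioo a b := ⟨hx.1, hx.2.trans hc⟩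
    have hv := h.vpos x (Ioo_subset_Ico_self hx')
    have hx0 : 0 < x := (h.ha.trans hx.1)
    have := h.D_nonneg (Ioo_subset_Icc_self hx')
    have := Real.rpow_pos_of_pos hv (-(((k : ℝ) + 3) / (k + 1)) - 1)
    positivity

lemma Bub.g_ge (h : Bub k p a b v w) {s0 : ℝ} (h0 : s0 ∈ Ioo a b) (h1 : s0 < 1) :
    (1 - s0 ^ 2 / 2) ^ (((k : ℝ) + 5) / (k + 1)) * (1 - (a / s0) ^ (k + 3)) / (k + 3) ≤
      - w s0 * (s0⁻¹ * v s0 ^ (-(((k : ℝ) + 3) / (k + 1)))) := by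
  have hs := Ioo_subset_Icc_self h0
  have a0 := h.ha
  have hs0 : 0 < s0 := h.ha.trans h0.1
  have b1 := h.w_le hs
  have b2 := h.v_ge hs
  have b3 := h.v_le hs
  have b4 := h.vpos s0 (Ioo_subset_Ico_self h0)
  have b5 : 1 ≤ v s0 ^ (-(((k : ℝ) + 3) / (k + 1))) := by
    apply Real.one_le_rpow_of_pos_of_le_one_of_nonpos b4 b3
    have : 0 ≤ ((k : ℝ) + 3) / (k + 1) := by positivity
    linarith
  have b6 : (1 - s0 ^ 2 / 2) ^ (((k : ℝ) + 5) / (k + 1)) ≤ v s0 ^ p := by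
    calc _ ≤ v s0 ^ (((k : ℝ) + 5) / (k + 1)) := by
          apply Real.rpow_le_rpow _ b2 (by positivity)
          nlinarith
      _ ≤ _ := Real.rpow_le_rpow_of_exponent_ge b4 b3 h.hp'
  have b7 : (a / s0) ^ (k + 3) ≤ 1 := pow_le_one₀ (by positivity) ((div_le_one hs0).2 h0.1.le)
  have b8 : v s0 ^ p * (1 - (a / s0) ^ (k + 3)) / (k + 3) ≤ - w s0 * s0⁻¹ := by
    have e : v s0 ^ p * (s0 ^ (k + 3) - a ^ (k + 3)) / (k + 3) =
      s0 ^ (k + 3) * (v s0 ^ p * (1 - (a / s0) ^ (k + 3)) / (k + 3)) := by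
      rw [div_pow]; field_simp
    have e2 : s0 ^ (k + 2) * w s0 = s0 ^ (k + 3) * (w s0 * s0⁻¹) := by
      field_simp
      ring
    rw [e, e2] at b1
    have : 0 < s0 ^ (k + 3) := by positivity
    nlinarith
  calc _ ≤ v s0 ^ p * (1 - (a / s0) ^ (k + 3)) / (k + 3) := by
        gcongr
    _ ≤ - w s0 * s0⁻¹ := b8
    _ ≤ (- w s0 * s0⁻¹) * v s0 ^ (-(((k : ℝ) + 3) / (k + 1))) := by
      have : 0 ≤ - w s0 * s0⁻¹ := by
        have := h.W_le hs
        have : 0 ≤ - w s0 := by linarith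
        positivity
      nlinarith
    _ = _ := by ring

/-- `q = v^{-2/(n-2)}` lower bound. -/
lemma Bub.q_ge (h : Bub k p a b v w) {s0 G : ℝ} (h0 : s0 ∈ Ioo a b)
    (hG : G / (k + 3) ≤ - w s0 * (s0⁻¹ * v s0 ^ (-(((k : ℝ) + 3) / (k + 1)))))
    {s : ℝ} (hs : s ∈ Ico s0 b) :
    1 + G * (s ^ 2 - s0 ^ 2) / ((k + 3) * (k + 1)) ≤ v s ^ (-(2 / ((k : ℝ) + 1))) := by
  have mono : MonotoneOn (fun t => v t ^ (-(2 / ((k : ℝ) + 1))) - G / ((k + 3) * (k + 1)) * t ^ 2)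
      (Icc s0 s) := by
    have sub : Icc s0 s ⊆ Icc a b := fun x hx => ⟨h0.1.le.trans hx.1, hx.2.trans hs.2.le⟩
    refine mono_of_hasDerivAt (f' := fun t => 2 * t / (k + 1) *
      (- w t * (t⁻¹ * v t ^ (-(((k : ℝ) + 3) / (k + 1)))) - G / (k + 3))) ?_ ?_ ?_
    · have := h.vc.mono sub
      have : ContinuousOn (fun s => v s ^ (-(2 / ((k : ℝ) + 1)))) (Icc s0 s) :=
        this.rpow_const (fun x hx => Or.inl (h.vpos x ⟨h0.1.le.trans hx.1, hx.2.trans_lt hs.2⟩).ne')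
      fun_prop
    · intro x hx
      have hx' : x ∈ Ioo a b := ⟨h0.1.trans hx.1, hx.2.trans hs.2⟩
      have hv := h.vpos x (Ioo_subset_Ico_self hx')
      have hx0 : x ≠ 0 := (h.ha.trans hx'.1).ne'
      have d3 := (h.dv x hx').rpow_const (p := (-(2 / ((k : ℝ) + 1)))) (Or.inl hv.ne')
      refine (d3.sub ((hasDerivAt_pow 2 x).const_mul (G / (((k : ℝ) + 3) * (k + 1))))).congr_deriv ?_
      have e1 : v x ^ (-(2 / ((k : ℝ) + 1)) - 1) = v x ^ (-(((k : ℝ) + 3) / (k + 1))) := by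
        congr 1; field_simp; ring
      rw [e1]
      generalize v x ^ (-(((k : ℝ) + 3) / (k + 1))) = q
      push_cast
      field_simp
    · intro x hx
      have hx0 : 0 < x := h.ha.trans (h0.1.trans hx.1)
      have := h.g_mono hs.2 ⟨h0.1.le, hs.1⟩ ⟨(h0.1.trans hx.1).le, hx.2.le⟩ hx.1.le
      simp only at this
      apply mul_nonneg (by positivity)
      linarith
  have := mono ⟨le_rfl, hs.1⟩ ⟨hs.1, le_rfl⟩ hs.1
  simp only at this
  have h1 : 1 ≤ v s0 ^ (-(2 / ((k : ℝ) + 1))) := by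
    apply Real.one_le_rpow_of_pos_of_le_one_of_nonpos (h.vpos s0 (Ioo_subset_Ico_self h0))
      (h.v_le (Ioo_subset_Icc_self h0))
    have : 0 ≤ 2 / ((k : ℝ) + 1) := by positivity
    linarith
  have e : 1 + G * (s ^ 2 - s0 ^ 2) / ((k + 3) * (k + 1)) =
    1 + G / ((k + 3) * (k + 1)) * s ^ 2 - G / ((k + 3) * (k + 1)) * s0 ^ 2 := by ring
  rw [e]; linarith

/-- Conclusion: `v ≤ λ^{-(n-2)/2} U`. -/
lemma Bub.v_le_U (h : Bub k p a b v w) {s0 G l : ℝ} (has : a < s0) (h1 : s0 < 1) (l0 : 0 < l)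
    (hG : G ≤ (1 - s0 ^ 2 / 2) ^ (((k : ℝ) + 5) / (k + 1)) * (1 - (a / s0) ^ (k + 3)))
    (hl : l * (1 + s0 ^ 2) ≤ 1) (hlG : l ≤ G) (hlG2 : l ≤ 1 - G * s0 ^ 2)
    {s : ℝ} (hs : s ∈ Icc a b) : v s ≤ l ^ (-(((k : ℝ) + 1) / 2)) * UU k s := by
  have N3 : (1 : ℝ) ≤ (k + 3) * (k + 1) := by nlinarith [k.cast_nonneg (α := ℝ)]
  have UUp : 0 < 1 + s ^ 2 / (((k : ℝ) + 3) * (k + 1)) := by positivity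
  rcases eq_or_lt_of_le hs.2 with rfl | hsb
  · rw [h.vb]; unfold UU; positivity
  have hv := h.vpos s ⟨hs.1, hsb⟩
  have key : l * (1 + s ^ 2 / ((k + 3) * (k + 1))) ≤ v s ^ (-(2 / ((k : ℝ) + 1))) := by
    rcases le_total s s0 with hss | hss
    · have : 1 ≤ v s ^ (-(2 / ((k : ℝ) + 1))) := by
        apply Real.one_le_rpow_of_pos_of_le_one_of_nonpos hv (h.v_le hs)
        have : 0 ≤ 2 / ((k : ℝ) + 1) := by positivity
        linarith
      refine le_trans (le_trans ?_ hl) this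
      gcongr
      calc s ^ 2 / (((k : ℝ) + 3) * (k + 1)) ≤ s ^ 2 := div_le_self (sq_nonneg _) N3
        _ ≤ s0 ^ 2 := by
          have := h.ha.trans_le hs.1
          gcongr
    · have h0 : s0 ∈ Ioo a b := ⟨has, hss.trans_lt hsb⟩
      have := h.q_ge (G := G) h0 (le_trans (by gcongr) (h.g_ge h0 h1)) ⟨hss, hsb⟩
      refine le_trans ?_ this
      have e : 1 + G * (s ^ 2 - s0 ^ 2) / ((k + 3) * (k + 1)) =
        (1 - G * s0 ^ 2 / ((k + 3) * (k + 1))) + G * (s ^ 2 / ((k + 3) * (k + 1))) := by ring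
      rw [e]
      have hG0 : 0 ≤ G := l0.le.trans hlG
      have : G * s0 ^ 2 / (((k : ℝ) + 3) * (k + 1)) ≤ G * s0 ^ 2 := div_le_self (by positivity) N3
      have : l * (s ^ 2 / (((k : ℝ) + 3) * (k + 1))) ≤ G * (s ^ 2 / (((k : ℝ) + 3) * (k + 1))) := by
        gcongr
      linarith
  have := Real.rpow_le_rpow_of_nonpos (by positivity) key
    (z := -(((k : ℝ) + 1) / 2)) (by have : 0 ≤ ((k : ℝ) + 1) / 2 := by positivity
                                    linarith)
  rw [← Real.rpow_mul hv.le, Real.mul_rpow l0.le UUp.le] at this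
  have e : -(2 / ((k : ℝ) + 1)) * -(((k : ℝ) + 1) / 2) = 1 := by field_simp
  rw [e, Real.rpow_one] at this
  exact this

lemma UU_pos (k : ℕ) (s : ℝ) : 0 < UU k s := by unfold UU; positivity

lemma UU_le_one (k : ℕ) (s : ℝ) : UU k s ≤ 1 := by
  unfold UU
  apply Real.rpow_le_one_of_one_le_of_nonpos
  · have : 0 ≤ s ^ 2 / (((k : ℝ) + 3) * (k + 1)) := by positivity
    linarith
  · have : 0 ≤ ((k : ℝ) + 1) / 2 := by positivity
    linarith

lemma UU_anti (k : ℕ) {s t : ℝ} (hs : 0 ≤ s) (hst : s ≤ t) : UU k t ≤ UU k s := by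
  unfold UU
  apply Real.rpow_le_rpow_of_nonpos (by positivity)
  · gcongr
  · have : 0 ≤ ((k : ℝ) + 1) / 2 := by positivity
    linarith

/-- derivative of `U`. -/
def UU1 (k : ℕ) (s : ℝ) : ℝ :=
  -(s / (k + 3)) * (1 + s ^ 2 / ((k + 3) * (k + 1))) ^ (-(((k : ℝ) + 3) / 2))

lemma UU_deriv (k : ℕ) (s : ℝ) : HasDerivAt (UU k) (UU1 k s) s := by
  have hp : 0 < 1 + s ^ 2 / (((k : ℝ) + 3) * (k + 1)) := by positivity
  have d := (((hasDerivAt_pow 2 s).div_const (((k : ℝ) + 3) * (k + 1))).const_add 1).rpow_const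
    (p := -(((k : ℝ) + 1) / 2)) (Or.inl hp.ne')
  refine d.congr_deriv ?_
  unfold UU1
  have e : -(((k : ℝ) + 1) / 2) - 1 = -(((k : ℝ) + 3) / 2) := by ring
  rw [e]
  generalize (1 + s ^ 2 / (((k : ℝ) + 3) * (k + 1))) ^ (-(((k : ℝ) + 3) / 2)) = q
  push_cast
  field_simp

lemma UU1_deriv (k : ℕ) (s : ℝ) : HasDerivAt (fun s => s ^ (k + 2) * UU1 k s)
    (-(s ^ (k + 2) * UU k s ^ (((k : ℝ) + 5) / (k + 1)))) s := by
  have hp : 0 < 1 + s ^ 2 / (((k : ℝ) + 3) * (k + 1)) := by positivity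
  have d := (((hasDerivAt_pow 2 s).div_const (((k : ℝ) + 3) * (k + 1))).const_add 1).rpow_const
    (p := -(((k : ℝ) + 3) / 2)) (Or.inl hp.ne')
  have d2 := (hasDerivAt_pow (k + 2) s).mul (((hasDerivAt_id s).div_const ((k : ℝ) + 3)).neg.mul d)
  refine d2.congr_deriv ?_
  have e0 : UU k s ^ (((k : ℝ) + 5) / (k + 1)) =
      (1 + s ^ 2 / (((k : ℝ) + 3) * (k + 1))) ^ (-(((k : ℝ) + 3) / 2) - 1) := by
    unfold UU
    rw [← Real.rpow_mul hp.le]; congr 1; field_simp; ring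
  have e1 : (1 + s ^ 2 / (((k : ℝ) + 3) * (k + 1))) ^ (-(((k : ℝ) + 3) / 2)) =
     (1 + s ^ 2 / (((k : ℝ) + 3) * (k + 1))) ^ (-(((k : ℝ) + 3) / 2) - 1) *
      (1 + s ^ 2 / (((k : ℝ) + 3) * (k + 1))) := by
    rw [← Real.rpow_add_one hp.ne']; congr 1; ring
  simp only [Pi.mul_apply, Pi.neg_apply, id, show k + 2 - 1 = k + 1 from rfl]
  rw [e0, e1]
  generalize (1 + s ^ 2 / (((k : ℝ) + 3) * (k + 1))) ^ (-(((k : ℝ) + 3) / 2) - 1) = q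
  push_cast
  field_simp
  ring

/-- Lower bound from the upper bound. -/
lemma Bub.v_ge_U (h : Bub k p a b v w) {l c L : ℝ} (l0 : 0 ≤ l) (c0 : 0 ≤ c) (hL : L ≤ b)
    (hU : ∀ s ∈ Icc a b, v s ≤ l * UU k s)
    (hc : ∀ s ∈ Icc a L, (l * UU k s) ^ p ≤ c * UU k s ^ (((k : ℝ) + 5) / (k + 1)))
    {s : ℝ} (hs : s ∈ Icc a L) : 1 - c + c * UU k s ≤ v s := by
  have sub : Icc a L ⊆ Icc a b := Icc_subset_Icc le_rfl hL
  have sub' : Ioo a L ⊆ Ioo a b := Ioo_subset_Ioo le_rfl hL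
  have aL : a ≤ L := hs.1.trans hs.2
  have m1 : MonotoneOn (fun s => s ^ (k + 2) * w s - c * (s ^ (k + 2) * UU1 k s)) (Icc a L) := by
    refine mono_of_hasDerivAt ?_ (fun x hx => (h.dW (sub' hx)).sub ((UU1_deriv k x).const_mul c)) ?_
    · have := h.wc.mono sub
      have : Continuous (fun s => s ^ (k + 2) * UU1 k s) :=
        continuous_iff_continuousAt.2 fun x => (UU1_deriv k x).continuousAt
      exact ContinuousOn.sub (by fun_prop) (this.continuousOn.const_smul c)
    · intro x hx
      have hx' := Ioo_subset_Icc_self hx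
      have x0 : 0 < x := h.ha.trans hx.1
      have : v x ^ p ≤ c * UU k x ^ (((k : ℝ) + 5) / (k + 1)) :=
        (Real.rpow_le_rpow (h.v_nonneg (sub hx')) (hU x (sub hx')) (by linarith [h.hp])).trans
          (hc x hx')
      have : x ^ (k + 2) * v x ^ p ≤ x ^ (k + 2) * (c * UU k x ^ (((k : ℝ) + 5) / (k + 1))) := by
        gcongr
      linarith
  have m2 : MonotoneOn (fun s => v s - c * UU k s) (Icc a L) := by
    refine mono_of_hasDerivAt ?_ (fun x hx => (h.dv x (sub' hx)).sub ((UU_deriv k x).const_mul c)) ?_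
    · have := h.vc.mono sub
      have : Continuous (UU k) :=
        continuous_iff_continuousAt.2 fun x => (UU_deriv k x).continuousAt
      fun_prop
    · intro x hx
      have x0 : 0 < x := h.ha.trans hx.1
      have a0 := h.ha
      have := m1 ⟨le_rfl, aL⟩ (Ioo_subset_Icc_self hx) hx.1.le
      simp only [h.wa] at this
      have q : UU1 k a ≤ 0 := by
        unfold UU1
        have : 0 ≤ a / ((k : ℝ) + 3) * (1 + a ^ 2 / ((k + 3) * (k + 1))) ^ (-(((k : ℝ) + 3) / 2)) := by
          positivity
        linarith
      have q2 : 0 ≤ c * (a ^ (k + 2) * (-UU1 k a)) := by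
        have : 0 ≤ - UU1 k a := by linarith
        positivity
      have q3 : 0 ≤ x ^ (k + 2) * (w x - c * UU1 k x) := by linarith
      exact nonneg_of_mul_nonneg_right q3 (by positivity)
  have := m2 ⟨le_rfl, aL⟩ hs hs.1
  simp only [h.va] at this
  have : c * UU k a ≤ c * 1 := by gcongr; exact UU_le_one k a
  linarith

/-- Pohozaev identity. -/
lemma Bub.poho (h : Bub k p a b v w) :
    b ^ (k + 3) * w b ^ 2 - 2 / (p + 1) * a ^ (k + 3) =
      (2 * ((k + 3) / (p + 1)) - (k + 1)) * ∫ s in a..b, s ^ (k + 2) * v s ^ (p + 1) := by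
  have hp := h.hp
  have cv : ContinuousOn (fun s => v s ^ (p + 1)) (Icc a b) :=
        h.vc.rpow_const (fun x _ => Or.inr (by linarith [h.hp]))
  have := intervalIntegral.integral_eq_sub_of_hasDerivAt_of_le h.hab.le
    (f := fun s => s ^ (k + 3) * w s ^ 2 + 2 / (p + 1) * (s ^ (k + 3) * v s ^ (p + 1))
      + (k + 1) * (s ^ (k + 2) * w s * v s))
    (f' := fun s => (2 * ((k + 3) / (p + 1)) - (k + 1)) * (s ^ (k + 2) * v s ^ (p + 1))) ?_ ?_ ?_
  · rw [intervalIntegral.integral_const_mul] at this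
    rw [this, h.va, h.wa, h.vb, Real.zero_rpow (by linarith)]
    simp
  · have := h.vc
    have := h.wc
    fun_prop
  · intro x hx
    have hv := h.vpos x (Ioo_subset_Ico_self hx)
    have hx0 : x ≠ 0 := (h.ha.trans hx.1).ne'
    have d1 := h.dv x hx
    have d2 := h.dw x hx
    have d3 := d1.rpow_const (p := p + 1) (Or.inl hv.ne')
    have d4 := (((hasDerivAt_pow (k + 3) x).mul (d2.pow 2)).add
      (((hasDerivAt_pow (k + 3) x).mul d3).const_mul (2 / (p + 1)))).add
      (((h.dW hx).mul d1).const_mul ((k : ℝ) + 1))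
    refine d4.congr_deriv ?_
    have e1 : p + 1 - 1 = p := by ring
    have e2 : v x ^ (p + 1) = v x ^ p * v x := by rw [Real.rpow_add hv, Real.rpow_one]
    simp only [show k + 3 - 1 = k + 2 from rfl, Pi.pow_apply, Pi.mul_apply]
    rw [e1, e2]
    have : p + 1 ≠ 0 := by linarith
    push_cast
    field_simp
    ring
  · apply ContinuousOn.intervalIntegrable_of_Icc h.hab.le
    fun_prop
end

section
variable {k : ℕ} {a b : ℝ → ℝ} {v w : ℝ → ℝ → ℝ}

/-- critical exponent in dimension `k+3`. -/
def pst (k : ℕ) : ℝ := ((k : ℝ) + 5) / (k + 1)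

lemma one_lt_pst (k : ℕ) : 1 < pst k := by
  unfold pst
  rw [one_lt_div (by positivity)]
  linarith

lemma ev_upper (hB : ∀ᶠ ε in 𝓝[>] (0 : ℝ), Bub k (pst k - ε) (a ε) (b ε) (v ε) (w ε))
    (ha : Tendsto a (𝓝[>] 0) (𝓝 0)) {l : ℝ} (l0 : 0 < l) (l1 : l < 1) :
    ∀ᶠ ε in 𝓝[>] (0 : ℝ), ∀ s ∈ Icc (a ε) (b ε),
      v ε s ≤ l ^ (-(((k : ℝ) + 1) / 2)) * UU k s := by
  set G := (l + 1) / 2 with hG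
  have t1 : Tendsto (fun s0 : ℝ => (1 - s0 ^ 2 / 2) ^ (((k : ℝ) + 5) / (k + 1))) (𝓝[>] 0) (𝓝 1) := by
    have : ContinuousAt (fun s0 : ℝ => (1 - s0 ^ 2 / 2) ^ (((k : ℝ) + 5) / (k + 1))) 0 := by
      apply ContinuousAt.rpow_const (by fun_prop)
      left; norm_num
    have h := this.tendsto.mono_left (nhdsWithin_le_nhds (s := Ioi 0))
    simpa using h
  have t2 : Tendsto (fun s0 : ℝ => l * (1 + s0 ^ 2)) (𝓝[>] 0) (𝓝 l) := by
    have : Continuous (fun s0 : ℝ => l * (1 + s0 ^ 2)) := by fun_prop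
    simpa using (this.tendsto 0).mono_left (nhdsWithin_le_nhds (s := Ioi 0))
  have t3 : Tendsto (fun s0 : ℝ => 1 - G * s0 ^ 2) (𝓝[>] 0) (𝓝 1) := by
    have : Continuous (fun s0 : ℝ => 1 - G * s0 ^ 2) := by fun_prop
    simpa using (this.tendsto 0).mono_left (nhdsWithin_le_nhds (s := Ioi 0))
  obtain ⟨s0, e1, e2, e3, e4⟩ := ((t1.eventually_const_lt (show G < 1 by rw [hG]; linarith)).and
    ((t2.eventually_lt_const l1).and ((t3.eventually_const_lt l1).and
      (Ioo_mem_nhdsGT (show (0 : ℝ) < 1 by norm_num))))).exists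
  have t4 : Tendsto (fun ε => (1 - s0 ^ 2 / 2) ^ (((k : ℝ) + 5) / (k + 1)) *
      (1 - (a ε / s0) ^ (k + 3))) (𝓝[>] 0) (𝓝 ((1 - s0 ^ 2 / 2) ^ (((k : ℝ) + 5) / (k + 1)))) := by
    have := (((ha.div_const s0).pow (k + 3)).const_sub 1).const_mul
      ((1 - s0 ^ 2 / 2) ^ (((k : ℝ) + 5) / (k + 1)))
    simpa using this
  filter_upwards [hB, ha.eventually_lt_const e4.1, t4.eventually_const_lt e1] with ε h1 h2 h3 s hs
  exact h1.v_le_U (G := G) h2 e4.2 l0 h3.le e2.le (by rw [hG]; linarith) e3.le hs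

lemma ev_upper' (hB : ∀ᶠ ε in 𝓝[>] (0 : ℝ), Bub k (pst k - ε) (a ε) (b ε) (v ε) (w ε))
    (ha : Tendsto a (𝓝[>] 0) (𝓝 0)) {x : ℝ} (hx : 1 < x) :
    ∀ᶠ ε in 𝓝[>] (0 : ℝ), ∀ s ∈ Icc (a ε) (b ε), v ε s ≤ x * UU k s := by
  have x0 : 0 < x := by linarith
  have h := ev_upper hB ha (l := x ^ (-(2 / ((k : ℝ) + 1)))) (by positivity)
    (by
      apply Real.rpow_lt_one_of_one_lt_of_neg hx
      have : 0 < 2 / ((k : ℝ) + 1) := by positivity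
      linarith)
  rw [← Real.rpow_mul x0.le] at h
  have e : -(2 / ((k : ℝ) + 1)) * -(((k : ℝ) + 1) / 2) = 1 := by field_simp
  rwa [e, Real.rpow_one] at h

lemma ev_lower (hB : ∀ᶠ ε in 𝓝[>] (0 : ℝ), Bub k (pst k - ε) (a ε) (b ε) (v ε) (w ε))
    (ha : Tendsto a (𝓝[>] 0) (𝓝 0)) {s c : ℝ} (hs : 0 < s) (hc : 1 < c) :
    ∀ᶠ ε in 𝓝[>] (0 : ℝ), a ε < s ∧ ∀ t ∈ Icc (a ε) (b ε), t ≤ s →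
      1 - c + c * UU k t ≤ v ε t := by
  have hps := one_lt_pst k
  set x := ((1 + c) / 2) ^ (1 / pst k) with hx
  have x1 : 1 < x := Real.one_lt_rpow (by linarith) (by positivity)
  have xp : x ^ pst k = (1 + c) / 2 := by
    rw [hx, ← Real.rpow_mul (by linarith)]
    rw [one_div, inv_mul_cancel₀ (by linarith), Real.rpow_one]
  have Us := UU_pos k s
  have t1 : Tendsto (fun ε : ℝ => (1 + c) / 2 * UU k s ^ (-ε)) (𝓝[>] 0) (𝓝 ((1 + c) / 2)) := by
    have : ContinuousAt (fun ε : ℝ => (1 + c) / 2 * UU k s ^ (-ε)) 0 := by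
      apply ContinuousAt.mul continuousAt_const
      apply ContinuousAt.rpow continuousAt_const (by fun_prop) (Or.inl Us.ne')
    have h := this.tendsto.mono_left (nhdsWithin_le_nhds (s := Ioi 0))
    simpa using h
  filter_upwards [hB, ha.eventually_lt_const hs, ev_upper' hB ha x1,
    t1.eventually_lt_const (show (1 + c) / 2 < c by linarith), self_mem_nhdsWithin] with
    ε h1 h2 h3 h4 h5
  refine ⟨h2, fun t ht hts => ?_⟩
  refine h1.v_ge_U (l := x) (L := t) (by linarith) (by linarith) ht.2 h3 ?_ ⟨ht.1, le_rfl⟩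
  intro r hr
  have hr0 : 0 < r := h1.ha.trans_le hr.1
  have Ur := UU_pos k r
  have h5' : (0 : ℝ) < ε := h5
  change _ ≤ c * UU k r ^ (pst k)
  rw [Real.mul_rpow (by linarith) Ur.le, sub_eq_add_neg, Real.rpow_add Ur]
  have q1 : x ^ (pst k + -ε) ≤ (1 + c) / 2 := by
    rw [← xp]
    exact Real.rpow_le_rpow_of_exponent_le x1.le (by linarith)
  have q2 : UU k r ^ (-ε) ≤ UU k s ^ (-ε) :=
    Real.rpow_le_rpow_of_nonpos Us (UU_anti k hr0.le (hr.2.trans hts)) (by linarith)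
  have q3 : 0 < UU k r ^ pst k := by positivity
  calc _ ≤ (1 + c) / 2 * (UU k r ^ pst k * UU k s ^ (-ε)) := by gcongr
    _ = ((1 + c) / 2 * UU k s ^ (-ε)) * UU k r ^ pst k := by ring
    _ ≤ _ := by gcongr

lemma ev_mem (hB : ∀ᶠ ε in 𝓝[>] (0 : ℝ), Bub k (pst k - ε) (a ε) (b ε) (v ε) (w ε))
    (ha : Tendsto a (𝓝[>] 0) (𝓝 0)) {s : ℝ} (hs : 0 < s) :
    ∀ᶠ ε in 𝓝[>] (0 : ℝ), s ∈ Ioo (a ε) (b ε) := by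
  have Us := UU_pos k s
  have Us1 := UU_le_one k s
  filter_upwards [hB, ev_lower hB ha hs (c := 1 + UU k s / 2) (by linarith)] with ε h1 h2
  refine ⟨h2.1, ?_⟩
  by_contra hcon
  push Not at hcon
  have := h2.2 (b ε) ⟨h1.hab.le, le_rfl⟩ hcon
  rw [h1.vb] at this
  have := UU_anti k (h1.ha.trans h1.hab).le hcon
  nlinarith

lemma tend_v (hB : ∀ᶠ ε in 𝓝[>] (0 : ℝ), Bub k (pst k - ε) (a ε) (b ε) (v ε) (w ε))
    (ha : Tendsto a (𝓝[>] 0) (𝓝 0)) {s : ℝ} (hs : 0 < s) :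
    Tendsto (fun ε => v ε s) (𝓝[>] 0) (𝓝 (UU k s)) := by
  have Us := UU_pos k s
  have Us1 := UU_le_one k s
  rw [tendsto_order]
  constructor
  · intro x hx
    have : ContinuousAt (fun c : ℝ => 1 - c + c * UU k s) 1 := by fun_prop
    have t := this.tendsto.mono_left (nhdsWithin_le_nhds (s := Ioi 1))
    simp only [sub_self, zero_add, one_mul] at t
    obtain ⟨c, c1, c2⟩ := ((t.eventually_const_lt hx).and self_mem_nhdsWithin).exists
    filter_upwards [ev_lower hB ha hs c2, ev_mem hB ha hs] with ε h1 h2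
    exact c1.trans_le (h1.2 s (Ioo_subset_Icc_self h2) le_rfl)
  · intro x hx
    have : ContinuousAt (fun c : ℝ => c * UU k s) 1 := by fun_prop
    have t := this.tendsto.mono_left (nhdsWithin_le_nhds (s := Ioi 1))
    simp only [one_mul] at t
    obtain ⟨c, c1, c2⟩ := ((t.eventually_lt_const hx).and self_mem_nhdsWithin).exists
    filter_upwards [ev_upper' hB ha c2, ev_mem hB ha hs] with ε h1 h2
    exact (h1 s (Ioo_subset_Icc_self h2)).trans_lt c1

lemma bound_aux (k : ℕ) {s ε : ℝ} (hs : 0 < s) (hε : ε ≤ 1 / (k + 1)) :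
    s ^ (k + 2) * UU k s ^ (pst k - ε + 1) ≤
      (((k : ℝ) + 3) * (k + 1)) ^ (((k : ℝ) + 2) / 2) * (((k : ℝ) + 3) * (k + 1)) *
        (1 + s ^ 2)⁻¹ := by
  set N := ((k : ℝ) + 3) * (k + 1) with hN
  have N1 : 1 ≤ N := by rw [hN]; nlinarith [k.cast_nonneg (α := ℝ)]
  set B := 1 + s ^ 2 / N with hB
  have B1 : 1 ≤ B := by
    have : 0 ≤ s ^ 2 / N := by positivity
    rw [hB]; linarith
  have B0 : 0 < B := by linarith
  have e1 : s ^ (k + 2) ≤ (N * B) ^ (((k : ℝ) + 2) / 2) := by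
    have : s ^ (k + 2) = (s ^ 2) ^ (((k : ℝ) + 2) / 2) := by
      rw [← Real.rpow_natCast s 2, ← Real.rpow_mul hs.le, ← Real.rpow_natCast]
      congr 1; push_cast; ring
    rw [this]
    apply Real.rpow_le_rpow (by positivity) _ (by positivity)
    rw [hB]
    have : N * (1 + s ^ 2 / N) = N + s ^ 2 := by field_simp
    rw [this]; linarith
  have e2 : UU k s ^ (pst k - ε + 1) ≤ B ^ (-((k : ℝ) + 5 / 2)) := by
    unfold UU
    rw [← Real.rpow_mul (by positivity)]
    apply Real.rpow_le_rpow_of_exponent_le B1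
    have : -(((k : ℝ) + 1) / 2) * (pst k - ε + 1) = -(k + 3) + ε * (k + 1) / 2 := by
      unfold pst; field_simp; ring
    rw [this]
    rw [le_div_iff₀ (by positivity)] at hε
    linarith
  have e3 : B ^ (((k : ℝ) + 2) / 2) * B ^ (-((k : ℝ) + 5 / 2)) ≤ B⁻¹ := by
    rw [← Real.rpow_add B0, ← Real.rpow_neg_one]
    apply Real.rpow_le_rpow_of_exponent_le B1
    linarith [k.cast_nonneg (α := ℝ)]
  have e4 : B⁻¹ ≤ N * (1 + s ^ 2)⁻¹ := by
    rw [inv_le_comm₀ B0 (by positivity), mul_inv, inv_inv, inv_mul_le_iff₀ (by linarith), hB]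
    have : N * (1 + s ^ 2 / N) = N + s ^ 2 := by field_simp
    rw [this]; linarith
  calc _ ≤ (N * B) ^ (((k : ℝ) + 2) / 2) * B ^ (-((k : ℝ) + 5 / 2)) := by
        have := UU_pos k s
        exact mul_le_mul e1 e2 (by positivity) (by positivity)
    _ = N ^ (((k : ℝ) + 2) / 2) * (B ^ (((k : ℝ) + 2) / 2) * B ^ (-((k : ℝ) + 5 / 2))) := by
      rw [Real.mul_rpow (by linarith) B0.le]; ring
    _ ≤ N ^ (((k : ℝ) + 2) / 2) * (N * (1 + s ^ 2)⁻¹) := by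
      exact mul_le_mul_of_nonneg_left (e3.trans e4) (by positivity)
    _ = _ := by ring

lemma tend_int (hB : ∀ᶠ ε in 𝓝[>] (0 : ℝ), Bub k (pst k - ε) (a ε) (b ε) (v ε) (w ε))
    (ha : Tendsto a (𝓝[>] 0) (𝓝 0)) :
    Tendsto (fun ε => ∫ s in (a ε)..(b ε), s ^ (k + 2) * v ε s ^ (pst k - ε + 1)) (𝓝[>] 0)
      (𝓝 (∫ s in Ioi (0 : ℝ), s ^ (k + 2) * UU k s ^ (pst k + 1))) := by
  have hps := one_lt_pst k
  have e1 : (fun ε => ∫ s in (a ε)..(b ε), s ^ (k + 2) * v ε s ^ (pst k - ε + 1)) =ᶠ[𝓝[>] 0]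
      fun ε => ∫ s, (Ioc (a ε) (b ε)).indicator
        (fun s => s ^ (k + 2) * v ε s ^ (pst k - ε + 1)) s := by
    filter_upwards [hB] with ε h
    rw [intervalIntegral.integral_of_le h.hab.le, integral_indicator measurableSet_Ioc]
  rw [tendsto_congr' e1, ← integral_indicator measurableSet_Ioi]
  have small : ∀ᶠ ε in 𝓝[>] (0 : ℝ), ε ∈ Ioo (0 : ℝ) (1 / (k + 1)) :=
    Ioo_mem_nhdsGT (by positivity)
  refine tendsto_integral_filter_of_dominated_convergence
    (fun s => 2 ^ (pst k + 1) * ((((k : ℝ) + 3) * (k + 1)) ^ (((k : ℝ) + 2) / 2) *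
      (((k : ℝ) + 3) * (k + 1)) * (1 + s ^ 2)⁻¹)) ?_ ?_ ?_ ?_
  · filter_upwards [hB] with ε h
    rw [aestronglyMeasurable_indicator_iff measurableSet_Ioc]
    apply ContinuousOn.aestronglyMeasurable _ measurableSet_Ioc
    have hp := h.hp
    have : ContinuousOn (fun s => v ε s ^ (pst k - ε + 1)) (Ioc (a ε) (b ε)) :=
      (h.vc.mono Ioc_subset_Icc_self).rpow_const (fun x _ => Or.inr (by linarith))
    fun_prop
  · filter_upwards [hB, ev_upper' hB ha (x := 2) (by norm_num), small] with ε h h2 h3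
    refine Eventually.of_forall fun s => ?_
    by_cases hs : s ∈ Ioc (a ε) (b ε)
    · rw [indicator_of_mem hs]
      have s0 : 0 < s := h.ha.trans hs.1
      have hs' := Ioc_subset_Icc_self hs
      have v0 := h.v_nonneg hs'
      have hp := h.hp
      rw [Real.norm_of_nonneg (by positivity)]
      have q : v ε s ^ (pst k - ε + 1) ≤ 2 ^ (pst k + 1) * UU k s ^ (pst k - ε + 1) := by
        calc _ ≤ (2 * UU k s) ^ (pst k - ε + 1) :=
              Real.rpow_le_rpow v0 (h2 s hs') (by linarith)
          _ = 2 ^ (pst k - ε + 1) * UU k s ^ (pst k - ε + 1) :=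
              Real.mul_rpow (by norm_num) (UU_pos k s).le
          _ ≤ _ := by
            have := UU_pos k s
            gcongr
            · norm_num
            · linarith [h3.1]
      calc _ ≤ s ^ (k + 2) * (2 ^ (pst k + 1) * UU k s ^ (pst k - ε + 1)) := by gcongr
        _ = 2 ^ (pst k + 1) * (s ^ (k + 2) * UU k s ^ (pst k - ε + 1)) := by ring
        _ ≤ _ := by
          exact mul_le_mul_of_nonneg_left (bound_aux k s0 h3.2.le) (by positivity)
    · rw [indicator_of_notMem hs, norm_zero]
      positivity
  · exact ((integrable_inv_one_add_sq).const_mul _).const_mul _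
  · refine Eventually.of_forall fun s => ?_
    by_cases hs : 0 < s
    · rw [indicator_of_mem (show s ∈ Ioi 0 from hs)]
      have t1 : Tendsto (fun ε : ℝ => pst k - ε + 1) (𝓝[>] 0) (𝓝 (pst k + 1)) := by
        have : Continuous (fun ε : ℝ => pst k - ε + 1) := by fun_prop
        simpa using (this.tendsto 0).mono_left (nhdsWithin_le_nhds (s := Ioi 0))
      have t2 := ((tend_v hB ha hs).rpow t1 (Or.inl (UU_pos k s).ne')).const_mul (s ^ (k + 2))
      refine t2.congr' ?_
      filter_upwards [ev_mem hB ha hs] with ε h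
      rw [indicator_of_mem (Ioo_subset_Ioc_self h)]
    · rw [indicator_of_notMem (show s ∉ Ioi 0 from hs)]
      refine tendsto_const_nhds.congr' ?_
      filter_upwards [hB] with ε h
      rw [indicator_of_notMem]
      intro hh
      exact hs (h.ha.trans hh.1)
end

lemma beta_real {x : ℝ} (hx : 0 < x) :
    ∫ t in Ioo (0 : ℝ) 1, t ^ (x - 1) * (1 - t) ^ (x - 1) =
      Real.Gamma x ^ 2 / Real.Gamma (2 * x) := by
  have h := ProbabilityTheory.beta_eq_betaIntegralReal x x hx hx
  have e : Real.Gamma x ^ 2 / Real.Gamma (2 * x) = ProbabilityTheory.beta x x := by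
    unfold ProbabilityTheory.beta
    rw [two_mul, sq]
  rw [e, h, Complex.betaIntegral, intervalIntegral.integral_of_le (by norm_num),
      ← integral_Ioc_eq_integral_Ioo, ← RCLike.re_to_complex, ← integral_re]
  · refine setIntegral_congr_fun measurableSet_Ioc fun t ⟨hx1, hx₂⟩ ↦ ?_
    norm_cast
    rw [← Complex.ofReal_cpow, ← Complex.ofReal_cpow, RCLike.re_to_complex,
      Complex.re_mul_ofReal, Complex.ofReal_re]
    all_goals linarith
  · have := Complex.betaIntegral_convergent (u := x) (v := x) (by simpa) (by simpa)
    rw [intervalIntegrable_iff_integrableOn_Ioc_of_le (by simp), IntegrableOn] at this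
    exact this

lemma int_UU (k : ℕ) : ∫ s in Ioi (0 : ℝ), s ^ (k + 2) * UU k s ^ (pst k + 1) =
    (((k : ℝ) + 3) * (k + 1)) ^ (((k : ℝ) + 3) / 2) / 2 *
      (Real.Gamma (((k : ℝ) + 3) / 2) ^ 2 / Real.Gamma ((k : ℝ) + 3)) := by
  set N := ((k : ℝ) + 3) * (k + 1) with hN
  have N0 : 0 < N := by positivity
  have hb := beta_real (x := ((k : ℝ) + 3) / 2) (by positivity)
  rw [show 2 * (((k : ℝ) + 3) / 2) = (k : ℝ) + 3 by ring] at hb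
  rw [← hb]
  have img : (fun s : ℝ => s ^ 2 / (N + s ^ 2)) '' Ioi 0 = Ioo 0 1 := by
    ext t
    simp only [mem_image, mem_Ioi, mem_Ioo]
    constructor
    · rintro ⟨s, hs, rfl⟩
      refine ⟨by positivity, ?_⟩
      rw [div_lt_one (by positivity)]; linarith
    · rintro ⟨h0, h1⟩
      have h1' : 0 < 1 - t := by linarith
      refine ⟨√(N * t / (1 - t)), by positivity, ?_⟩
      rw [Real.sq_sqrt (by positivity)]
      field_simp
      ring
  have inj : InjOn (fun s : ℝ => s ^ 2 / (N + s ^ 2)) (Ioi 0) := by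
    intro x hx y hy hxy
    simp only [mem_Ioi] at hx hy
    simp only at hxy
    rw [div_eq_div_iff (by positivity) (by positivity)] at hxy
    have : x ^ 2 = y ^ 2 := by nlinarith
    exact (pow_left_inj₀ hx.le hy.le (by norm_num)).1 this
  rw [← img, integral_image_eq_integral_abs_deriv_smul measurableSet_Ioi
    (f' := fun s => 2 * s * N / (N + s ^ 2) ^ 2) _ inj, ← integral_const_mul]
  · refine setIntegral_congr_fun measurableSet_Ioi fun s hs => ?_
    have s0 : 0 < s := hs
    simp only [smul_eq_mul]
    rw [abs_of_pos (by positivity)]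
    have e1 : 1 - s ^ 2 / (N + s ^ 2) = N / (N + s ^ 2) := by field_simp; ring
    rw [e1, ← Real.mul_rpow (by positivity) (by positivity)]
    have e2 : UU k s ^ (pst k + 1) = ((N + s ^ 2) / N) ^ (-((k : ℝ) + 3)) := by
      unfold UU
      rw [← Real.rpow_mul (by positivity)]
      congr 1
      · rw [← hN]; field_simp
      · unfold pst; field_simp; ring
    rw [e2]
    have M0 : 0 < N + s ^ 2 := by positivity
    have e3 : s ^ 2 / (N + s ^ 2) * (N / (N + s ^ 2)) = s ^ 2 * N / (N + s ^ 2) ^ 2 := by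
      field_simp
    rw [e3]
    generalize N + s ^ 2 = M at *
    have e4 : s ^ (k + 2) = s * s ^ ((k : ℝ) + 1) := by
      rw [pow_succ, mul_comm]; congr 1
      rw [← Real.rpow_natCast]; push_cast; rfl
    have e5 : (s ^ 2 * N / M ^ 2) ^ (((k : ℝ) + 3) / 2 - 1) =
      s ^ ((k : ℝ) + 1) * N ^ (((k : ℝ) + 1) / 2) / M ^ ((k : ℝ) + 1) := by
      rw [Real.div_rpow (by positivity) (by positivity), Real.mul_rpow (by positivity) (by positivity),
        ← Real.rpow_natCast s 2, ← Real.rpow_natCast M 2, ← Real.rpow_mul s0.le, ← Real.rpow_mul M0.le]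
      have f1 : ((2:ℕ):ℝ) * (((k:ℝ)+3)/2 - 1) = (k:ℝ)+1 := by push_cast; ring
      have f2 : ((k:ℝ)+3)/2 - 1 = ((k:ℝ)+1)/2 := by ring
      rw [f1, f2]
    have e6 : (M / N) ^ (-((k : ℝ) + 3)) =
        N ^ (((k : ℝ) + 3) / 2) * N ^ (((k : ℝ) + 1) / 2) * N / (M ^ ((k : ℝ) + 1) * M ^ 2) := by
      rw [Real.rpow_neg (by positivity), Real.div_rpow M0.le N0.le, inv_div]
      congr 1
      · rw [← Real.rpow_add N0, ← Real.rpow_add_one N0.ne']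
        congr 1; ring
      · rw [← Real.rpow_natCast M 2, ← Real.rpow_add M0]; congr 1; push_cast; ring
    rw [e4, e5, e6]
    field_simp
  · intro s hs
    have s0 : 0 < s := hs
    have h1 := hasDerivAt_pow 2 s
    have := h1.div (h1.const_add N) (by positivity)
    refine (this.congr_deriv ?_).hasDerivWithinAt
    field_simp
    push_cast
    ring

/-- Working data extracted from a radial Dirichlet solution in dimension `k + 3`. -/
structure Rad (k m : ℕ) (p : ℝ) (u u1 : ℝ → ℝ) (ρ : ℕ → ℝ) (d : ℝ) : Prop where
  uc : ContinuousOn u (Icc 0 1)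
  u1c : ContinuousOn u1 (Icc 0 1)
  du : ∀ r ∈ Ioo (0 : ℝ) 1, HasDerivAt u (u1 r) r
  du1 : ∀ r ∈ Ioo (0 : ℝ) 1,
    HasDerivAt u1 (-(((k : ℝ) + 2) / r * u1 r) - |u r| ^ (p - 1) * u r) r
  ρ1 : ρ 1 = 1
  hpos : ∀ j, 1 ≤ j → j ≤ m → 0 < ρ j ∧ ρ j ≤ 1 ∧ u (ρ j) = 0
  hlt : ∀ j, 1 ≤ j → j + 1 ≤ m → ρ (j + 1) < ρ j
  h0 : ∀ r ∈ Ioo 0 (ρ m), u r ≠ 0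
  hk : ∀ j, 1 ≤ j → j + 1 ≤ m → ∀ r ∈ Ioo (ρ (j + 1)) (ρ j), u r ≠ 0
  d0 : 0 < d
  d1 : d < 1
  u1d : u1 d = 0
  ud : ∀ r ∈ Ico d 1, u r ≠ 0

lemma rad_of {k m : ℕ} (hm : 2 ≤ m) {p : ℝ} {u : ℝ → ℝ} {ρ δ : ℕ → ℝ}
    (h : DirichletData (k + 3) p m u ρ δ) :
    Rad k m p u (derivWithin u (Icc 0 1)) ρ (δ 1) ∧
      derivWithin u (Icc 0 1) 1 = deriv u 1 := by
  obtain ⟨⟨hC, -, hode⟩, hu1, hρ1, hδm, hδρ, hρδ, hZ, hCr⟩ := h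
  have hud : UniqueDiffOn ℝ (Icc (0 : ℝ) 1) := uniqueDiffOn_Icc (by norm_num)
  have hlt : ∀ j, 1 ≤ j → j + 1 ≤ m → ρ (j + 1) < ρ j := fun j h1 h2 =>
    (hρδ j h1 h2).trans (hδρ j h1 (by omega))
  have hpos : ∀ j, 1 ≤ j → j ≤ m → 0 < ρ j ∧ ρ j ≤ 1 ∧ u (ρ j) = 0 := by
    intro j h1 h2
    have : ρ j ∈ {r : ℝ | r ∈ Set.Ioc (0 : ℝ) 1 ∧ u r = 0} := by
      rw [hZ]; exact ⟨j, ⟨h1, h2⟩, rfl⟩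
    exact ⟨this.1.1, this.1.2, this.2⟩
  have hanti : ∀ i j, 1 ≤ i → i ≤ j → j ≤ m → ρ j ≤ ρ i := by
    intro i j h1 h2
    induction j, h2 using Nat.le_induction with
    | base => intro _; exact le_rfl
    | succ j hj ih => intro h3; exact (hlt j (by omega) h3).le.trans (ih (by omega))
  have hzero : ∀ r, 0 < r → r ≤ 1 → u r = 0 → ∃ j, 1 ≤ j ∧ j ≤ m ∧ ρ j = r := by
    intro r h1 h2 h3
    have : r ∈ {r : ℝ | r ∈ Set.Ioc (0 : ℝ) 1 ∧ u r = 0} := ⟨⟨h1, h2⟩, h3⟩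
    rw [hZ] at this
    obtain ⟨j, hj, e⟩ := this
    exact ⟨j, hj.1, hj.2, e⟩
  have hk : ∀ j, 1 ≤ j → j + 1 ≤ m → ∀ r ∈ Ioo (ρ (j + 1)) (ρ j), u r ≠ 0 := by
    intro j h1 h2 r hr h0
    obtain ⟨i, i1, i2, rfl⟩ := hzero r ((hpos _ (by omega) h2).1.trans hr.1)
      (hr.2.le.trans (hpos j h1 (by omega)).2.1) h0
    rcases le_or_gt i j with hij | hij
    · exact absurd (hanti i j i1 hij (by omega)) (not_le.2 hr.2)
    · exact absurd (hanti (j + 1) i (by omega) hij i2) (not_le.2 hr.1)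
  have hd2 := hρδ 1 le_rfl hm
  have hd1 : δ 1 < 1 := hρ1 ▸ hδρ 1 le_rfl (by omega)
  have hd0 : 0 < δ 1 := (hpos 2 (by norm_num) hm).1.trans hd2
  have hnhds : ∀ r ∈ Ioo (0 : ℝ) 1, Icc (0 : ℝ) 1 ∈ 𝓝 r := fun r hr => Icc_mem_nhds hr.1 hr.2
  have heq : ∀ r ∈ Ioo (0 : ℝ) 1, derivWithin u (Icc 0 1) r = deriv u r := fun r hr =>
    derivWithin_of_mem_nhds (hnhds r hr)
  have hd1ne : deriv u 1 ≠ 0 := by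
    intro h0
    have : (1 : ℝ) ∈ {r : ℝ | r ∈ Set.Icc (0 : ℝ) 1 ∧ deriv u r = 0} := ⟨by simp, h0⟩
    rw [hCr] at this
    obtain ⟨j, hj, e⟩ := this
    have := hδρ j hj.1 hj.2
    have := (hpos j hj.1 hj.2).2.1
    linarith
  refine ⟨⟨hC.continuousOn, hC.continuousOn_derivWithin hud (by norm_num), ?_, ?_, hρ1, hpos,
    hlt, ?_, hk, hd0, hd1, ?_, ?_⟩, ?_⟩
  · intro r hr
    rw [heq r hr]
    exact ((hC.contDiffAt (hnhds r hr)).differentiableAt (by norm_num)).hasDerivAt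
  · intro r hr
    have hca := hC.contDiffAt (hnhds r hr)
    have h1 : ContDiffAt ℝ 1 (deriv u) r := hca.derivWithin (by norm_num)
    have h2 := (h1.differentiableAt (by norm_num)).hasDerivAt
    have h3 := (hasDerivAt_pow (k + 3 - 1) r).mul h2
    have h4 := hode r ⟨hr.1, hr.2.le⟩
    have h5 : deriv (fun s => s ^ (k + 3 - 1) * deriv u s) r = _ := h3.deriv
    rw [h5] at h4
    have r0 := hr.1
    have ev : derivWithin u (Icc 0 1) =ᶠ[𝓝 r] deriv u := by
      filter_upwards [Ioo_mem_nhds hr.1 hr.2] with x hx using heq x hx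
    refine (h2.congr_of_eventuallyEq ev).congr_deriv ?_
    rw [heq r hr]
    simp only [show k + 3 - 1 = k + 2 from rfl, show k + 2 - 1 = k + 1 from rfl] at h4
    push_cast at h4
    have e : r ^ (k + 2) = r ^ (k + 1) * r := pow_succ _ _
    rw [e] at h4
    have rp : 0 < r ^ (k + 1) := by positivity
    have h6 : (k + 2) * deriv u r + r * deriv (deriv u) r = -(|u r| ^ (p - 1) * u r * r) := by
      apply mul_left_cancel₀ rp.ne'
      linear_combination h4
    field_simp
    linear_combination h6
  · intro r hr h0
    obtain ⟨i, i1, i2, rfl⟩ := hzero r hr.1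
      (hr.2.le.trans (hpos m (by omega) le_rfl).2.1) h0
    exact absurd (hanti i m i1 i2 le_rfl) (not_le.2 hr.2)
  · rw [heq _ ⟨hd0, hd1⟩]
    have : δ 1 ∈ {r : ℝ | r ∈ Set.Icc (0 : ℝ) 1 ∧ deriv u r = 0} := by
      rw [hCr]; exact ⟨1, ⟨le_rfl, by omega⟩, rfl⟩
    exact this.2
  · intro r hr
    exact hk 1 le_rfl hm r ⟨hd2.trans_le hr.1, by rw [hρ1]; exact hr.2⟩
  · have hdif : DifferentiableAt ℝ u 1 := by
      by_contra hc
      exact hd1ne (deriv_zero_of_not_differentiableAt hc)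
    exact hdif.derivWithin (hud 1 (by simp))

/-- Uniform constant for the phase-plane energy. -/
def KK (k : ℕ) : ℝ :=
  (((k : ℝ) + 1) ^ 2 / 4 + 1) *
    (((((k : ℝ) + 1) ^ 2 / 4 + 1) * ((pst k + 1) / 2)) ^ (((k : ℝ) + 1) / 2)) ^ 2

lemma KK_spec (k : ℕ) {p γ : ℝ} (h1 : 2 / ((k : ℝ) + 1) ≤ p - 1) (h2 : p ≤ pst k)
    (hγ : 0 < γ) (hγ' : γ ≤ ((k : ℝ) + 1) ^ 2 / 4) (x : ℝ) :
    (γ + 1) * x ^ 2 ≤ 2 * |x| ^ (p + 1) / (p + 1) + KK k := by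
  set G := ((k : ℝ) + 1) ^ 2 / 4 with hG
  have G0 : 0 < G := by positivity
  have P0 := one_lt_pst k
  set B := (G + 1) * ((pst k + 1) / 2) with hB
  have q0 : 0 < p - 1 := lt_of_lt_of_le (by positivity) h1
  have B1 : 1 ≤ B := by rw [hB]; nlinarith
  have B0 : 0 < B := by linarith
  set X := B ^ (((k : ℝ) + 1) / 2) with hX
  have X1 : 1 ≤ X := Real.one_le_rpow B1 (by positivity)
  have hKK : KK k = (G + 1) * X ^ 2 := rfl
  rw [hKK]
  have t0 : 0 ≤ 2 * |x| ^ (p + 1) / (p + 1) := by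
    have : 0 < p + 1 := by linarith
    positivity
  rcases le_total X |x| with hx | hx
  · have x0 : 0 < |x| := by linarith
    have e1 : B ≤ |x| ^ (p - 1) := by
      calc B = X ^ (2 / ((k : ℝ) + 1)) := by
              rw [hX, ← Real.rpow_mul B0.le]
              rw [show ((k : ℝ) + 1) / 2 * (2 / ((k : ℝ) + 1)) = 1 by field_simp, Real.rpow_one]
        _ ≤ X ^ (p - 1) := Real.rpow_le_rpow_of_exponent_le X1 h1
        _ ≤ |x| ^ (p - 1) := Real.rpow_le_rpow (by linarith) hx q0.le
    have e2 : |x| ^ (p + 1) = |x| ^ (p - 1) * x ^ 2 := by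
      rw [← sq_abs x, ← Real.rpow_natCast |x| 2, ← Real.rpow_add x0]; congr 1; push_cast; ring
    have e3 : (γ + 1) * (p + 1) ≤ 2 * B := by
      rw [hB]
      have : (γ + 1) * (p + 1) ≤ (G + 1) * (pst k + 1) :=
        mul_le_mul (by linarith) (by linarith) (by linarith) (by linarith)
      linarith
    have e4 : (γ + 1) * x ^ 2 ≤ 2 * |x| ^ (p + 1) / (p + 1) := by
      rw [le_div_iff₀ (by linarith), e2]
      have : (γ + 1) * (p + 1) * x ^ 2 ≤ 2 * |x| ^ (p - 1) * x ^ 2 :=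
        mul_le_mul_of_nonneg_right (by linarith) (sq_nonneg x)
      linarith
    have : 0 ≤ (G + 1) * X ^ 2 := by positivity
    linarith
  · have e1 : x ^ 2 ≤ X ^ 2 := by
      rw [← sq_abs x]
      exact pow_le_pow_left₀ (abs_nonneg x) hx 2
    have : (γ + 1) * x ^ 2 ≤ (G + 1) * X ^ 2 :=
      mul_le_mul (by linarith) e1 (sq_nonneg x) (by linarith)
    linarith

section
variable {k m : ℕ} {p : ℝ} {u u1 : ℝ → ℝ} {ρ : ℕ → ℝ} {d : ℝ}

lemma Rad.ph (h : Rad k m p u u1 ρ d) (h1 : 2 / ((k : ℝ) + 1) ≤ p - 1) (h2 : p ≤ pst k)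
    {α β : ℝ} (hα : α = 2 / (p - 1)) (hβ : β = α - ((k : ℝ) + 1) / 2) (hβ1 : 8 * β < 1) :
    PH β (α * ((k : ℝ) + 1 - α)) p (KK k) (fun r => r ^ α * u r)
      (fun r => r ^ α * (α * u r + r * u1 r)) := by
  have q0 : 0 < p - 1 := lt_of_lt_of_le (by positivity) h1
  have α0 : 0 < α := by rw [hα]; positivity
  have hq : α * (p - 1) = 2 := by rw [hα]; field_simp
  have β0 : 0 ≤ β := by
    have : p - 1 ≤ 4 / ((k : ℝ) + 1) := by
      have : pst k = 4 / ((k : ℝ) + 1) + 1 := by unfold pst; field_simp; ring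
      linarith
    rw [hβ, hα, sub_nonneg, le_div_iff₀ q0]
    rw [le_div_iff₀ (by positivity)] at this
    linarith
  have k0 : (0 : ℝ) ≤ k := Nat.cast_nonneg k
  have γ0 : 0 < α * ((k : ℝ) + 1 - α) := mul_pos α0 (by linarith)
  have rc : ContinuousOn (fun r : ℝ => r ^ α) (Icc 0 1) :=
    (Real.continuous_rpow_const α0.le).continuousOn
  refine ⟨by linarith, β0, hβ1.le, γ0, KK_spec k h1 h2 γ0 ?_, rc.mul h.uc,
    rc.mul ((h.uc.const_mul α |>.add (continuousOn_id.mul h.u1c))), ?_, ?_, ?_, ?_⟩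
  · nlinarith [sq_nonneg (2 * α - (k + 1))]
  · simp [Real.zero_rpow α0.ne']
  · simp [Real.zero_rpow α0.ne']
  · intro r hr
    have r0 := hr.1
    have h3 := (Real.hasDerivAt_rpow_const (p := α) (Or.inl r0.ne')).mul (h.du r hr)
    refine h3.congr_deriv ?_
    rw [Real.rpow_sub_one r0.ne']
    field_simp
  · intro r hr
    have r0 := hr.1
    have h3 := (Real.hasDerivAt_rpow_const (p := α) (Or.inl r0.ne')).mul
      (((h.du r hr).const_mul α).add ((hasDerivAt_id r).mul (h.du1 r hr)))
    refine h3.congr_deriv ?_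
    have e : |r ^ α * u r| ^ (p - 1) = r ^ 2 * |u r| ^ (p - 1) := by
      rw [abs_mul, abs_of_pos (by positivity), Real.mul_rpow (by positivity) (by positivity),
        ← Real.rpow_mul r0.le, hq, ← Real.rpow_natCast r 2]; norm_cast
    rw [e, Real.rpow_sub_one r0.ne', hβ]
    simp only [id, Pi.add_apply, Pi.mul_apply]
    field_simp
    ring

lemma Rad.small (h : Rad k m p u u1 ρ d) (hm : 2 ≤ m)
    (h1 : 2 / ((k : ℝ) + 1) ≤ p - 1) (h2 : p ≤ pst k)
    {α β : ℝ} (hα : α = 2 / (p - 1)) (hβ : β = α - ((k : ℝ) + 1) / 2) (hβ1 : 8 * β < 1) :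
    d * |u d| ^ ((p - 1) / 2) ≤
      ((KK k / ((1 - 8 * β) ^ 2) ^ m - KK k) * ((pst k + 1) / 2)) ^ ((p - 1) / 2 / (p + 1)) := by
  have H := h.ph h1 h2 hα hβ hβ1
  have q0 : 0 < p - 1 := lt_of_lt_of_le (by positivity) h1
  have α0 : 0 < α := by rw [hα]; positivity
  have hq : α * (p - 1) = 2 := by rw [hα]; field_simp
  have hit := H.iter m (by omega) ρ
    (fun j a b => ⟨(h.hpos j a b).1, (h.hpos j a b).2.1, by simp [(h.hpos j a b).2.2]⟩)
    h.hlt (fun r hr => mul_ne_zero (by have := hr.1; positivity) (h.h0 r hr))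
    (fun j a b r hr => mul_ne_zero
      (by have := (h.hpos (j+1) (by omega) b).1.trans hr.1; positivity) (h.hk j a b r hr))
  rw [h.ρ1] at hit
  have hmono := H.PPmono (a := d) (b := 1) ⟨h.d0.le, h.d1.le⟩ (by simp) h.d1.le
  have d0 := h.d0
  have β8 : 0 < 1 - 8 * β := by linarith
  have D0 : 0 < ((1 - 8 * β) ^ 2) ^ m := by positivity
  rw [← le_div_iff₀ D0] at hit
  have hle := hmono.trans hit
  unfold PP at hle
  simp only [h.u1d] at hle
  have p1 : 0 < p + 1 := by linarith
  set Y := |d ^ α * u d| with hY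
  have Y0 : 0 ≤ Y := abs_nonneg _
  have k0 : (0 : ℝ) ≤ k := Nat.cast_nonneg k
  have β0 := H.hβ
  have e1 : 2 * Y ^ (p + 1) / (p + 1) ≤ KK k / ((1 - 8 * β) ^ 2) ^ m - KK k := by
    have : 0 ≤ (α ^ 2 - α * ((k : ℝ) + 1 - α)) * (d ^ α * u d) ^ 2 := by
      apply mul_nonneg _ (sq_nonneg _)
      have : 0 ≤ α * (2 * α - (k + 1)) := mul_nonneg α0.le (by linarith)
      nlinarith
    nlinarith
  have e2 : Y ^ (p + 1) ≤ (KK k / ((1 - 8 * β) ^ 2) ^ m - KK k) * ((pst k + 1) / 2) := by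
    rw [div_le_iff₀ p1] at e1
    have t0 : 0 ≤ KK k / ((1 - 8 * β) ^ 2) ^ m - KK k := by
      by_contra hc
      have : 0 ≤ Y ^ (p + 1) := by positivity
      nlinarith
    nlinarith
  have e3 : d * |u d| ^ ((p - 1) / 2) = (Y ^ (p + 1)) ^ ((p - 1) / 2 / (p + 1)) := by
    rw [← Real.rpow_mul Y0, mul_div_cancel₀ _ p1.ne', hY, abs_mul, abs_of_pos (Real.rpow_pos_of_pos d0 α),
      Real.mul_rpow (by positivity) (by positivity), ← Real.rpow_mul d0.le,
      show α * ((p - 1) / 2) = 1 by linarith, Real.rpow_one]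
  rw [e3]
  exact Real.rpow_le_rpow (by positivity) e2 (by positivity)

end

lemma tend_a {k m : ℕ} (hm : 2 ≤ m) {u u1 : ℝ → ℝ → ℝ} {ρ : ℝ → ℕ → ℝ} {d : ℝ → ℝ}
    (h : ∀ᶠ ε in 𝓝[>] (0 : ℝ), Rad k m (pst k - ε) (u ε) (u1 ε) (ρ ε) (d ε)) :
    Tendsto (fun ε => d ε * |u ε (d ε)| ^ ((pst k - ε - 1) / 2)) (𝓝[>] 0) (𝓝 0) := by
  have hid : Tendsto (fun ε : ℝ => ε) (𝓝[>] 0) (𝓝 0) := tendsto_nhdsWithin_of_tendsto_nhds tendsto_id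
  have P1 := one_lt_pst k
  have hps : pst k - 1 = 4 / ((k : ℝ) + 1) := by unfold pst; field_simp; ring
  have hp : Tendsto (fun ε : ℝ => pst k - ε) (𝓝[>] 0) (𝓝 (pst k)) := by
    simpa using hid.const_sub (pst k)
  have hq : Tendsto (fun ε : ℝ => pst k - ε - 1) (𝓝[>] 0) (𝓝 (pst k - 1)) := hp.sub_const 1
  have hβ : Tendsto (fun ε : ℝ => 2 / (pst k - ε - 1) - ((k : ℝ) + 1) / 2) (𝓝[>] 0) (𝓝 0) := by
    have := ((tendsto_const_nhds (x := (2 : ℝ))).div hq (by linarith)).sub_const (((k : ℝ) + 1) / 2)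
    have e : (2 : ℝ) / (pst k - 1) - ((k : ℝ) + 1) / 2 = 0 := by rw [hps]; field_simp; ring
    rw [e] at this
    exact this
  set β : ℝ → ℝ := fun ε => 2 / (pst k - ε - 1) - ((k : ℝ) + 1) / 2 with hβd
  have hD : Tendsto (fun ε => ((1 - 8 * β ε) ^ 2) ^ m) (𝓝[>] 0) (𝓝 1) := by
    simpa using (((hβ.const_mul 8).const_sub 1).pow 2).pow m
  have hT : Tendsto (fun ε => (KK k / ((1 - 8 * β ε) ^ 2) ^ m - KK k) * ((pst k + 1) / 2))
      (𝓝[>] 0) (𝓝 0) := by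
    simpa using (((tendsto_const_nhds (x := KK k)).div hD one_ne_zero).sub_const (KK k)).mul_const ((pst k + 1) / 2)
  have hE : Tendsto (fun ε => (pst k - ε - 1) / 2 / (pst k - ε + 1)) (𝓝[>] 0)
      (𝓝 ((pst k - 1) / 2 / (pst k + 1))) :=
    (hq.div_const 2).div (hp.add_const 1) (by linarith)
  have e0 : 0 < (pst k - 1) / 2 / (pst k + 1) := by
    have : 0 < pst k - 1 := by linarith
    positivity
  have hfin := hT.rpow hE (Or.inr e0)
  rw [Real.zero_rpow e0.ne'] at hfin
  refine squeeze_zero' ?_ ?_ hfin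
  · filter_upwards [h] with ε hε
    have := hε.d0
    positivity
  · have c1 : ∀ᶠ ε in 𝓝[>] (0 : ℝ), 2 / ((k : ℝ) + 1) ≤ pst k - ε - 1 :=
      hq.eventually_const_le (by rw [hps]; gcongr; norm_num)
    have c2 : ∀ᶠ ε in 𝓝[>] (0 : ℝ), β ε < 1 / 8 := hβ.eventually_lt_const (by norm_num)
    filter_upwards [h, c1, c2, self_mem_nhdsWithin] with ε hε h1 h2 h3
    have h3 : 0 < ε := h3
    exact hε.small hm h1 (by linarith) rfl rfl (by linarith)

lemma pos_of_ne {f : ℝ → ℝ} {d : ℝ} (hc : ContinuousOn f (Icc d 1)) (hd : 0 < f d)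
    (hne : ∀ r ∈ Ico d 1, f r ≠ 0) : ∀ r ∈ Ico d 1, 0 < f r := by
  intro r hr
  by_contra hneg
  have hsub : Icc d r ⊆ Icc d 1 := Icc_subset_Icc_right hr.2.le
  obtain ⟨t, ht, h0⟩ := intermediate_value_Icc' hr.1 (hc.mono hsub)
    (show (0 : ℝ) ∈ Icc (f r) (f d) from ⟨not_lt.1 hneg, hd.le⟩)
  exact hne t ⟨ht.1, ht.2.trans_lt hr.2⟩ h0

lemma Rad.bub {k m : ℕ} {p : ℝ} {u u1 : ℝ → ℝ} {ρ : ℕ → ℝ} {d : ℝ}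
    (h : Rad k m p u u1 ρ d) (hm : 2 ≤ m) (hp : 1 < p) (hp' : p ≤ pst k) {M Λ : ℝ}
    (hM : M = |u d|) (hΛ : Λ = M ^ ((p - 1) / 2)) :
    ∃ v w : ℝ → ℝ, Bub k p (d * Λ) Λ v w ∧ u1 1 ^ 2 = M ^ 2 * Λ ^ 2 * w Λ ^ 2 := by
  have ud : u d ≠ 0 := h.ud d ⟨le_rfl, h.d1⟩
  have M0 : 0 < M := by rw [hM]; positivity
  have Λ0 : 0 < Λ := by rw [hΛ]; positivity
  have hMq : M ^ (p - 1) = Λ ^ 2 := by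
    rw [hΛ, ← Real.rpow_natCast (M ^ ((p - 1) / 2)) 2, ← Real.rpow_mul M0.le]
    congr 1; push_cast; ring
  obtain ⟨σ, hσ, hσM⟩ : ∃ σ : ℝ, (σ ^ 2 = 1 ∧ |σ| = 1) ∧ M = σ * u d := by
    rcases lt_or_gt_of_ne ud with h0 | h0
    · exact ⟨-1, by norm_num, by rw [hM, abs_of_neg h0]; ring⟩
    · exact ⟨1, by norm_num, by rw [hM, abs_of_pos h0]; ring⟩
  have σ0 : σ ≠ 0 := by rintro rfl; norm_num at hσ
  have d0 := h.d0
  have d1 := h.d1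
  have hsub : Icc d 1 ⊆ Icc (0 : ℝ) 1 := Icc_subset_Icc_left d0.le
  have hposu : ∀ r ∈ Ico d 1, 0 < σ * u r :=
    pos_of_ne ((h.uc.mono hsub).const_mul σ) (hσM ▸ M0) fun r hr => mul_ne_zero σ0 (h.ud r hr)
  have hmaps : MapsTo (fun s : ℝ => s / Λ) (Icc (d * Λ) Λ) (Icc 0 1) := by
    intro s hs
    refine ⟨?_, (div_le_one Λ0).2 hs.2⟩
    exact div_nonneg ((by positivity : 0 ≤ d * Λ).trans hs.1) Λ0.le
  have hmem : ∀ s ∈ Ioo (d * Λ) Λ, s / Λ ∈ Ioo d 1 := fun s hs =>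
    ⟨(lt_div_iff₀ Λ0).2 hs.1, (div_lt_one Λ0).2 hs.2⟩
  have hcd : ContinuousOn (fun s : ℝ => s / Λ) (Icc (d * Λ) Λ) :=
    (continuous_id.div_const Λ).continuousOn
  have u10 : u 1 = 0 := by rw [← h.ρ1]; exact (h.hpos 1 le_rfl (by omega)).2.2
  refine ⟨fun s => σ * u (s / Λ) / M, fun s => σ * u1 (s / Λ) / (M * Λ),
    ⟨hp, hp', by positivity, by nlinarith, ?_, ?_, ?_, ?_, ?_, ?_, ?_, ?_⟩, ?_⟩
  · exact ((h.uc.comp hcd hmaps).const_mul σ).div_const M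
  · exact ((h.u1c.comp hcd hmaps).const_mul σ).div_const (M * Λ)
  · intro s hs
    have hm := hmem s hs
    have h1 := (h.du (s / Λ) ⟨d0.trans hm.1, hm.2⟩).comp s ((hasDerivAt_id s).div_const Λ)
    refine ((h1.const_mul σ).div_const M).congr_deriv ?_
    field_simp
  · intro s hs
    have hm := hmem s hs
    have s0 : 0 < s := (by positivity : 0 < d * Λ).trans hs.1
    have h1 := (h.du1 (s / Λ) ⟨d0.trans hm.1, hm.2⟩).comp s ((hasDerivAt_id s).div_const Λ)
    refine ((h1.const_mul σ).div_const (M * Λ)).congr_deriv ?_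
    have hv := hposu (s / Λ) ⟨hm.1.le, hm.2⟩
    have e : (σ * u (s / Λ) / M) ^ p = |u (s / Λ)| ^ (p - 1) / Λ ^ 2 * (σ * u (s / Λ) / M) := by
      have : (σ * u (s / Λ) / M) ^ p =
          (σ * u (s / Λ) / M) ^ (p - 1) * (σ * u (s / Λ) / M) := by
        rw [← Real.rpow_add_one (by positivity)]; congr 1; ring
      rw [this, Real.div_rpow hv.le M0.le, hMq]
      congr 3
      rw [← abs_of_pos hv, abs_mul, hσ.2, one_mul]
    rw [e]
    field_simp
  · simp only [mul_div_assoc, div_self Λ0.ne', mul_one]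
    rw [← mul_div_assoc, ← hσM, div_self M0.ne']
  · simp only [mul_div_assoc, div_self Λ0.ne', mul_one]
    rw [h.u1d]; simp
  · simp [div_self Λ0.ne', u10]
  · intro s hs
    have := hposu (s / Λ) ⟨(le_div_iff₀ Λ0).2 hs.1, (div_lt_one Λ0).2 hs.2⟩
    positivity
  · simp only [div_self Λ0.ne']
    rw [div_pow, mul_pow, hσ.1]
    field_simp

/-- algebra of the rescaling -/
lemma rescale_alg {k : ℕ} {ε M Λ d w : ℝ} (M0 : 0 < M)
    (hΛ : Λ = M ^ ((pst k - ε - 1) / 2)) (c : ℝ) :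
    M ^ (-(ε * ((k : ℝ) + 1) / 2)) * (M ^ 2 * Λ ^ 2 * w ^ 2 - c * M ^ (pst k + 1 - ε) * d ^ (k + 3))
      = Λ ^ (k + 3) * w ^ 2 - c * (d * Λ) ^ (k + 3) := by
  have hps : pst k = 4 / ((k : ℝ) + 1) + 1 := by unfold pst; field_simp; ring
  have a1 : Λ ^ (k + 1) = M ^ (-(ε * ((k : ℝ) + 1) / 2)) * M ^ 2 := by
    rw [hΛ, ← Real.rpow_natCast _ (k + 1), ← Real.rpow_mul M0.le, ← Real.rpow_natCast M 2,
      ← Real.rpow_add M0]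
    congr 1
    rw [hps]; push_cast; field_simp; ring
  have a2 : M ^ (pst k + 1 - ε) = M ^ 2 * Λ ^ 2 := by
    rw [hΛ, ← Real.rpow_natCast (M ^ ((pst k - ε - 1) / 2)) 2, ← Real.rpow_mul M0.le, ← Real.rpow_natCast M 2,
      ← Real.rpow_add M0]
    congr 1
    push_cast; ring
  have a3 : Λ ^ (k + 3) = Λ ^ (k + 1) * Λ ^ 2 := by rw [← pow_add]
  rw [a2, mul_pow, a3, a1]
  ring

theorem main_k (k m : ℕ) (hm : 2 ≤ m)
    (u : ℝ → ℝ → ℝ) (ρ δ : ℝ → ℕ → ℝ)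
    (hu : ∀ ε ∈ Set.Ioo (0 : ℝ) (4 / ((k : ℝ) + 1)),
      DirichletData (k + 3) (pst k - ε) m (u ε) (ρ ε) (δ ε)) :
    Tendsto (fun ε : ℝ => (kappa (k + 3) * ε)⁻¹ *
        |u ε (δ ε 1)| ^ (-(ε * ((k : ℝ) + 1) / 2)) *
        (deriv (u ε) 1 ^ 2 -
          (2 / (pst k - ε + 1)) *
            |u ε (δ ε 1)| ^ (pst k + 1 - ε) * δ ε 1 ^ (k + 3)))
      (𝓝[>] (0 : ℝ))
      (𝓝 (((k : ℝ) + 3) ^ (((k : ℝ) + 1) / 2) * ((k : ℝ) + 1) ^ (((k : ℝ) + 5) / 2))) := by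
  have hev : ∀ᶠ ε in 𝓝[>] (0 : ℝ), ε ∈ Ioo (0 : ℝ) (4 / ((k : ℝ) + 1)) :=
    Ioo_mem_nhdsGT (by positivity)
  have P1 := one_lt_pst k
  have hps : pst k = 4 / ((k : ℝ) + 1) + 1 := by unfold pst; field_simp; ring
  set u1 : ℝ → ℝ → ℝ := fun ε => derivWithin (u ε) (Icc 0 1)
  have hR : ∀ ε ∈ Ioo (0 : ℝ) (4 / ((k : ℝ) + 1)),
      Rad k m (pst k - ε) (u ε) (u1 ε) (ρ ε) (δ ε 1) ∧ u1 ε 1 = deriv (u ε) 1 :=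
    fun ε hε => rad_of hm (hu ε hε)
  set M : ℝ → ℝ := fun ε => |u ε (δ ε 1)| with hM
  set Λ : ℝ → ℝ := fun ε => M ε ^ ((pst k - ε - 1) / 2) with hΛ
  have hex : ∀ ε, ∃ v w : ℝ → ℝ, ε ∈ Ioo (0 : ℝ) (4 / ((k : ℝ) + 1)) →
      Bub k (pst k - ε) (δ ε 1 * Λ ε) (Λ ε) v w ∧
        u1 ε 1 ^ 2 = M ε ^ 2 * Λ ε ^ 2 * w (Λ ε) ^ 2 := by
    intro ε
    by_cases hε : ε ∈ Ioo (0 : ℝ) (4 / ((k : ℝ) + 1))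
    · obtain ⟨v, w, h1⟩ := (hR ε hε).1.bub hm (by linarith [hε.2]) (by linarith [hε.1])
        (M := M ε) (Λ := Λ ε) rfl rfl
      exact ⟨v, w, fun _ => h1⟩
    · exact ⟨0, 0, fun h => absurd h hε⟩
  choose v w hvw using hex
  have ha : Tendsto (fun ε => δ ε 1 * Λ ε) (𝓝[>] 0) (𝓝 0) :=
    tend_a hm (hev.mono fun ε hε => (hR ε hε).1)
  have hI := tend_int (k := k) (a := fun ε => δ ε 1 * Λ ε) (b := Λ) (v := v) (w := w)
    (hev.mono fun ε hε => (hvw ε hε).1) ha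
  have hid : Tendsto (fun ε : ℝ => ε) (𝓝[>] 0) (𝓝 0) := tendsto_nhdsWithin_of_tendsto_nhds tendsto_id
  have hp : Tendsto (fun ε : ℝ => pst k - ε + 1) (𝓝[>] 0) (𝓝 (pst k + 1)) := by
    simpa using (hid.const_sub (pst k)).add_const 1
  have hc : Tendsto (fun ε : ℝ => (kappa (k + 3))⁻¹ * (((k : ℝ) + 1) / (pst k - ε + 1))) (𝓝[>] 0)
      (𝓝 ((kappa (k + 3))⁻¹ * (((k : ℝ) + 1) / (pst k + 1)))) :=
    ((tendsto_const_nhds (x := (k : ℝ) + 1)).div hp (by linarith)).const_mul _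
  have hfin := hc.mul hI
  have hval : (kappa (k + 3))⁻¹ * (((k : ℝ) + 1) / (pst k + 1)) *
      (∫ s in Ioi (0 : ℝ), s ^ (k + 2) * UU k s ^ (pst k + 1)) =
      ((k : ℝ) + 3) ^ (((k : ℝ) + 1) / 2) * ((k : ℝ) + 1) ^ (((k : ℝ) + 5) / 2) := by
    rw [int_UU]
    unfold kappa
    have g1 : 0 < Real.Gamma (((k : ℝ) + 3) / 2) := Real.Gamma_pos_of_pos (by positivity)
    have g2 : 0 < Real.Gamma ((k : ℝ) + 3) := Real.Gamma_pos_of_pos (by positivity)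
    push_cast
    rw [show (k : ℝ) + 3 - 2 = k + 1 by ring,
      show pst k + 1 = 2 * ((k : ℝ) + 3) / (k + 1) by unfold pst; field_simp; ring,
      Real.mul_rpow (by positivity) (by positivity)]
    rw [show ((k : ℝ) + 3) ^ (((k : ℝ) + 3) / 2) = (k + 3) ^ (((k : ℝ) + 1) / 2) * (k + 3) by
        rw [← Real.rpow_add_one (by positivity)]; congr 1; ring,
      show ((k : ℝ) + 1) ^ (((k : ℝ) + 5) / 2) = (k + 1) ^ (((k : ℝ) + 3) / 2) * (k + 1) by
        rw [← Real.rpow_add_one (by positivity)]; congr 1; ring]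
    generalize Real.Gamma (((k : ℝ) + 3) / 2) = G1 at *
    generalize Real.Gamma ((k : ℝ) + 3) = G2 at *
    generalize ((k : ℝ) + 3) ^ (((k : ℝ) + 1) / 2) = X1
    generalize ((k : ℝ) + 1) ^ (((k : ℝ) + 3) / 2) = X2
    field_simp
    try ring
  rw [hval] at hfin
  refine hfin.congr' ?_
  filter_upwards [hev] with ε hε
  obtain ⟨hB, hw⟩ := hvw ε hε
  obtain ⟨hRr, h1⟩ := hR ε hε
  have M0 : 0 < M ε := abs_pos.2 (hRr.ud _ ⟨le_rfl, hRr.d1⟩)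
  have ε0 := hε.1
  have hpp : 0 < pst k - ε + 1 := by linarith [hε.2]
  rw [← h1, hw, mul_assoc ((kappa (k + 3) * ε)⁻¹), rescale_alg M0 rfl, hB.poho]
  generalize (∫ s in (δ ε 1 * Λ ε)..(Λ ε), s ^ (k + 2) * v ε s ^ (pst k - ε + 1)) = I
  have hco : 2 * (((k : ℝ) + 3) / (pst k - ε + 1)) - (k + 1) = ε * ((k + 1) / (pst k - ε + 1)) := by
    field_simp
    rw [hps]
    field_simp
    ring
  rw [hco, mul_inv]
  generalize kappa (k + 3) = κ
  field_simp

/-- **Lemma 4.5.** For radial Dirichlet solutions with `m-1` interior zeros (largest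
critical point `δ_{1,ε}`):
`(κ_n ε)^{-1} |u_ε(δ_{1,ε})|^{-ε(n-2)/2} [ u_ε'(1)² - ((n-2)/(n-ε(n-2)/2)) |u_ε(δ_{1,ε})|^{2n/(n-2)-ε} δ_{1,ε}^n ]
  → n^{(n-2)/2} (n-2)^{(n+2)/2}` as `ε → 0⁺`. -/
theorem dirichlet_pohozaev_limit (n m : ℕ) (hn : 3 ≤ n) (hm : 2 ≤ m)
    (u : ℝ → ℝ → ℝ) (ρ δ : ℝ → ℕ → ℝ)
    (hu : ∀ ε ∈ Set.Ioo (0 : ℝ) (4 / ((n : ℝ) - 2)),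
      DirichletData n (pEps n ε) m (u ε) (ρ ε) (δ ε)) :
    Tendsto (fun ε : ℝ => (kappa n * ε)⁻¹ *
        |u ε (δ ε 1)| ^ (-(ε * ((n : ℝ) - 2) / 2)) *
        (deriv (u ε) 1 ^ 2 -
          (((n : ℝ) - 2) / ((n : ℝ) - ε * ((n : ℝ) - 2) / 2)) *
            |u ε (δ ε 1)| ^ (2 * (n : ℝ) / ((n : ℝ) - 2) - ε) * δ ε 1 ^ n))
      (𝓝[>] (0 : ℝ))
      (𝓝 ((n : ℝ) ^ (((n : ℝ) - 2) / 2) * ((n : ℝ) - 2) ^ (((n : ℝ) + 2) / 2))) := by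
  obtain ⟨k, rfl⟩ : ∃ k, n = k + 3 := ⟨n - 3, by omega⟩
  have hc : ((k + 3 : ℕ) : ℝ) = (k : ℝ) + 3 := by push_cast; ring
  have hp : ∀ ε, pEps (k + 3) ε = pst k - ε := by
    intro ε
    unfold pEps pst
    rw [hc]
    congr 2 <;> ring
  have h2 : ((k + 3 : ℕ) : ℝ) - 2 = (k : ℝ) + 1 := by rw [hc]; ring
  have h := main_k k m hm u ρ δ (by
    intro ε hε
    rw [← hp]
    exact hu ε (by rw [h2]; exact hε))
  rw [h2, show (((k + 3 : ℕ) : ℝ) + 2) = (k : ℝ) + 5 by rw [hc]; ring, hc]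
  refine h.congr' ?_
  have hev : ∀ᶠ ε in 𝓝[>] (0 : ℝ), ε ∈ Ioo (0 : ℝ) (4 / ((k : ℝ) + 1)) :=
    Ioo_mem_nhdsGT (by positivity)
  filter_upwards [hev] with ε hε
  have e1 : pst k + 1 - ε = 2 * ((k : ℝ) + 3) / ((k : ℝ) + 1) - ε := by
    unfold pst; field_simp; ring
  have e3 : ε * ((k : ℝ) + 1) < 4 := (lt_div_iff₀ (by positivity)).1 hε.2
  have k0 : (0 : ℝ) ≤ k := Nat.cast_nonneg k
  have e2 : 2 / (pst k - ε + 1) = ((k : ℝ) + 1) / ((k : ℝ) + 3 - ε * ((k : ℝ) + 1) / 2) := by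
    have hne : (k : ℝ) + 3 - ε * ((k : ℝ) + 1) / 2 ≠ 0 := by nlinarith
    have : pst k - ε + 1 = 2 * ((k : ℝ) + 3 - ε * ((k : ℝ) + 1) / 2) / ((k : ℝ) + 1) := by
      unfold pst; field_simp; ring
    rw [this]
    field_simp
  rw [e1, e2]
end
end
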